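/- Let m > 1 and r ≥ 2 be integers, and set n = mr + 1. Let Λ_r(m) = Λ_{r,1}(m) be the algebra of m-quasi-invariants in variables y_1,...,y_r, z, and let P_{r;m}(t) = Σ_{k≥0} dim_C Λ_r(m)^{(k)} t^k be its Hilbert series, where Λ_r(m)^{(k)} is the degree-k homogeneous component. Then P_{r;m}(t) is a rational function of t satisfying the functional equation P_{r;m}(t^{−1}) = (−1)^{r+1} t^{n(1−r)} P_{r;m}(t); consequently (by Stanley's criterion, since Λ_r(m) is a Cohen–Macaulay domain), the graded algebra Λ_r(m) is Gorenstein. -/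

import Mathlib

open MvPolynomial

set_option synthInstance.maxHeartbeats 1000000
set_option maxHeartbeats 1000000

noncomputable section

/-- The polynomial ring `ℂ[y_1,...,y_r,z]`, with `y_j = X (inl j)`, `z = X (inr ())`. -/
abbrev Rr1 (r : ℕ) := MvPolynomial (Fin r ⊕ Unit) ℂ

/-- The algebra `Λ_r(m) = Λ_{r,1}(m)` of `m`-quasi-invariants in `y_1,...,y_r,z`:
polynomials `P` with `((m∂_z − ∂_{y_j})P)|_{y_j = z} = 0` for all `j`, and such that for
all `j ≠ k` the difference of `P` and `P` with `y_j, y_k` swapped is divisible by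
`(y_j − y_k)^{2m+1}`. -/
def QI1 (r m : ℕ) : Set (Rr1 r) :=
  {f | (∀ (j : Fin r), ∀ v : Fin r ⊕ Unit → ℂ,
      v (Sum.inl j) = v (Sum.inr ()) →
      eval v (C (m : ℂ) * pderiv (Sum.inr ()) f - pderiv (Sum.inl j) f) = 0) ∧
    ∀ j k : Fin r, j ≠ k → ∃ g : Rr1 r,
      f - rename (Sum.map (⇑(Equiv.swap j k)) id) f =
        (X (Sum.inl j) - X (Sum.inl k)) ^ (2 * m + 1) * g}

/-- The dimension of the degree-`k` homogeneous component of `Λ_r(m)`. -/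
def hd (r m k : ℕ) : ℕ :=
  Module.finrank ℂ (Submodule.span ℂ {f : Rr1 r | f ∈ QI1 r m ∧ f.IsHomogeneous k})

section DiffOps

variable {σ : Type*} [Fintype σ]

omit [Fintype σ] in
lemma pderiv_comm (s t : σ) (f : MvPolynomial σ ℂ) :
    pderiv s (pderiv t f) = pderiv t (pderiv s f) := by
  classical
  have h : ⁅(pderiv s : Derivation ℂ (MvPolynomial σ ℂ) (MvPolynomial σ ℂ)), pderiv (R := ℂ) t⁆ = 0 := by
    refine MvPolynomial.derivation_ext fun i => ?_
    rw [Derivation.commutator_apply]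
    simp only [pderiv_X, Pi.single_apply]
    split_ifs <;> simp
  have h2 := congrArg (fun D => D f) h
  simpa [Derivation.commutator_apply, sub_eq_zero] using h2

/-- The weighted Laplacian `Σ γ_s ∂_s²`. -/
def lapl (γ : σ → ℝ) : MvPolynomial σ ℂ →ₗ[ℂ] MvPolynomial σ ℂ :=
  ∑ s, (γ s : ℂ) • ((pderiv s).toLinearMap ∘ₗ (pderiv s).toLinearMap)

/-- The weighted gradient pairing with `u`, as a derivation. -/
def grad (γ : σ → ℝ) (u : MvPolynomial σ ℂ) :
    Derivation ℂ (MvPolynomial σ ℂ) (MvPolynomial σ ℂ) :=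
  ∑ s, (C (γ s : ℂ) * pderiv s u) • pderiv s

/-- The Euler operator `Σ X_s ∂_s`. -/
def eul : MvPolynomial σ ℂ →ₗ[ℂ] MvPolynomial σ ℂ :=
  ∑ s, (LinearMap.mulLeft ℂ (X s)) ∘ₗ (pderiv s).toLinearMap

lemma lapl_apply (γ : σ → ℝ) (f : MvPolynomial σ ℂ) :
    lapl γ f = ∑ s, C (γ s : ℂ) * pderiv s (pderiv s f) := by
  simp [lapl, LinearMap.sum_apply, MvPolynomial.smul_eq_C_mul]

lemma grad_apply (γ : σ → ℝ) (u f : MvPolynomial σ ℂ) :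
    grad γ u f = ∑ s, C (γ s : ℂ) * pderiv s u * pderiv s f := by
  have h := congrFun (map_sum Derivation.coeFnAddMonoidHom
    (fun s => (C (γ s : ℂ) * pderiv s u) • pderiv s) Finset.univ) f
  simp only [Finset.sum_apply, Derivation.coeFnAddMonoidHom_apply, Derivation.smul_apply,
    smul_eq_mul] at h
  exact h

lemma grad_comm (γ : σ → ℝ) (u v : MvPolynomial σ ℂ) : grad γ u v = grad γ v u := by
  simp only [grad_apply]
  exact Finset.sum_congr rfl fun s _ => by ring

lemma eul_apply (f : MvPolynomial σ ℂ) : eul f = ∑ s, X s * pderiv s f := by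
  simp [eul, LinearMap.sum_apply]

lemma lapl_mul (γ : σ → ℝ) (u v : MvPolynomial σ ℂ) :
    lapl γ (u * v) = u * lapl γ v + v * lapl γ u + 2 * grad γ u v := by
  simp only [lapl_apply, grad_apply, Finset.mul_sum, ← Finset.sum_add_distrib]
  refine Finset.sum_congr rfl fun s _ => ?_
  simp only [pderiv_mul, map_add]
  ring

lemma eul_mul (u v : MvPolynomial σ ℂ) : eul (u * v) = u * eul v + v * eul u := by
  simp only [eul_apply, Finset.mul_sum, ← Finset.sum_add_distrib]
  refine Finset.sum_congr rfl fun s _ => ?_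
  simp only [pderiv_mul]
  ring

lemma eul_hom {f : MvPolynomial σ ℂ} {n : ℕ} (h : f.IsHomogeneous n) : eul f = (n : ℂ) • f := by
  rw [eul_apply, h.sum_X_mul_pderiv, Nat.cast_smul_eq_nsmul]

lemma eul_homComp (f : MvPolynomial σ ℂ) (n : ℕ) :
    homogeneousComponent n (eul f) = (n : ℂ) • homogeneousComponent n f := by
  conv_lhs => rw [← sum_homogeneousComponent f, map_sum, map_sum]
  have : ∀ i ∈ Finset.range (f.totalDegree + 1),
      homogeneousComponent n (eul (homogeneousComponent i f)) =
      if i = n then (n : ℂ) • homogeneousComponent n f else 0 := by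
    intro i _
    rw [eul_hom (homogeneousComponent_isHomogeneous i f), map_smul,
      homogeneousComponent_of_mem (homogeneousComponent_mem i f)]
    by_cases h : i = n
    · subst h; simp
    · simp [h, Ne.symm h]
  rw [Finset.sum_congr rfl this, Finset.sum_ite_eq']
  split_ifs with h
  · rfl
  · rw [homogeneousComponent_eq_zero, smul_zero]
    simpa [Nat.lt_succ_iff] using h

lemma homComp_of_eigen {f : MvPolynomial σ ℂ} {c : ℂ} (h : eul f = c • f) (n : ℕ)
    (hn : (n : ℂ) ≠ c) : homogeneousComponent n f = 0 := by
  have := eul_homComp f n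
  rw [h, map_smul] at this
  have h2 : ((n : ℂ) - c) • homogeneousComponent n f = 0 := by rw [sub_smul, ← this, sub_self]
  exact (smul_eq_zero.mp h2).resolve_left (sub_ne_zero.mpr hn)

lemma isHomogeneous_of_eigen {f : MvPolynomial σ ℂ} {n : ℕ} (h : eul f = (n : ℂ) • f) :
    f.IsHomogeneous n := by
  rw [← sum_homogeneousComponent f]
  refine IsHomogeneous.sum _ _ _ fun i _ => ?_
  by_cases hi : i = n
  · subst hi; exact homogeneousComponent_isHomogeneous _ _
  · rw [homComp_of_eigen h i (by exact_mod_cast hi)]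
    exact isHomogeneous_zero _ _ _

lemma eq_zero_of_eigen {f : MvPolynomial σ ℂ} {c : ℂ} (h : eul f = c • f)
    (hc : ∀ n : ℕ, (n : ℂ) ≠ c) : f = 0 := by
  rw [← sum_homogeneousComponent f]
  exact Finset.sum_eq_zero fun i _ => homComp_of_eigen h i (hc i)

lemma eul_pderiv (s : σ) (f : MvPolynomial σ ℂ) :
    eul (pderiv s f) = pderiv s (eul f) - pderiv s f := by
  classical
  simp only [eul_apply, map_sum, pderiv_mul, pderiv_X, Finset.sum_add_distrib]
  have h1 : ∑ x, (Pi.single s 1 : σ → MvPolynomial σ ℂ) x * pderiv x f = pderiv s f := by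
    rw [Finset.sum_eq_single s] <;> simp +contextual
  have h2 : ∀ x, pderiv s (pderiv x f) = pderiv x (pderiv s f) := fun x => pderiv_comm s x f
  simp only [h1, h2]
  ring

lemma eul_lapl (γ : σ → ℝ) (f : MvPolynomial σ ℂ) :
    eul (lapl γ f) = lapl γ (eul f) - 2 * lapl γ f := by
  have hC : ∀ (c : ℂ) (g : MvPolynomial σ ℂ), eul (C c * g) = C c * eul g := fun c g => by
    rw [← smul_eq_C_mul, map_smul, smul_eq_C_mul]
  simp only [lapl_apply, map_sum, hC, eul_pderiv, map_sub, Finset.mul_sum, ← Finset.sum_sub_distrib]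
  exact Finset.sum_congr rfl fun s _ => by ring

lemma eul_grad (γ : σ → ℝ) (u v : MvPolynomial σ ℂ) :
    eul (grad γ u v) = grad γ (eul u) v + grad γ u (eul v) - 2 * grad γ u v := by
  have hC : ∀ (c : ℂ) (g : MvPolynomial σ ℂ), eul (C c * g) = C c * eul g := fun c g => by
    rw [← smul_eq_C_mul, map_smul, smul_eq_C_mul]
  simp only [grad_apply, map_sum, hC, eul_mul, mul_assoc, eul_pderiv, Finset.mul_sum,
    ← Finset.sum_sub_distrib, ← Finset.sum_add_distrib]
  exact Finset.sum_congr rfl fun s _ => by ring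

end DiffOps

section QSystems

variable {σ : Type*} [Fintype σ]

lemma eq_C_of_pderiv_eq_zero {f : MvPolynomial σ ℂ} (h : ∀ s, pderiv s f = 0) :
    f = C (coeff 0 f) := by
  have h1 : f.IsHomogeneous 0 := by
    refine isHomogeneous_of_eigen ?_
    simp [eul_apply, h]
  rw [← totalDegree_eq_zero_iff_eq_C]
  exact Nat.le_zero.mp h1.totalDegree_le

omit [Fintype σ] in
lemma totalDegree_pderiv_lt {f : MvPolynomial σ ℂ} {s : σ} (h : pderiv s f ≠ 0) :
    (pderiv s f).totalDegree < f.totalDegree := by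
  classical
  obtain ⟨m, hm, hm2⟩ := Finset.exists_mem_eq_sup _ (support_nonempty.mpr h)
    (fun m => m.sum fun _ e => e)
  rw [totalDegree, hm2]
  rw [mem_support_iff, coeff_pderiv] at hm
  have h3 := le_totalDegree (p := f) (s := m + Finsupp.single s 1)
    (by rw [mem_support_iff]; exact left_ne_zero_of_mul hm)
  rw [Finsupp.sum_add_index' (by simp) (by simp)] at h3
  simp at h3
  omega

/-- A nonzero polynomial has a nonzero constant among its iterated partial derivatives. -/
lemma exists_const_of_pderiv_closed (P : MvPolynomial σ ℂ → Prop)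
    (hP : ∀ f s, P f → P (pderiv s f)) {f : MvPolynomial σ ℂ} (hf : P f) (h0 : f ≠ 0) :
    ∃ c : ℂ, c ≠ 0 ∧ P (C c) := by
  induction hn : f.totalDegree using Nat.strong_induction_on generalizing f with
  | _ n ih =>
    by_cases h : ∀ s, pderiv s f = 0
    · have := eq_C_of_pderiv_eq_zero h
      refine ⟨coeff 0 f, fun hc => h0 (by rw [this, hc, C_0]), this ▸ hf⟩
    · push Not at h
      obtain ⟨s, hs⟩ := h
      exact ih _ (hn ▸ totalDegree_pderiv_lt hs) (hP _ s hf) hs rfl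

/-- A subalgebra with a Laplace-type operator obtained from `κ`. -/
structure QSys (σ : Type*) [Fintype σ] where
  γ : σ → ℝ
  γ_pos : ∀ s, 0 < γ s
  κ : MvPolynomial σ ℂ
  κ_mem : κ ∈ Submonoid.closure {p : MvPolynomial σ ℂ | ∃ a b, a ≠ b ∧ p = X a - X b}
  Q : Subalgebra ℂ (MvPolynomial σ ℂ)
  κ_mul : ∀ w, κ * w ∈ Q
  hom : ∀ f ∈ Q, ∀ n, homogeneousComponent n f ∈ Q
  L : MvPolynomial σ ℂ →ₗ[ℂ] MvPolynomial σ ℂ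
  L_mem : ∀ f ∈ Q, L f ∈ Q
  L_spec : ∀ f ∈ Q, κ * L f = κ * lapl γ f - grad γ κ f

namespace QSys

variable (S : QSys σ)

/-- A functional satisfying Gaussian integration by parts. -/
structure Gauss where
  J : MvPolynomial σ ℂ →ₗ[ℂ] ℂ
  ibp : ∀ s w, J (S.κ * pderiv s w - w * pderiv s S.κ) = (S.γ s : ℂ)⁻¹ * J (S.κ * (X s * w))
  ne : J (S.κ * S.κ) ≠ 0

variable {S}

omit [Fintype σ] in
lemma closure_hom {κ : MvPolynomial σ ℂ}
    (h : κ ∈ Submonoid.closure {p : MvPolynomial σ ℂ | ∃ a b, a ≠ b ∧ p = X a - X b}) :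
    κ ≠ 0 ∧ ∃ n, κ.IsHomogeneous n := by
  induction h using Submonoid.closure_induction with
  | mem x hx =>
    obtain ⟨a, b, hab, rfl⟩ := hx
    refine ⟨fun h => hab ?_, 1, (isHomogeneous_X _ _).sub (isHomogeneous_X _ _)⟩
    exact X_injective (sub_eq_zero.mp h)
  | one => exact ⟨one_ne_zero, 0, isHomogeneous_one _ _⟩
  | mul x y _ _ hx hy =>
    obtain ⟨h1, n, hn⟩ := hx
    obtain ⟨h2, k, hk⟩ := hy
    exact ⟨mul_ne_zero h1 h2, n + k, hn.mul hk⟩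

lemma κ_ne : S.κ ≠ 0 := (closure_hom S.κ_mem).1

lemma eul_L {f : MvPolynomial σ ℂ} (hf : f ∈ S.Q) (hEf : eul f ∈ S.Q) :
    eul (S.L f) = S.L (eul f) - 2 * S.L f := by
  obtain ⟨h0, n, hn⟩ := closure_hom S.κ_mem
  have hE := eul_hom hn
  apply mul_left_cancel₀ h0
  have h1 := congrArg eul (S.L_spec f hf)
  have h2 := S.L_spec _ hEf
  have h3 := S.L_spec _ hf
  simp only [eul_mul, map_sub, eul_lapl, eul_grad, hE] at h1
  have h4 : grad S.γ ((n : ℂ) • S.κ) f = (n : ℂ) • grad S.γ S.κ f := by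
    rw [grad_comm, Derivation.map_smul, grad_comm]
  rw [h4] at h1
  simp only [smul_eq_C_mul] at h1
  linear_combination h1 - h2 + (2 - C (n : ℂ)) * h3

lemma eul_mem {f : MvPolynomial σ ℂ} (hf : f ∈ S.Q) : eul f ∈ S.Q := by
  rw [← sum_homogeneousComponent (eul f)]
  refine Subalgebra.sum_mem _ fun i _ => ?_
  rw [eul_homComp]
  exact Subalgebra.smul_mem _ (S.hom f hf i) _

lemma Gauss.symm_aux (G : S.Gauss) {u : MvPolynomial σ ℂ} (hu : u ∈ S.Q)
    (v : MvPolynomial σ ℂ) :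
    G.J (S.κ * (v * (eul u - S.L u))) = G.J (S.κ * grad S.γ u v) := by
  have h1 : ∀ s, G.J (C (S.γ s : ℂ) * (S.κ * pderiv s (v * pderiv s u) -
      v * pderiv s u * pderiv s S.κ)) = G.J (S.κ * (X s * (v * pderiv s u))) := by
    intro s
    rw [← smul_eq_C_mul, map_smul, G.ibp, smul_eq_mul, mul_inv_cancel_left₀]
    exact_mod_cast (S.γ_pos s).ne'
  have h2 := Finset.sum_congr (rfl : (Finset.univ : Finset σ) = Finset.univ) fun s _ => h1 s
  rw [← map_sum, ← map_sum] at h2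
  have h3 : S.κ * (v * (eul u - S.L u)) =
      ∑ x, S.κ * (X x * (v * pderiv x u)) - v * (S.κ * S.L u) := by
    have hs : ∑ x, S.κ * (X x * (v * pderiv x u)) = S.κ * (v * ∑ x, X x * pderiv x u) := by
      rw [Finset.mul_sum, Finset.mul_sum]
      exact Finset.sum_congr rfl fun s _ => by ring
    rw [eul_apply, hs]
    ring
  rw [h3, map_sub, sub_eq_iff_eq_add, ← map_add, S.L_spec u hu]
  rw [← h2]
  refine congrArg G.J ?_
  simp only [grad_apply, lapl_apply, Finset.mul_sum, mul_sub, ← Finset.sum_sub_distrib,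
    ← Finset.sum_add_distrib]
  refine Finset.sum_congr rfl fun s _ => ?_
  simp only [pderiv_mul]
  ring

lemma Gauss.symm (G : S.Gauss) {u v : MvPolynomial σ ℂ} (hu : u ∈ S.Q) (hv : v ∈ S.Q) :
    G.J (S.κ * (v * (eul u - S.L u))) = G.J (S.κ * (u * (eul v - S.L v))) := by
  rw [G.symm_aux hu, G.symm_aux hv, grad_comm]

lemma Gauss.nondeg (G : S.Gauss) {u : MvPolynomial σ ℂ}
    (hu : ∀ w, G.J (S.κ * (S.κ * w * u)) = 0) : u = 0 := by
  by_contra h0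
  have hP : ∀ (f : MvPolynomial σ ℂ) (s : σ), (∀ w, G.J (S.κ * (S.κ * w * f)) = 0) →
      ∀ w, G.J (S.κ * (S.κ * w * pderiv s f)) = 0 := by
    intro f s hf w
    have h1 := G.ibp s (S.κ * w * f)
    have h2 : S.κ * (X s * (S.κ * w * f)) = S.κ * (S.κ * (X s * w) * f) := by ring
    have h3 : S.κ * pderiv s (S.κ * w * f) - S.κ * w * f * pderiv s S.κ =
        S.κ * (S.κ * w * pderiv s f) + S.κ * (S.κ * (pderiv s w) * f) := by
      simp only [pderiv_mul]; ring
    rw [h2, hf, h3, map_add, hf] at h1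
    simpa using h1
  obtain ⟨c, hc, h⟩ := exists_const_of_pderiv_closed
    (fun u => ∀ w, G.J (S.κ * (S.κ * w * u)) = 0) hP hu h0
  refine G.ne ?_
  have := h (C c⁻¹)
  rwa [mul_assoc S.κ (C c⁻¹), ← C_mul, inv_mul_cancel₀ hc, C_1, mul_one] at this

end QSys
end QSystems

section GradedForm

variable {σ : Type*} [Fintype σ]

namespace QSys

variable {S : QSys σ}

variable (S) in
/-- The homogeneous component of degree `k` of the quasi-invariants. -/
def Qk (k : ℕ) : Submodule ℂ (MvPolynomial σ ℂ) :=
  Subalgebra.toSubmodule S.Q ⊓ homogeneousSubmodule σ ℂ k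

variable (S) in
/-- The quasi-invariants of degree less than `k`. -/
def Low (k : ℕ) : Submodule ℂ (MvPolynomial σ ℂ) :=
  Subalgebra.toSubmodule S.Q ⊓ ⨅ n : {n : ℕ // k ≤ n}, LinearMap.ker (homogeneousComponent n.1)

lemma mem_Low {k : ℕ} {f : MvPolynomial σ ℂ} :
    f ∈ S.Low k ↔ f ∈ S.Q ∧ ∀ n, k ≤ n → homogeneousComponent n f = 0 := by
  simp [Low]

lemma mem_Qk {k : ℕ} {f : MvPolynomial σ ℂ} : f ∈ S.Qk k ↔ f ∈ S.Q ∧ f.IsHomogeneous k := by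
  simp [Qk]

lemma hc_mem_Qk {f : MvPolynomial σ ℂ} (hf : f ∈ S.Q) (k : ℕ) :
    homogeneousComponent k f ∈ S.Qk k :=
  mem_Qk.mpr ⟨S.hom f hf k, homogeneousComponent_isHomogeneous k f⟩

lemma Low_eq_sum {k : ℕ} {f : MvPolynomial σ ℂ} (hf : f ∈ S.Low k) :
    f = ∑ l ∈ Finset.range k, homogeneousComponent l f := by
  have hf := mem_Low.mp hf
  conv_lhs => rw [← sum_homogeneousComponent f]
  have h1 : ∀ n, k ≤ n → homogeneousComponent n f = 0 := hf.2
  have h2 : ∀ n, f.totalDegree + 1 ≤ n → homogeneousComponent n f = 0 := fun n hn =>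
    homogeneousComponent_eq_zero _ _ hn
  rcases le_total k (f.totalDegree + 1) with h | h
  · exact (Finset.sum_subset (Finset.range_mono h) fun n _ hn =>
      h1 n (by simpa using hn)).symm
  · exact Finset.sum_subset (Finset.range_mono h) fun n _ hn => h2 n (by simpa using hn)

lemma mem_Low_of_eigen {a : ℕ} {c : ℂ} {w : MvPolynomial σ ℂ} (hw : w ∈ S.Q)
    (h : eul w = c • w) (hc : ∀ n : ℕ, a ≤ n → (n : ℂ) ≠ c) : w ∈ S.Low a :=
  mem_Low.mpr ⟨hw, fun n hn => homComp_of_eigen h n (hc n hn)⟩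

lemma eul_L_eigen {f : MvPolynomial σ ℂ} {c : ℂ} (hf : f ∈ S.Q) (h : eul f = c • f) :
    eul (S.L f) = (c - 2) • S.L f := by
  rw [eul_L hf (eul_mem hf), h, map_smul, sub_smul]
  congr 1
  rw [← Nat.cast_ofNat (R := MvPolynomial σ ℂ), ← Nat.cast_ofNat (R := ℂ),
    Nat.cast_smul_eq_nsmul, nsmul_eq_mul]

lemma Lpow_mem {f : MvPolynomial σ ℂ} (hf : f ∈ S.Q) (j : ℕ) : (S.L ^ j) f ∈ S.Q := by
  induction j with
  | zero => simpa
  | succ j ih => rw [pow_succ']; exact S.L_mem _ ih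

lemma eul_Lpow {f : MvPolynomial σ ℂ} {c : ℂ} (hf : f ∈ S.Q) (h : eul f = c • f) (j : ℕ) :
    eul ((S.L ^ j) f) = (c - 2 * j) • (S.L ^ j) f := by
  induction j with
  | zero => simpa
  | succ j ih =>
    rw [pow_succ', Module.End.mul_apply, eul_L_eigen (Lpow_mem hf j) ih]
    congr 1
    push_cast; ring

variable (S) in
/-- The truncated exponential of `-L/2`. -/
def til (k : ℕ) : MvPolynomial σ ℂ →ₗ[ℂ] MvPolynomial σ ℂ :=
  ∑ j ∈ Finset.range (k + 1), ((-1 / 2 : ℂ) ^ j / (j.factorial : ℂ)) • S.L ^ j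

lemma til_apply (k : ℕ) (f : MvPolynomial σ ℂ) : S.til k f =
    ∑ j ∈ Finset.range (k + 1), ((-1 / 2 : ℂ) ^ j / (j.factorial : ℂ)) • (S.L ^ j) f := by
  simp [til, LinearMap.sum_apply]

lemma til_mem {f : MvPolynomial σ ℂ} (hf : f ∈ S.Q) (k : ℕ) : S.til k f ∈ S.Q := by
  rw [til_apply]
  exact Subalgebra.sum_mem _ fun j _ => Subalgebra.smul_mem _ (Lpow_mem hf j) _

lemma til_eigen {k : ℕ} {f : MvPolynomial σ ℂ} (hf : f ∈ S.Qk k) :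
    eul (S.til k f) - S.L (S.til k f) = (k : ℂ) • S.til k f := by
  obtain ⟨hQ, hk⟩ := mem_Qk.mp hf
  have hE := eul_hom hk
  have key : ∀ n : ℕ, eul (∑ j ∈ Finset.range n,
      ((-1 / 2 : ℂ) ^ j / (j.factorial : ℂ)) • (S.L ^ j) f) -
      S.L (∑ j ∈ Finset.range n, ((-1 / 2 : ℂ) ^ j / (j.factorial : ℂ)) • (S.L ^ j) f) =
      (k : ℂ) • (∑ j ∈ Finset.range n, ((-1 / 2 : ℂ) ^ j / (j.factorial : ℂ)) • (S.L ^ j) f) +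
      ((-1 / 2 : ℂ) ^ n * (2 * n) / (n.factorial : ℂ)) • (S.L ^ n) f := by
    intro n
    induction n with
    | zero => simp
    | succ n ih =>
      rw [Finset.sum_range_succ, map_add, map_add, smul_add, map_smul, map_smul,
        eul_Lpow hQ hE, pow_succ' S.L, Module.End.mul_apply]
      have h1 : ((n + 1).factorial : ℂ) = (n + 1) * n.factorial := by
        rw [Nat.factorial_succ]; push_cast; ring
      have h2 : (n.factorial : ℂ) ≠ 0 := by exact_mod_cast n.factorial_ne_zero
      have h3 : (n + 1 : ℂ) ≠ 0 := by exact_mod_cast n.succ_ne_zero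
      have h4 : ((-1 / 2 : ℂ) ^ (n + 1) * (2 * ((n + 1 : ℕ) : ℂ)) / ((n + 1).factorial : ℂ)) =
          - ((-1 / 2 : ℂ) ^ n / (n.factorial : ℂ)) := by
        rw [h1]; push_cast; field_simp; ring
      have h5 : (-1 / 2 : ℂ) ^ n * (2 * n) / (n.factorial : ℂ) =
        ((-1 / 2 : ℂ) ^ n / (n.factorial : ℂ)) * (2 * n) := by ring
      rw [h4]
      rw [h5] at ih
      linear_combination (norm := module) ih
  rw [til_apply, key (k + 1)]
  have : (S.L ^ (k + 1)) f = 0 := by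
    refine eq_zero_of_eigen (eul_Lpow hQ hE (k + 1)) fun n hn => ?_
    have : (n : ℂ) + 2 * (k + 1) = k := by rw [hn]; push_cast; ring
    have : n + 2 * (k + 1) = k := by exact_mod_cast this
    omega
  rw [this, smul_zero, add_zero]

lemma til_sub {k : ℕ} {f : MvPolynomial σ ℂ} (hf : f ∈ S.Qk k) :
    S.til k f - f ∈ S.Low k := by
  obtain ⟨hQ, hk⟩ := mem_Qk.mp hf
  rw [til_apply, Finset.sum_range_succ']
  simp only [pow_zero, Nat.factorial_zero, Nat.cast_one, div_one, one_smul, Module.End.one_apply,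
    add_sub_cancel_right]
  refine Submodule.sum_mem _ fun j _ => Submodule.smul_mem _ _ ?_
  refine mem_Low_of_eigen (Lpow_mem hQ _) (eul_Lpow hQ (eul_hom hk) _) fun n hn h => ?_
  have : (n : ℂ) + 2 * (j + 1) = k := by rw [h]; push_cast; ring
  have : n + 2 * (j + 1) = k := by exact_mod_cast this
  omega

lemma Gauss.orth (G : S.Gauss) {u v : MvPolynomial σ ℂ} (hu : u ∈ S.Q) (hv : v ∈ S.Q)
    {a b : ℂ} (ha : eul u - S.L u = a • u) (hb : eul v - S.L v = b • v) (hab : a ≠ b) :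
    G.J (S.κ * (v * u)) = 0 := by
  have h := G.symm hu hv
  rw [ha, hb, mul_smul_comm, mul_smul_comm, mul_smul_comm, mul_smul_comm, map_smul, map_smul,
    mul_comm u v, ← sub_eq_zero, ← sub_smul] at h
  exact (smul_eq_zero.mp h).resolve_left (sub_ne_zero.mpr hab)

lemma Gauss.orth_Low (G : S.Gauss) {k : ℕ} {v : MvPolynomial σ ℂ} (hv : v ∈ S.Q)
    (hk : eul v - S.L v = (k : ℂ) • v) (l : ℕ)
    (h : l ≤ k ∨ ∀ u ∈ S.Qk k, G.J (S.κ * (v * u)) = 0) :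
    ∀ u ∈ S.Low l, G.J (S.κ * (v * u)) = 0 := by
  induction l with
  | zero =>
    intro u hu
    rw [Low_eq_sum hu]; simp
  | succ l ih =>
    have ih' := ih (h.imp_left fun h => by omega)
    intro u hu
    have huQ := (mem_Low.mp hu).1
    have h1 : u - homogeneousComponent l u ∈ S.Low l := by
      refine mem_Low.mpr ⟨Subalgebra.sub_mem _ huQ (S.hom u huQ l), fun n hn => ?_⟩
      rw [map_sub]
      rcases eq_or_lt_of_le hn with rfl | hn
      · rw [homogeneousComponent_eq_self (homogeneousComponent_mem _ _), sub_self]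
      · rw [(mem_Low.mp hu).2 n hn, homogeneousComponent_of_mem (homogeneousComponent_mem l u),
          if_neg (by omega), sub_zero]
    have h2 : G.J (S.κ * (v * homogeneousComponent l u)) = 0 := by
      by_cases hl : l = k
      · subst hl
        exact (h.resolve_left (by omega)) _ (hc_mem_Qk huQ _)
      · have hm := hc_mem_Qk huQ l
        have h3 := G.orth (til_mem (S.hom u huQ l) l) hv (til_eigen hm) hk (by exact_mod_cast hl)
        have h4 := ih' _ (til_sub hm)
        rw [mul_sub, mul_sub, map_sub, h3, zero_sub, neg_eq_zero] at h4
        exact h4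
    have h3 := ih' _ h1
    rw [mul_sub, mul_sub, map_sub, h2, sub_zero] at h3
    exact h3

lemma Gauss.eq_zero (G : S.Gauss) {k : ℕ} {v : MvPolynomial σ ℂ} (hv : v ∈ S.Q)
    (hk : eul v - S.L v = (k : ℂ) • v) (h : ∀ u ∈ S.Qk k, G.J (S.κ * (v * u)) = 0) : v = 0 := by
  refine G.nondeg fun w => ?_
  rw [mul_comm _ v]
  refine G.orth_Low hv hk ((S.κ * w).totalDegree + 1) (Or.inr h) _ (mem_Low.mpr ⟨S.κ_mul w, ?_⟩)
  intro n hn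
  exact homogeneousComponent_eq_zero _ _ hn

end QSys
end GradedForm

section Adjunction

variable {σ : Type*} [Fintype σ]

namespace QSys

variable {S : QSys σ}

variable (S) in
/-- The iterated commutator `ad_L^j(p)`. -/
def adp (p : MvPolynomial σ ℂ) : ℕ → Module.End ℂ (MvPolynomial σ ℂ)
  | 0 => LinearMap.mulLeft ℂ p
  | j + 1 => S.L * adp p j - adp p j * S.L

lemma adp_zero (p f : MvPolynomial σ ℂ) : S.adp p 0 f = p * f := rfl

lemma adp_succ (p f : MvPolynomial σ ℂ) (j : ℕ) :
    S.adp p (j + 1) f = S.L (S.adp p j f) - S.adp p j (S.L f) := rfl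

lemma adp_mem {p : MvPolynomial σ ℂ} (hp : p ∈ S.Q) (j : ℕ) :
    ∀ f ∈ S.Q, S.adp p j f ∈ S.Q := by
  induction j with
  | zero => exact fun f hf => Subalgebra.mul_mem _ hp hf
  | succ j ih =>
    exact fun f hf => Subalgebra.sub_mem _ (S.L_mem _ (ih f hf)) (ih _ (S.L_mem f hf))

lemma eul_adp {p : MvPolynomial σ ℂ} (hp : p ∈ S.Q) {i : ℕ} (hi : p.IsHomogeneous i) (j : ℕ) :
    ∀ f ∈ S.Q, eul (S.adp p j f) = S.adp p j (eul f) + ((i : ℂ) - 2 * j) • S.adp p j f := by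
  induction j with
  | zero =>
    intro f _
    simp only [adp_zero, eul_mul, eul_hom hi, mul_smul_comm, mul_comm f p]
    simp
  | succ j ih =>
    intro f hf
    have h1 := adp_mem hp j f hf
    have h2 := S.L_mem f hf
    have h3 : ∀ g ∈ S.Q, eul (S.L g) = S.L (eul g) - (2 : ℂ) • S.L g := fun g hg => by
      rw [eul_L hg (eul_mem hg)]
      congr 1
      rw [← Nat.cast_ofNat (R := MvPolynomial σ ℂ), ← Nat.cast_ofNat (R := ℂ),
        Nat.cast_smul_eq_nsmul, nsmul_eq_mul]
    simp only [adp_succ, map_sub, h3 _ h1, ih _ h2, ih _ hf, h3 _ hf, map_add, map_smul]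
    push_cast
    module

lemma eul_adp_eigen {p : MvPolynomial σ ℂ} (hp : p ∈ S.Q) {i : ℕ} (hi : p.IsHomogeneous i)
    (j : ℕ) {f : MvPolynomial σ ℂ} (hf : f ∈ S.Q) {c : ℂ} (hc : eul f = c • f) :
    eul (S.adp p j f) = (c + i - 2 * j) • S.adp p j f := by
  rw [eul_adp hp hi j f hf, hc, map_smul]
  module

lemma adp_mem_Low {p : MvPolynomial σ ℂ} (hp : p ∈ S.Q) {i : ℕ} (hi : p.IsHomogeneous i)
    (j : ℕ) {a b : ℕ} (hab : a + i ≤ b + 2 * j) {f : MvPolynomial σ ℂ} (hf : f ∈ S.Low a) :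
    S.adp p j f ∈ S.Low b := by
  rw [Low_eq_sum hf, map_sum]
  have hQ := (mem_Low.mp hf).1
  refine Submodule.sum_mem _ fun l hl => mem_Low_of_eigen (adp_mem hp _ _ (S.hom f hQ l))
    (eul_adp_eigen hp hi j (S.hom f hQ l) (eul_hom (homogeneousComponent_isHomogeneous l f)))
    fun n hn h => ?_
  have : ((n + 2 * j : ℕ) : ℂ) = ((l + i : ℕ) : ℂ) := by push_cast; rw [h]; ring
  have := Nat.cast_injective this
  have := Finset.mem_range.mp hl
  omega

lemma Gauss.adp_step (G : S.Gauss) {p : MvPolynomial σ ℂ} (hp : p ∈ S.Q) {i : ℕ}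
    (hi : p.IsHomogeneous i) {u v : MvPolynomial σ ℂ} (hu : u ∈ S.Q) (hv : v ∈ S.Q) {a b : ℂ}
    (ha : eul u - S.L u = a • u) (hb : eul v - S.L v = b • v) (j : ℕ) :
    G.J (S.κ * (u * S.adp p (j + 1) v)) =
      (b - a + i - 2 * j) * G.J (S.κ * (u * S.adp p j v)) := by
  have h1 := G.symm hu (adp_mem hp j v hv)
  have h2 : eul (S.adp p j v) - S.L (S.adp p j v) =
      (b + i - 2 * j) • S.adp p j v - S.adp p (j + 1) v := by
    rw [eul_adp hp hi j v hv, adp_succ]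
    have := congrArg (S.adp p j) hb
    rw [map_sub, map_smul] at this
    linear_combination (norm := module) this
  rw [h2, ha, mul_sub, mul_sub, map_sub, mul_smul_comm, mul_smul_comm, mul_smul_comm,
    mul_smul_comm, map_smul, map_smul, mul_comm _ u, smul_eq_mul, smul_eq_mul] at h1
  linear_combination h1

lemma Gauss.adp_eq_zero (G : S.Gauss) {p : MvPolynomial σ ℂ} (hp : p ∈ S.Q) {i : ℕ}
    (hi : p.IsHomogeneous i) {k : ℕ} {g : MvPolynomial σ ℂ} (hg : g ∈ S.Qk k)
    (h : ∀ a, a + i = k → ∀ f ∈ S.Qk a, G.J (S.κ * (S.til k g * (p * f))) = 0) :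
    S.adp p i g = 0 := by
  obtain ⟨hgQ, hgk⟩ := mem_Qk.mp hg
  have hE := eul_adp_eigen hp hi i hgQ (eul_hom hgk)
  rcases lt_or_ge k i with hki | hki
  · refine eq_zero_of_eigen hE fun n hn => ?_
    have : ((n + i : ℕ) : ℂ) = k := by push_cast; rw [hn]; ring
    have := Nat.cast_injective this
    omega
  obtain ⟨a, rfl⟩ := Nat.exists_eq_add_of_le' hki
  have hcast : ((a + i : ℕ) : ℂ) + i - 2 * i = a := by push_cast; ring
  rw [hcast] at hE
  set w := S.adp p i g with hw
  have hwQ : w ∈ S.Q := adp_mem hp i g hgQ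
  have hwa : w ∈ S.Qk a := mem_Qk.mpr ⟨hwQ, isHomogeneous_of_eigen hE⟩
  have hv := til_mem hgQ (a + i)
  have hvE := til_eigen hg
  set v := S.til (a + i) g with hvdef
  have h0 : S.til a w = 0 := by
    refine G.eq_zero (til_mem hwQ a) (til_eigen hwa) fun f hf => ?_
    have hfQ := (mem_Qk.mp hf).1
    have huQ := til_mem hfQ a
    have huE := til_eigen hf
    have hLow := til_sub hf
    set u := S.til a f with hu
    have e1 : G.J (S.κ * (u * S.adp p 0 v)) = 0 := by
      rw [adp_zero]
      have := G.orth_Low hv hvE (a + i) (Or.inl le_rfl) _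
        (adp_mem_Low hp hi 0 (b := a + i) (by omega) hLow)
      rw [adp_zero, mul_sub, mul_sub, mul_sub, map_sub, h a rfl f hf, sub_zero] at this
      rw [mul_left_comm u p v, mul_comm u v, mul_left_comm p v u]
      exact this
    have e2 : ∀ j, G.J (S.κ * (u * S.adp p j v)) = 0 := by
      intro j
      induction j with
      | zero => exact e1
      | succ j ih => rw [G.adp_step hp hi huQ hv huE hvE, ih, mul_zero]
    have e3 := G.orth_Low huQ huE a (Or.inl le_rfl) _
      (adp_mem_Low hp hi i (b := a) (by omega) (til_sub hg))
    rw [← hvdef, map_sub, mul_sub, mul_sub, map_sub, e2, zero_sub, neg_eq_zero, ← hw] at e3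
    have e4 := G.orth_Low huQ huE a (Or.inl le_rfl) _ (til_sub hwa)
    rw [mul_sub, mul_sub, map_sub, e3, sub_zero] at e4
    have e5 := G.orth_Low (til_mem hwQ a) (til_eigen hwa) a (Or.inl le_rfl) _ hLow
    rw [mul_sub, mul_sub, map_sub, mul_comm _ u, e4, zero_sub, neg_eq_zero] at e5
    exact e5
  have h1 := (mem_Low.mp (til_sub hwa)).2 a le_rfl
  rw [h0, zero_sub, map_neg, neg_eq_zero,
    homogeneousComponent_eq_self (mem_homogeneousSubmodule _ _ |>.mpr (mem_Qk.mp hwa).2)] at h1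
  exact h1

instance (k : ℕ) : FiniteDimensional ℂ (homogeneousSubmodule σ ℂ k) := by
  have h : homogeneousSubmodule σ ℂ k ≤ restrictTotalDegree σ ℂ k := fun f hf =>
    (mem_restrictTotalDegree _ _ _).mpr ((mem_homogeneousSubmodule _ _).mp hf).totalDegree_le
  exact Submodule.finiteDimensional_of_le h

instance (k : ℕ) : FiniteDimensional ℂ (S.Qk k) :=
  Submodule.finiteDimensional_of_le (inf_le_right : S.Qk k ≤ homogeneousSubmodule σ ℂ k)

variable (S) in
/-- The degree `k` part of the ideal of `Q` generated by the `P i`. -/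
def Uk {n : ℕ} (P : Fin n → MvPolynomial σ ℂ) (k : ℕ) : Submodule ℂ (MvPolynomial σ ℂ) :=
  Submodule.span ℂ {f | ∃ (i : Fin n) (a : ℕ) (g : MvPolynomial σ ℂ),
    a + (i + 1) = k ∧ g ∈ S.Qk a ∧ f = P i * g}

lemma Uk_le {n : ℕ} {P : Fin n → MvPolynomial σ ℂ} (hP : ∀ i : Fin n, P i ∈ S.Qk (i + 1)) (k : ℕ) :
    S.Uk P k ≤ S.Qk k := by
  refine Submodule.span_le.mpr ?_
  rintro _ ⟨i, a, g, rfl, hg, rfl⟩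
  have h1 := mem_Qk.mp (hP i)
  have h2 := mem_Qk.mp hg
  refine mem_Qk.mpr ⟨Subalgebra.mul_mem _ h1.1 h2.1, ?_⟩
  rw [add_comm]
  exact h1.2.mul h2.2

variable (S) in
/-- The homogeneous elements annihilated by the operators `ad_L^{i+1}(P i)`. -/
def Sol {n : ℕ} (P : Fin n → MvPolynomial σ ℂ) (k : ℕ) : Submodule ℂ (MvPolynomial σ ℂ) :=
  S.Qk k ⊓ ⨅ i : Fin n, LinearMap.ker (S.adp (P i) (i + 1))

lemma Gauss.finrank_le (G : S.Gauss) {n : ℕ} {P : Fin n → MvPolynomial σ ℂ}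
    (hP : ∀ i : Fin n, P i ∈ S.Qk (i + 1)) (k : ℕ) :
    Module.finrank ℂ (S.Qk k) ≤ Module.finrank ℂ (S.Uk P k) + Module.finrank ℂ (S.Sol P k) := by
  have : FiniteDimensional ℂ (S.Uk P k) := Submodule.finiteDimensional_of_le (Uk_le hP k)
  have : FiniteDimensional ℂ (S.Sol P k) :=
    Submodule.finiteDimensional_of_le (inf_le_left : S.Sol P k ≤ S.Qk k)
  let Φ : S.Qk k →ₗ[ℂ] Module.Dual ℂ (S.Uk P k) :=
    LinearMap.mk₂ ℂ (fun g u => G.J (S.κ * (S.til k g.1 * u.1)))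
      (fun a b c => by simp [add_mul, mul_add]) (fun a b c => by simp)
      (fun a b c => by simp [mul_add]) (fun a b c => by simp)
  rw [← LinearMap.finrank_range_add_finrank_ker Φ]
  refine add_le_add ((Submodule.finrank_le _).trans Subspace.dual_finrank_eq.le) ?_
  let e : LinearMap.ker Φ →ₗ[ℂ] S.Sol P k :=
    LinearMap.codRestrict (S.Sol P k) ((S.Qk k).subtype ∘ₗ (LinearMap.ker Φ).subtype) (by
      rintro ⟨⟨g, hg⟩, h⟩
      refine ⟨hg, ?_⟩
      rw [SetLike.mem_coe, Submodule.mem_iInf]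
      intro i
      have h1 := mem_Qk.mp (hP i)
      refine G.adp_eq_zero h1.1 h1.2 hg fun a ha f hf => ?_
      have := LinearMap.congr_fun (LinearMap.mem_ker.mp h)
        ⟨P i * f, Submodule.subset_span ⟨i, a, f, ha, hf, rfl⟩⟩
      exact this)
  refine LinearMap.finrank_le_finrank_of_injective (f := e) ?_
  intro x y hxy
  have := congrArg Subtype.val hxy
  exact Subtype.ext (Subtype.ext this)

end QSys
end Adjunction

section FractionDerivation

variable {A K : Type*} [CommRing A] [IsDomain A] [Algebra ℂ A] [Field K] [Algebra A K]
  [IsFractionRing A K] [Algebra ℂ K] [IsScalarTower ℂ A K]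

omit [IsDomain A] in
variable (K) in
lemma exists_derivation_extension (D : Derivation ℂ A A) :
    ∃ D' : Derivation ℂ K K, ∀ f, D' (algebraMap A K f) = algebraMap A K (D f) := by
  let φ0 : A →+* TrivSqZeroExt K K :=
    { toFun := fun f => TrivSqZeroExt.inl (algebraMap A K f) + TrivSqZeroExt.inr (algebraMap A K (D f))
      map_one' := by ext <;> simp
      map_zero' := by ext <;> simp
      map_add' := fun x y => by ext <;> simp [Algebra.smul_def]
      map_mul' := fun x y => by
        ext
        · simp
        · simp only [Derivation.leibniz, smul_eq_mul, map_mul, map_add, TrivSqZeroExt.snd_mul,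
            TrivSqZeroExt.snd_add, TrivSqZeroExt.snd_inl, TrivSqZeroExt.snd_inr,
            TrivSqZeroExt.fst_add, TrivSqZeroExt.fst_inl, TrivSqZeroExt.fst_inr, zero_add,
            add_zero, op_smul_eq_smul] }
  have hu : ∀ y : nonZeroDivisors A, IsUnit (φ0 y) := by
    intro y
    rw [TrivSqZeroExt.isUnit_iff_isUnit_fst]
    simp only [φ0, RingHom.coe_mk, MonoidHom.coe_mk, OneHom.coe_mk, TrivSqZeroExt.fst_add,
      TrivSqZeroExt.fst_inl, TrivSqZeroExt.fst_inr, add_zero]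
    exact IsLocalization.map_units K y
  let φ : K →+* TrivSqZeroExt K K := IsLocalization.lift hu
  have hφ : ∀ f, φ (algebraMap A K f) = φ0 f := fun f => IsLocalization.lift_eq hu f
  have hfst : ∀ x, (φ x).fst = x := by
    have : (TrivSqZeroExt.fstHom K K K).toRingHom.comp φ = RingHom.id K := by
      refine IsLocalization.ringHom_ext (nonZeroDivisors A) ?_
      ext f
      simp [hφ, φ0]
    exact fun x => RingHom.congr_fun this x
  have hC : ∀ c : ℂ, φ (algebraMap ℂ K c) = TrivSqZeroExt.inl (algebraMap ℂ K c) := by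
    intro c
    rw [IsScalarTower.algebraMap_apply ℂ A K, hφ]
    simp [φ0]
  refine ⟨Derivation.mk' ⟨⟨fun x => (φ x).snd, fun x y => by rw [map_add, TrivSqZeroExt.snd_add]⟩, fun c x => ?_⟩ fun x y => ?_, fun f => ?_⟩
  · change (φ (c • x)).snd = c • (φ x).snd
    rw [Algebra.smul_def, map_mul, hC, TrivSqZeroExt.snd_mul, TrivSqZeroExt.snd_inl, smul_zero,
      add_zero, TrivSqZeroExt.fst_inl, smul_eq_mul, Algebra.smul_def]
  · change (φ (x * y)).snd = x • (φ y).snd + y • (φ x).snd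
    rw [map_mul, TrivSqZeroExt.snd_mul, hfst, hfst, op_smul_eq_smul]
  · change (φ (algebraMap A K f)).snd = _
    rw [hφ]
    change (TrivSqZeroExt.inl (algebraMap A K f) +
      TrivSqZeroExt.inr (algebraMap A K (D f)) : TrivSqZeroExt K K).snd = _
    rw [TrivSqZeroExt.snd_add, TrivSqZeroExt.snd_inl, TrivSqZeroExt.snd_inr, zero_add]

omit [Algebra ℂ A] [IsScalarTower ℂ A K] in
lemma derivation_eq_zero_of_fraction {D : Derivation ℂ K K}
    (h : ∀ f : A, D (algebraMap A K f) = 0) : D = 0 := by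
  ext x
  obtain ⟨a, b, hb, rfl⟩ := IsFractionRing.div_surjective (A := A) x
  have hb0 : algebraMap A K b ≠ 0 := IsFractionRing.to_map_ne_zero_of_mem_nonZeroDivisors hb
  have h1 : D (algebraMap A K a / algebraMap A K b * algebraMap A K b) = 0 := by
    rw [div_mul_cancel₀ _ hb0, h]
  rw [Derivation.leibniz, h, smul_zero, zero_add, smul_eq_mul] at h1
  exact (mul_eq_zero.mp h1).resolve_left hb0

end FractionDerivation

section OperatorOrder

variable {σ K : Type*} [Fintype σ] [Field K] [Algebra ℂ K]

/-- Differential operators of order less than `n` with coefficients in `K`. -/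
def DO (d : σ → Derivation ℂ K K) (n : ℕ) : Submodule K (Module.End ℂ K) :=
  Submodule.span K {T | ∃ l : List σ, l.length < n ∧
    T = (l.map fun s => ((d s).toLinearMap : Module.End ℂ K)).prod}

variable {d : σ → Derivation ℂ K K}

omit [Fintype σ] in
lemma DO_mono {a b : ℕ} (h : a ≤ b) : DO d a ≤ DO d b :=
  Submodule.span_mono fun _ ⟨l, hl, hT⟩ => ⟨l, hl.trans_le h, hT⟩

omit [Fintype σ] in
lemma list_mem_DO (l : List σ) : (l.map fun s => ((d s).toLinearMap : Module.End ℂ K)).prod ∈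
    DO d (l.length + 1) :=
  Submodule.subset_span ⟨l, Nat.lt_succ_self _, rfl⟩

omit [Fintype σ] in
lemma d_mul_smul (s : σ) (c : K) (T : Module.End ℂ K) :
    (d s).toLinearMap * (c • T) = c • ((d s).toLinearMap * T) + (d s c) • T := by
  ext x
  simp [mul_comm]

omit [Fintype σ] in
lemma d_mul_mem {n : ℕ} (s : σ) {T : Module.End ℂ K} (hT : T ∈ DO d n) :
    (d s).toLinearMap * T ∈ DO d (n + 1) := by
  induction hT using Submodule.span_induction with
  | mem T hT =>
    obtain ⟨l, hl, rfl⟩ := hT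
    exact Submodule.subset_span ⟨s :: l, by simpa using hl, by simp⟩
  | zero => simp
  | add x y _ _ hx hy => rw [mul_add]; exact Submodule.add_mem _ hx hy
  | smul c x hx' hx =>
    rw [d_mul_smul]
    exact Submodule.add_mem _ (Submodule.smul_mem _ _ hx)
      (Submodule.smul_mem _ _ (DO_mono (Nat.le_succ n) hx'))

/-- The operator `Σ γ_s d_s² + Σ v_s d_s`. -/
def LK (d : σ → Derivation ℂ K K) (γ : σ → ℝ) (v : σ → K) : Module.End ℂ K :=
  ∑ s, ((γ s : ℂ) • ((d s).toLinearMap * (d s).toLinearMap : Module.End ℂ K) +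
    v s • (d s).toLinearMap)

variable {γ : σ → ℝ} {v : σ → K}

lemma LK_mul_smul (c : K) (T : Module.End ℂ K) :
    LK d γ v * (c • T) = c • (LK d γ v * T) +
      ∑ s, (2 * (γ s : ℂ)) • (d s c • ((d s).toLinearMap * T)) + (LK d γ v c) • T := by
  ext x
  simp only [LK, Module.End.mul_apply, LinearMap.add_apply, LinearMap.smul_apply,
    LinearMap.sum_apply, smul_eq_mul, Finset.sum_mul, Finset.mul_sum, ← Finset.sum_add_distrib]
  refine Finset.sum_congr rfl fun s _ => ?_
  simp only [Derivation.coeFn_coe, Derivation.leibniz, map_add, smul_eq_mul, Algebra.smul_def,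
    map_mul, map_ofNat]
  ring

lemma LK_comm_d (hd : ∀ s t x, d s (d t x) = d t (d s x)) (t : σ) :
    LK d γ v * (d t).toLinearMap = (d t).toLinearMap * LK d γ v -
      ∑ s, d t (v s) • ((d s).toLinearMap : Module.End ℂ K) := by
  ext x
  simp only [LK, Module.End.mul_apply, LinearMap.add_apply, LinearMap.smul_apply,
    LinearMap.sum_apply, smul_eq_mul, LinearMap.sub_apply, map_sum, ← Finset.sum_sub_distrib]
  refine Finset.sum_congr rfl fun s _ => ?_
  simp only [Derivation.coeFn_coe, Derivation.leibniz, map_add, smul_eq_mul,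
    Derivation.map_smul, hd t s]
  ring

lemma LK_comm_list (hd : ∀ s t x, d s (d t x) = d t (d s x)) (l : List σ) :
    LK d γ v * (l.map fun s => ((d s).toLinearMap : Module.End ℂ K)).prod -
      (l.map fun s => ((d s).toLinearMap : Module.End ℂ K)).prod * LK d γ v ∈
      DO d (l.length + 1) := by
  induction l with
  | nil => simp
  | cons s l ih =>
    have h := list_mem_DO (d := d) l
    simp only [List.map_cons, List.prod_cons, List.length_cons]
    set T := (l.map fun s => ((d s).toLinearMap : Module.End ℂ K)).prod
    have : LK d γ v * ((d s).toLinearMap * T) - (d s).toLinearMap * T * LK d γ v =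
        (d s).toLinearMap * (LK d γ v * T - T * LK d γ v) -
          ∑ t, d s (v t) • ((d t).toLinearMap * T) := by
      rw [← mul_assoc, LK_comm_d hd, sub_mul, mul_sub, Finset.sum_mul, mul_assoc, mul_assoc]
      simp only [smul_mul_assoc]
      abel
    rw [this]
    exact Submodule.sub_mem _ (d_mul_mem s ih)
      (Submodule.sum_mem _ fun t _ => Submodule.smul_mem _ _ (d_mul_mem t h))

omit [Fintype σ] in
lemma csmul_mem {n : ℕ} (c : ℂ) {T : Module.End ℂ K} (hT : T ∈ DO d n) : c • T ∈ DO d n := by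
  have : c • T = (algebraMap ℂ K c) • T := by
    ext x; simp [Algebra.smul_def]
  rw [this]
  exact Submodule.smul_mem _ _ hT

lemma LK_comm_mem (hd : ∀ s t x, d s (d t x) = d t (d s x)) {n : ℕ} {T : Module.End ℂ K}
    (hT : T ∈ DO d n) : LK d γ v * T - T * LK d γ v ∈ DO d (n + 1) := by
  induction hT using Submodule.span_induction with
  | mem T hT =>
    obtain ⟨l, hl, rfl⟩ := hT
    exact DO_mono (by omega) (LK_comm_list hd l)
  | zero => simp
  | add x y _ _ hx hy =>
    rw [mul_add, add_mul, add_sub_add_comm]; exact Submodule.add_mem _ hx hy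
  | smul c x hx' hx =>
    have : LK d γ v * (c • x) - (c • x) * LK d γ v = c • (LK d γ v * x - x * LK d γ v) +
        (∑ s, (2 * (γ s : ℂ)) • (d s c • ((d s).toLinearMap * x)) + (LK d γ v c) • x) := by
      rw [LK_mul_smul, smul_mul_assoc, smul_sub]; abel
    rw [this]
    exact Submodule.add_mem _ (Submodule.smul_mem _ _ hx) (Submodule.add_mem _
      (Submodule.sum_mem _ fun s _ => csmul_mem _ (Submodule.smul_mem _ _ (d_mul_mem s hx')))
      (Submodule.smul_mem _ _ (DO_mono (Nat.le_succ n) hx')))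

/-- The iterated commutator with `LK`. -/
def adK (d : σ → Derivation ℂ K K) (γ : σ → ℝ) (v : σ → K) (T : Module.End ℂ K) :
    ℕ → Module.End ℂ K
  | 0 => T
  | j + 1 => LK d γ v * adK d γ v T j - adK d γ v T j * LK d γ v

lemma adK_symbol [DecidableEq σ] (hd : ∀ s t x, d s (d t x) = d t (d s x)) {j : σ} {x : K}
    (hx : ∀ s, d s x = if s = j then 1 else 0) (k i : ℕ) :
    adK d γ v (LinearMap.mulLeft ℂ (x ^ k)) i -
      ((2 * (γ j : ℂ)) ^ i * (k.descFactorial i : ℂ)) •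
        (x ^ (k - i) • ((d j).toLinearMap ^ i : Module.End ℂ K)) ∈ DO d i := by
  induction i with
  | zero =>
    have : LinearMap.mulLeft ℂ (x ^ k) = x ^ k • (1 : Module.End ℂ K) := by ext; simp
    simp [adK, this]
  | succ i ih =>
    have h1 := LK_comm_mem (γ := γ) (v := v) hd ih
    have hpow : ((d j).toLinearMap ^ i : Module.End ℂ K) =
        ((List.replicate i j).map fun s => ((d s).toLinearMap : Module.End ℂ K)).prod := by simp
    have h2 := LK_comm_list (γ := γ) (v := v) hd (List.replicate i j)
    have h3 := list_mem_DO (d := d) (List.replicate i j)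
    rw [← hpow, List.length_replicate] at h2 h3
    set T := ((d j).toLinearMap ^ i : Module.End ℂ K) with hT
    set c : ℂ := (2 * (γ j : ℂ)) ^ i * (k.descFactorial i : ℂ) with hc
    set A := adK d γ v (LinearMap.mulLeft ℂ (x ^ k)) i
    set y : K := x ^ (k - i) with hy
    have hdy : ∀ s, d s y = if s = j then ((k - i : ℕ) : K) * x ^ (k - i - 1) else 0 := by
      intro s
      rw [hy, Derivation.leibniz_pow, hx]
      split_ifs <;> simp
    have h4 : ∑ s, (2 * (γ s : ℂ)) • (d s y • ((d s).toLinearMap * T)) =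
        (2 * (γ j : ℂ) * ((k - i : ℕ) : ℂ)) • (x ^ (k - (i + 1)) • ((d j).toLinearMap * T)) := by
      rw [Finset.sum_eq_single j]
      · rw [hdy, if_pos rfl]
        ext z
        rw [LinearMap.smul_apply, LinearMap.smul_apply, LinearMap.smul_apply,
          LinearMap.smul_apply, smul_eq_mul, smul_eq_mul, Algebra.smul_def, Algebra.smul_def,
          map_mul _ (2 * (γ j : ℂ)), map_natCast, Nat.sub_sub]
        ring
      · intro s _ hs
        rw [hdy, if_neg hs, zero_smul, smul_zero]
      · simp
    have h5 : adK d γ v (LinearMap.mulLeft ℂ (x ^ k)) (i + 1) -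
        ((2 * (γ j : ℂ)) ^ (i + 1) * (k.descFactorial (i + 1) : ℂ)) •
          (x ^ (k - (i + 1)) • ((d j).toLinearMap ^ (i + 1) : Module.End ℂ K)) =
        (LK d γ v * (A - c • (y • T)) - (A - c • (y • T)) * LK d γ v) +
        (c • (y • (LK d γ v * T - T * LK d γ v)) + c • ((LK d γ v y) • T)) := by
      have e1 : adK d γ v (LinearMap.mulLeft ℂ (x ^ k)) (i + 1) =
        LK d γ v * A - A * LK d γ v := rfl
      have e2 : (2 * (γ j : ℂ)) ^ (i + 1) * (k.descFactorial (i + 1) : ℂ) =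
          c * (2 * (γ j : ℂ) * ((k - i : ℕ) : ℂ)) := by
        rw [hc, Nat.descFactorial_succ]; push_cast; ring
      rw [e1, e2, mul_smul c, pow_succ' (d j).toLinearMap, ← h4, mul_sub, sub_mul, mul_smul_comm c,
        LK_mul_smul]
      simp only [smul_mul_assoc, smul_sub, smul_add]
      abel
    rw [h5]
    exact Submodule.add_mem _ h1 (Submodule.add_mem _
      (csmul_mem _ (Submodule.smul_mem _ _ h2)) (csmul_mem _ (Submodule.smul_mem _ _ h3)))

end OperatorOrder

section VanishingOrder

variable {σ : Type*}

/-- Polynomials vanishing at `x` to order at least `n`. -/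
def Van (x : σ → ℂ) : ℕ → Submodule ℂ (MvPolynomial σ ℂ)
  | 0 => ⊤
  | n + 1 => LinearMap.ker (aeval x : MvPolynomial σ ℂ →ₐ[ℂ] ℂ).toLinearMap ⊓
      ⨅ s, (Van x n).comap (pderiv s : Derivation ℂ _ _).toLinearMap

variable {x : σ → ℂ}

lemma mem_Van_succ {n : ℕ} {f : MvPolynomial σ ℂ} :
    f ∈ Van x (n + 1) ↔ eval x f = 0 ∧ ∀ s, pderiv s f ∈ Van x n := by
  simp [Van, Submodule.mem_iInf, aeval_eq_eval]

lemma Van_succ_le (n : ℕ) : Van x (n + 1) ≤ Van x n := by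
  induction n with
  | zero => exact le_top
  | succ n ih =>
    intro f hf
    rw [mem_Van_succ] at hf ⊢
    exact ⟨hf.1, fun s => ih (hf.2 s)⟩

lemma Van_antitone : Antitone (Van x) := antitone_nat_of_succ_le Van_succ_le

lemma mul_mem_Van {n : ℕ} (g : MvPolynomial σ ℂ) {f : MvPolynomial σ ℂ} (hf : f ∈ Van x n) :
    g * f ∈ Van x n := by
  induction n generalizing g f with
  | zero => trivial
  | succ n ih =>
    have h := Van_succ_le n hf
    rw [mem_Van_succ] at hf ⊢
    refine ⟨by rw [map_mul, hf.1, mul_zero], fun s => ?_⟩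
    rw [Derivation.leibniz, smul_eq_mul, smul_eq_mul, mul_comm f]
    exact Submodule.add_mem _ (ih _ (hf.2 s)) (ih _ h)

lemma mem_Van_of_mul {n : ℕ} {g f : MvPolynomial σ ℂ} (hg : eval x g ≠ 0)
    (h : g * f ∈ Van x n) : f ∈ Van x n := by
  induction n generalizing f with
  | zero => trivial
  | succ n ih =>
    have hf := ih (Van_succ_le n h)
    rw [mem_Van_succ] at h ⊢
    refine ⟨by simpa [hg] using h.1, fun s => ih ?_⟩
    have h2 := h.2 s
    rw [Derivation.leibniz, smul_eq_mul, smul_eq_mul, mul_comm f] at h2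
    exact (Submodule.add_mem_iff_left _ (mul_mem_Van _ hf)).mp h2

lemma eq_zero_of_mem_Van [Fintype σ] {f : MvPolynomial σ ℂ} (h : ∀ n, f ∈ Van x n) : f = 0 := by
  by_contra h0
  obtain ⟨c, hc, h⟩ := exists_const_of_pderiv_closed (fun f => ∀ n, f ∈ Van x n)
    (fun f s hf n => (mem_Van_succ.mp (hf (n + 1))).2 s) h h0
  have := (mem_Van_succ.mp (h 1)).1
  rw [eval_C] at this
  exact hc this

open scoped IsMulCommutative in
variable (σ) in
/-- Polynomials acting as constant coefficient differential operators. -/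
lemma exists_pderivHom : ∃ Φ : MvPolynomial σ ℂ →ₐ[ℂ] Module.End ℂ (MvPolynomial σ ℂ),
    ∀ s, Φ (X s) = (pderiv s : Derivation ℂ (MvPolynomial σ ℂ) _).toLinearMap := by
  let D : σ → Module.End ℂ (MvPolynomial σ ℂ) := fun s =>
    (pderiv s : Derivation ℂ (MvPolynomial σ ℂ) _).toLinearMap
  have hcomm : ∀ a ∈ Set.range D, ∀ b ∈ Set.range D, a * b = b * a := by
    rintro _ ⟨s, rfl⟩ _ ⟨t, rfl⟩
    refine LinearMap.ext fun f => pderiv_comm s t f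
  have := Algebra.isMulCommutative_adjoin ℂ hcomm
  refine ⟨(Algebra.adjoin ℂ (Set.range D)).val.comp
    (aeval fun s => (⟨D s, Algebra.subset_adjoin ⟨s, rfl⟩⟩ : Algebra.adjoin ℂ (Set.range D))),
    fun s => ?_⟩
  rw [AlgHom.comp_apply, aeval_X]
  rfl

/-- Polynomials acting as constant coefficient differential operators. -/
def pdHom : MvPolynomial σ ℂ →ₐ[ℂ] Module.End ℂ (MvPolynomial σ ℂ) :=
  (exists_pderivHom σ).choose

lemma pdHom_X (s : σ) (f : MvPolynomial σ ℂ) : pdHom (X s) f = pderiv s f := by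
  rw [pdHom, (exists_pderivHom σ).choose_spec]
  rfl

lemma pdHom_eval {n : ℕ} {h f : MvPolynomial σ ℂ} (hh : h.IsHomogeneous n)
    (hf : f ∈ Van x (n + 1)) : eval x (pdHom h f) = 0 := by
  have key : ∀ (n : ℕ) (d : σ →₀ ℕ), d.degree = n → ∀ f ∈ Van x (n + 1),
      eval x (pdHom (monomial d 1) f) = 0 := by
    intro n
    induction n with
    | zero =>
      intro d hd f hf
      rw [Finsupp.degree_eq_zero_iff] at hd
      subst hd
      have : (monomial (0 : σ →₀ ℕ) (1 : ℂ)) = 1 := rfl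
      rw [this, map_one]
      exact (mem_Van_succ.mp hf).1
    | succ n ih =>
      intro d hd f hf
      obtain ⟨s, hs⟩ : ∃ s, d s ≠ 0 := by
        by_contra! h0
        have : d = 0 := Finsupp.ext h0
        simp [this] at hd
      have hd' : d = (d - Finsupp.single s 1) + Finsupp.single s 1 :=
        (tsub_add_cancel_of_le (by simpa using Nat.one_le_iff_ne_zero.mpr hs)).symm
      have h1 : (d - Finsupp.single s 1).degree = n := by
        rw [hd', map_add, Finsupp.degree_single] at hd
        omega
      have h2 : monomial d (1 : ℂ) = monomial (d - Finsupp.single s 1) 1 * X s := by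
        rw [X, monomial_mul, mul_one, ← hd']
      rw [h2, map_mul, Module.End.mul_apply, pdHom_X]
      exact ih _ h1 _ ((mem_Van_succ.mp hf).2 s)
  rw [h.as_sum, map_sum, LinearMap.sum_apply, map_sum]
  refine Finset.sum_eq_zero fun d hd => ?_
  have h3 : monomial d (coeff d h) = coeff d h • monomial d (1 : ℂ) := by
    rw [smul_monomial, smul_eq_mul, mul_one]
  rw [h3, map_smul, LinearMap.smul_apply, smul_eval, key n d ?_ f hf, mul_zero]
  have := hh (mem_support_iff.mp hd)
  rw [Finsupp.degree_eq_weight_one]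
  exact this

lemma mem_Van_succ_of_pdHom {n : ℕ} {f : MvPolynomial σ ℂ} (hf : f ∈ Van x n)
    (h : ∀ q : MvPolynomial σ ℂ, q.IsHomogeneous n → eval x (pdHom q f) = 0) :
    f ∈ Van x (n + 1) := by
  induction n generalizing f with
  | zero =>
    rw [mem_Van_succ]
    have := h 1 (isHomogeneous_one _ _)
    rw [map_one] at this
    exact ⟨this, fun _ => trivial⟩
  | succ n ih =>
    rw [mem_Van_succ] at hf ⊢
    refine ⟨hf.1, fun s => ih (hf.2 s) fun q hq => ?_⟩
    have := h (q * X s) (hq.mul (isHomogeneous_X _ s))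
    rwa [map_mul, Module.End.mul_apply, pdHom_X] at this

end VanishingOrder

section ClearDenominators

variable {σ K : Type*} [Field K] [Algebra (MvPolynomial σ ℂ) K]
  [IsFractionRing (MvPolynomial σ ℂ) K] [Algebra ℂ K]
  {d : σ → Derivation ℂ K K}

lemma DO_clear (hd : ∀ s (f : MvPolynomial σ ℂ), d s (algebraMap _ K f) = algebraMap _ K (pderiv s f))
    {k : ℕ} {T : Module.End ℂ K} (hT : T ∈ DO d k) :
    ∃ (c : MvPolynomial σ ℂ) (U : Module.End ℂ (MvPolynomial σ ℂ)), c ≠ 0 ∧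
      (∀ f, algebraMap _ K (U f) = algebraMap _ K c * T (algebraMap _ K f)) ∧
      ∀ (x : σ → ℂ) n, ∀ f ∈ Van x (n + k), U f ∈ Van x (n + 1) := by
  induction hT using Submodule.span_induction with
  | mem T hT =>
    obtain ⟨l, hl, rfl⟩ := hT
    have key : ∀ l : List σ, ∃ U : Module.End ℂ (MvPolynomial σ ℂ),
        (∀ f, algebraMap _ K (U f) = (l.map fun s => ((d s).toLinearMap : Module.End ℂ K)).prod
          (algebraMap _ K f)) ∧
        ∀ (x : σ → ℂ) n, ∀ f ∈ Van x (n + l.length), U f ∈ Van x n := by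
      intro l
      induction l with
      | nil => exact ⟨1, by simp, by simp⟩
      | cons s l ih =>
        obtain ⟨U, h1, h2⟩ := ih
        refine ⟨(pderiv s : Derivation ℂ (MvPolynomial σ ℂ) _).toLinearMap * U, fun f => ?_,
          fun x n f hf => ?_⟩
        · rw [List.map_cons, List.prod_cons, Module.End.mul_apply, Module.End.mul_apply, ← h1]
          exact (hd s _).symm
        · have := h2 x (n + 1) f (by
            rw [List.length_cons] at hf
            rwa [add_right_comm, add_assoc])
          exact (mem_Van_succ.mp this).2 s
    obtain ⟨U, h1, h2⟩ := key l
    refine ⟨1, U, one_ne_zero, fun f => by rw [map_one, one_mul, h1], fun x n f hf =>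
      h2 x (n + 1) f (Van_antitone (by omega) hf)⟩
  | zero => exact ⟨1, 0, one_ne_zero, fun f => by simp, fun x n f _ => Submodule.zero_mem _⟩
  | add T T' _ _ h h' =>
    obtain ⟨c, U, h0, h1, h2⟩ := h
    obtain ⟨c', U', h0', h1', h2'⟩ := h'
    refine ⟨c * c', LinearMap.mulLeft ℂ c' * U + LinearMap.mulLeft ℂ c * U', mul_ne_zero h0 h0',
      fun f => ?_, fun x n f hf => ?_⟩
    · rw [LinearMap.add_apply, Module.End.mul_apply, Module.End.mul_apply, LinearMap.mulLeft_apply,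
        LinearMap.mulLeft_apply, map_add, map_mul, map_mul, map_mul, h1, h1', LinearMap.add_apply]
      ring
    · exact Submodule.add_mem _ (mul_mem_Van _ (h2 x n f hf)) (mul_mem_Van _ (h2' x n f hf))
  | smul u T _ h =>
    obtain ⟨c, U, h0, h1, h2⟩ := h
    obtain ⟨a, b, hb, rfl⟩ := IsFractionRing.div_surjective (A := MvPolynomial σ ℂ) u
    have hb0 : algebraMap (MvPolynomial σ ℂ) K b ≠ 0 :=
      IsFractionRing.to_map_ne_zero_of_mem_nonZeroDivisors hb
    refine ⟨b * c, LinearMap.mulLeft ℂ a * U, mul_ne_zero (nonZeroDivisors.ne_zero hb) h0,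
      fun f => ?_, fun x n f hf => mul_mem_Van _ (h2 x n f hf)⟩
    rw [Module.End.mul_apply, LinearMap.mulLeft_apply, map_mul, map_mul, h1, LinearMap.smul_apply,
      smul_eq_mul]
    field_simp

end ClearDenominators

section SolutionBound

lemma adK_sum {σ K ι : Type*} [Fintype σ] [Field K] [Algebra ℂ K] (d : σ → Derivation ℂ K K)
    (γ : σ → ℝ) (v : σ → K) (I : Finset ι) (c : ι → ℂ) (T : ι → Module.End ℂ K) (k : ℕ) :
    adK d γ v (∑ i ∈ I, c i • T i) k = ∑ i ∈ I, c i • adK d γ v (T i) k := by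
  induction k with
  | zero => rfl
  | succ k ih =>
    simp only [adK, ih, Finset.mul_sum, Finset.sum_mul, ← Finset.sum_sub_distrib,
      mul_smul_comm, smul_mul_assoc, smul_sub]

variable {σ : Type*} [Fintype σ] {S : QSys σ}

namespace QSys

lemma adp_eq_adK {K : Type*} [Field K] [Algebra (MvPolynomial σ ℂ) K]
    [IsFractionRing (MvPolynomial σ ℂ) K] [Algebra ℂ K] [IsScalarTower ℂ (MvPolynomial σ ℂ) K]
    {d : σ → Derivation ℂ K K}
    (hd : ∀ s (f : MvPolynomial σ ℂ), d s (algebraMap _ K f) = algebraMap _ K (pderiv s f))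
    {p : MvPolynomial σ ℂ} (hp : p ∈ S.Q) (k : ℕ) :
    ∀ f ∈ S.Q, algebraMap _ K (S.adp p k f) =
      adK d S.γ (fun s => -(algebraMap ℂ K (S.γ s) * algebraMap _ K (pderiv s S.κ) /
        algebraMap _ K S.κ)) (LinearMap.mulLeft ℂ (algebraMap _ K p)) k (algebraMap _ K f) := by
  have hκ : algebraMap (MvPolynomial σ ℂ) K S.κ ≠ 0 := by
    rw [ne_eq, IsFractionRing.to_map_eq_zero_iff]
    exact S.κ_ne
  have hC : ∀ c : ℂ, algebraMap (MvPolynomial σ ℂ) K (C c) = algebraMap ℂ K c := fun c =>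
    (IsScalarTower.algebraMap_apply ℂ (MvPolynomial σ ℂ) K c).symm
  have hL : ∀ f ∈ S.Q, algebraMap _ K (S.L f) = LK d S.γ (fun s =>
      -(algebraMap ℂ K (S.γ s) * algebraMap _ K (pderiv s S.κ) / algebraMap _ K S.κ))
        (algebraMap _ K f) := by
    intro f hf
    refine mul_left_cancel₀ hκ ?_
    rw [← map_mul, S.L_spec f hf, lapl_apply, grad_apply, LK, LinearMap.sum_apply,
      Finset.mul_sum, Finset.mul_sum, ← Finset.sum_sub_distrib, map_sum]
    refine Finset.sum_congr rfl fun s _ => ?_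
    rw [LinearMap.add_apply, LinearMap.smul_apply, LinearMap.smul_apply, Module.End.mul_apply]
    simp only [smul_eq_mul]
    simp only [Derivation.coeFn_coe, hd, map_sub, map_mul, hC, Algebra.smul_def]
    field_simp
    ring
  induction k with
  | zero =>
    intro f _
    rw [adp_zero, adK, map_mul, LinearMap.mulLeft_apply]
  | succ k ih =>
    intro f hf
    rw [adp_succ, map_sub, adK, LinearMap.sub_apply, Module.End.mul_apply, Module.End.mul_apply,
      hL _ (adp_mem hp k f hf), ih f hf, ih _ (S.L_mem f hf), hL f hf]

/-- The operator `ad_L^k(Σ c_s X_s^k)` has principal symbol proportional to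
`Σ c_s (2 γ_s)^k X_s^k`. -/
lemma adp_powerSum (c : σ → ℂ) (k : ℕ) (hp : (∑ s, c s • X s ^ k) ∈ S.Q) :
    ∃ (b : MvPolynomial σ ℂ) (U : Module.End ℂ (MvPolynomial σ ℂ)), b ≠ 0 ∧
      (∀ f ∈ S.Q, S.adp (∑ s, c s • X s ^ k) k f = 0 →
        b * pdHom (∑ s, (c s * (2 * (S.γ s : ℂ)) ^ k) • X s ^ k) f = U f) ∧
      ∀ (x : σ → ℂ) n, ∀ f ∈ Van x (n + k), U f ∈ Van x (n + 1) := by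
  classical
  let K := FractionRing (MvPolynomial σ ℂ)
  choose d hd using fun s => exists_derivation_extension K
    (pderiv s : Derivation ℂ (MvPolynomial σ ℂ) (MvPolynomial σ ℂ))
  have hcomm : ∀ s t x, d s (d t x) = d t (d s x) := by
    intro s t x
    have h0 : ⁅d s, d t⁆ = 0 := by
      refine derivation_eq_zero_of_fraction (A := MvPolynomial σ ℂ) fun f => ?_
      rw [Derivation.commutator_apply, hd, hd, hd, hd, pderiv_comm, sub_self]
    have := congrArg (fun D : Derivation ℂ K K => D x) h0
    rw [Derivation.commutator_apply, Derivation.zero_apply] at this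
    exact sub_eq_zero.mp this
  set v : σ → K := fun s => -(algebraMap ℂ K (S.γ s) * algebraMap _ K (pderiv s S.κ) /
        algebraMap _ K S.κ) with hv
  have hX : ∀ t s, d s (algebraMap _ K (X t : MvPolynomial σ ℂ)) = if s = t then 1 else 0 := by
    intro t s
    rw [hd, pderiv_X, Pi.single_apply]
    by_cases h : s = t
    · rw [if_pos h, if_pos h.symm, map_one]
    · rw [if_neg h, if_neg (Ne.symm h), map_zero]
  have hsm : ∀ (a : ℂ) (f : MvPolynomial σ ℂ), algebraMap _ K (a • f) =
      algebraMap ℂ K a * algebraMap _ K f := by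
    intro a f
    rw [Algebra.smul_def, map_mul, ← IsScalarTower.algebraMap_apply ℂ (MvPolynomial σ ℂ) K]
  have hml : LinearMap.mulLeft ℂ (algebraMap _ K (∑ s, c s • X s ^ k : MvPolynomial σ ℂ)) =
      ∑ s, c s • LinearMap.mulLeft ℂ (algebraMap _ K (X s : MvPolynomial σ ℂ) ^ k) := by
    refine LinearMap.ext fun x => ?_
    rw [LinearMap.sum_apply, LinearMap.mulLeft_apply, map_sum, Finset.sum_mul]
    refine Finset.sum_congr rfl fun s _ => ?_
    rw [LinearMap.smul_apply, LinearMap.mulLeft_apply, hsm, map_pow,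
      Algebra.smul_def, mul_assoc]
  have h1 : adK d S.γ v (LinearMap.mulLeft ℂ
        (algebraMap _ K (∑ s, c s • X s ^ k : MvPolynomial σ ℂ))) k -
      ∑ s, (c s * ((2 * (S.γ s : ℂ)) ^ k * (k.factorial : ℂ))) •
        ((d s).toLinearMap ^ k : Module.End ℂ K) ∈ DO d k := by
    rw [hml, adK_sum, ← Finset.sum_sub_distrib]
    refine Submodule.sum_mem _ fun s _ => ?_
    have h2 := adK_symbol (γ := S.γ) (v := v) hcomm (hX s) k k
    rw [Nat.sub_self, pow_zero, one_smul, Nat.descFactorial_self] at h2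
    have h3 := csmul_mem (c s) h2
    rw [smul_sub, smul_smul] at h3
    exact h3
  obtain ⟨b, U, hb, hU, hV⟩ := DO_clear hd h1
  refine ⟨C (k.factorial : ℂ) * b, -U, mul_ne_zero ?_ hb, fun f hf h0 => ?_,
    fun x n f hf => Submodule.neg_mem _ (hV x n f hf)⟩
  · rw [ne_eq, C_eq_zero, Nat.cast_eq_zero]
    exact Nat.factorial_ne_zero k
  · apply IsFractionRing.injective (MvPolynomial σ ℂ) K
    have hpow : ∀ s, ∀ j : ℕ, ((d s).toLinearMap ^ j : Module.End ℂ K) (algebraMap _ K f) =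
        algebraMap _ K (pdHom (X s ^ j) f) := by
      intro s j
      induction j with
      | zero => rw [pow_zero, pow_zero, map_one]; rfl
      | succ j ih =>
        rw [pow_succ', Module.End.mul_apply, ih, pow_succ', map_mul, Module.End.mul_apply, pdHom_X]
        exact hd s _
    rw [LinearMap.neg_apply, map_neg, hU f, LinearMap.sub_apply, ← adp_eq_adK hd hp k f hf, h0,
      map_zero, zero_sub, mul_neg, neg_neg, LinearMap.sum_apply, map_mul, map_mul, mul_comm
      (algebraMap _ K (C _)), mul_assoc]
    refine congrArg _ ?_
    rw [map_sum, LinearMap.sum_apply, map_sum, Finset.mul_sum]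
    refine Finset.sum_congr rfl fun s _ => ?_
    rw [LinearMap.smul_apply, hpow, map_smul, LinearMap.smul_apply, hsm, Algebra.smul_def,
      map_mul (algebraMap ℂ K), map_mul (algebraMap ℂ K), map_mul (algebraMap ℂ K),
      IsScalarTower.algebraMap_apply ℂ (MvPolynomial σ ℂ) K (k.factorial : ℂ), algebraMap_eq]
    ring

end QSys
end SolutionBound

section SolutionBound

variable {σ : Type*} [Fintype σ] {S : QSys σ}

namespace QSys

instance {n : ℕ} (P : Fin n → MvPolynomial σ ℂ) (k : ℕ) : FiniteDimensional ℂ (S.Sol P k) :=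
  Submodule.finiteDimensional_of_le (inf_le_left : S.Sol P k ≤ S.Qk k)

/-- If the symbols of the operators `ad_L^{i+1}(P i)` generate an ideal of codimension at most
`N`, their space of homogeneous joint solutions has dimension at most `N`. -/
lemma sum_finrank_Sol_le {n N : ℕ} (c : σ → ℂ)
    (hP : ∀ i : Fin n, (∑ s, c s • X s ^ (i + 1 : ℕ)) ∈ S.Q) (B : Fin N → MvPolynomial σ ℂ)
    (hB : ∀ k, ∀ h : MvPolynomial σ ℂ, h.IsHomogeneous k → h ∈ Submodule.span ℂ (Set.range B) ⊔
      Submodule.span ℂ {f | ∃ (i : Fin n) (a : ℕ) (g : MvPolynomial σ ℂ), g.IsHomogeneous a ∧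
        a + (i + 1) = k ∧ f = (∑ s, (c s * (2 * (S.γ s : ℂ)) ^ (i + 1 : ℕ)) • X s ^ (i + 1 : ℕ)) * g})
    (M : ℕ) :
    ∑ k ∈ Finset.range M,
      Module.finrank ℂ (S.Sol (fun i : Fin n => ∑ s, c s • X s ^ (i + 1 : ℕ)) k) ≤ N := by
  choose b U hb hU hV using fun i : Fin n => S.adp_powerSum c (i + 1) (hP i)
  obtain ⟨x, hx⟩ : ∃ x, eval x (∏ i, b i) ≠ 0 := by
    by_contra! h
    exact Finset.prod_ne_zero_iff.mpr (fun i _ => hb i) (MvPolynomial.funext fun x => by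
      rw [h x, map_zero])
  rw [map_prod, Finset.prod_ne_zero_iff] at hx
  have key : ∀ f ∈ S.Q,
      (∀ i : Fin n, S.adp (∑ s, c s • X s ^ (i + 1 : ℕ)) (i + 1) f = 0) →
      (∀ j, eval x (pdHom (B j) f) = 0) → f = 0 := by
    intro f hf h0 hBf
    refine eq_zero_of_mem_Van (x := x) fun k => ?_
    induction k with
    | zero => trivial
    | succ k ih =>
      refine mem_Van_succ_of_pdHom ih fun q hq => ?_
      obtain ⟨q1, h1, q2, h2, rfl⟩ := Submodule.mem_sup.mp (hB k q hq)
      rw [map_add, LinearMap.add_apply, map_add]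
      have e1 : eval x (pdHom q1 f) = 0 := by
        clear hq
        induction h1 using Submodule.span_induction with
        | mem y hy => obtain ⟨j, rfl⟩ := hy; exact hBf j
        | zero => rw [map_zero, LinearMap.zero_apply, map_zero]
        | add y z _ _ hy hz => rw [map_add, LinearMap.add_apply, map_add, hy, hz, add_zero]
        | smul a y _ hy => rw [map_smul, LinearMap.smul_apply, smul_eval, hy, mul_zero]
      have e2 : eval x (pdHom q2 f) = 0 := by
        clear hq
        induction h2 using Submodule.span_induction with
        | mem y hy =>
          obtain ⟨i, a, g, hg, hak, rfl⟩ := hy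
          rw [mul_comm, map_mul, Module.End.mul_apply]
          refine pdHom_eval hg (mem_Van_of_mul (hx i (Finset.mem_univ _)) ?_)
          rw [hU i f hf (h0 i)]
          exact hV i x a f (hak ▸ ih)
        | zero => rw [map_zero, LinearMap.zero_apply, map_zero]
        | add y z _ _ hy hz => rw [map_add, LinearMap.add_apply, map_add, hy, hz, add_zero]
        | smul a y _ hy => rw [map_smul, LinearMap.smul_apply, smul_eval, hy, mul_zero]
      rw [e1, e2, add_zero]
  set P : Fin n → MvPolynomial σ ℂ := fun i => ∑ s, c s • X s ^ (i + 1 : ℕ) with hPdef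
  let Ψ : (∀ k : Fin M, S.Sol P k) →ₗ[ℂ] (Fin N → ℂ) :=
    LinearMap.pi fun j => (aeval x : MvPolynomial σ ℂ →ₐ[ℂ] ℂ).toLinearMap ∘ₗ pdHom (B j) ∘ₗ
      ∑ k : Fin M, (S.Sol P k).subtype ∘ₗ LinearMap.proj k
  have hΨ : Function.Injective Ψ := by
    rw [injective_iff_map_eq_zero]
    intro f hf
    have hsum : ∑ k : Fin M, (f k).1 = 0 := by
      refine key _ (Subalgebra.sum_mem _ fun k _ => (mem_Qk.mp (f k).2.1).1) (fun i => ?_)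
        fun j => ?_
      · rw [map_sum]
        refine Finset.sum_eq_zero fun k _ => ?_
        have := (f k).2.2
        rw [SetLike.mem_coe, Submodule.mem_iInf] at this
        exact this i
      · have := congrFun hf j
        simpa [Ψ, LinearMap.sum_apply, aeval_eq_eval] using this
    funext k
    refine Subtype.ext ?_
    have h3 := congrArg (homogeneousComponent (k : ℕ)) hsum
    rw [map_sum, map_zero, Finset.sum_eq_single k] at h3
    · rwa [homogeneousComponent_of_mem (mem_Qk.mp (f k).2.1).2, if_pos rfl] at h3
    · intro l _ hl
      rw [homogeneousComponent_of_mem (mem_Qk.mp (f l).2.1).2, if_neg]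
      exact fun h => hl (Fin.ext h).symm
    · simp
  have := LinearMap.finrank_le_finrank_of_injective hΨ
  rw [Module.finrank_pi_fintype, Module.finrank_fintype_fun_eq_card, Fintype.card_fin] at this
  rwa [Finset.sum_range]

end QSys
end SolutionBound

section Newton

/-- The coefficients of `(1 - u)^(-1/m)`. -/
def bcoef (m k : ℕ) : ℝ := ∏ i ∈ Finset.range k, ((m : ℝ)⁻¹ + i) / (i + 1)

lemma bcoef_pos {m : ℕ} (hm : 0 < m) (k : ℕ) : 0 < bcoef m k :=
  Finset.prod_pos fun i _ => by positivity

lemma bcoef_zero (m : ℕ) : bcoef m 0 = 1 := by simp [bcoef]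

lemma bcoef_succ (m k : ℕ) : (k + 1) * bcoef m (k + 1) = ((m : ℝ)⁻¹ + k) * bcoef m k := by
  rw [bcoef, bcoef, Finset.prod_range_succ]
  field_simp

lemma sum_bcoef {m : ℕ} (hm : 0 < m) (k : ℕ) :
    ∑ i ∈ Finset.range k, bcoef m i = m * k * bcoef m k := by
  induction k with
  | zero => simp
  | succ k ih =>
    have h0 : (m : ℝ) ≠ 0 := by positivity
    have := bcoef_succ m k
    rw [Finset.sum_range_succ, ih, Nat.cast_succ, mul_assoc (m : ℝ) (k + 1 : ℝ), this]
    field_simp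
    ring

variable {A : Type*} [CommRing A] [Algebra ℂ A]

lemma newton_step {r m : ℕ} (hm : 0 < m) (y : Fin r → A) (w : A) (k : ℕ)
    (hp : ∀ i, 1 ≤ i → i ≤ k → (m : A) * ∑ j, y j ^ i + w ^ i = 0)
    (he : ∀ i < k, aeval y (esymm (Fin r) ℂ i) = algebraMap ℂ A ((-1) ^ i * (bcoef m i : ℝ)) * w ^ i) :
    (k : A) * aeval y (esymm (Fin r) ℂ k) =
      (k : A) * (algebraMap ℂ A ((-1) ^ k * (bcoef m k : ℝ)) * w ^ k) := by
  have h0 : (m : ℂ) ≠ 0 := Nat.cast_ne_zero.mpr hm.ne'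
  have hu : IsUnit (m : A) := by
    have := (IsUnit.mk0 (m : ℂ) h0).map (algebraMap ℂ A)
    rwa [map_natCast] at this
  have h1 := congrArg (aeval y) (mul_esymm_eq_sum (Fin r) ℂ k)
  refine hu.mul_left_cancel ?_
  rw [map_mul, map_natCast] at h1
  rw [h1, map_mul, map_sum, Finset.sum_filter, Finset.Nat.sum_antidiagonal_eq_sum_range_succ_mk,
    Finset.sum_range_succ, if_neg (lt_irrefl k), add_zero]
  have h2 : ∀ i ∈ Finset.range k, (if i < k then aeval y ((-1) ^ i * esymm (Fin r) ℂ i *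
      psum (Fin r) ℂ (k - i)) else 0) * (m : A) = - (algebraMap ℂ A (bcoef m i : ℝ) * w ^ k) := by
    intro i hi
    have hik := Finset.mem_range.mp hi
    have hpi := hp (k - i) (by omega) (by omega)
    have hw : w ^ k = w ^ i * w ^ (k - i) := by rw [← pow_add]; congr 1; omega
    have h3 : aeval y (psum (Fin r) ℂ (k - i)) = ∑ j, y j ^ (k - i) := by
      simp [psum]
    rw [if_pos hik, map_mul, map_mul, he i hik, h3, hw, map_mul, map_pow, map_pow, map_neg, map_neg,
      map_one, map_one, ← mul_assoc, ← mul_assoc, ← mul_pow, neg_mul_neg, one_mul, one_pow, one_mul]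
    linear_combination (algebraMap ℂ A (bcoef m i : ℝ) * w ^ i) * hpi
  have h4 : (m : A) * ∑ i ∈ Finset.range k, (if i < k then aeval y ((-1) ^ i * esymm (Fin r) ℂ i *
      psum (Fin r) ℂ (k - i)) else 0) = -(algebraMap ℂ A ((m * k * bcoef m k : ℝ) : ℂ) * w ^ k) := by
    rw [mul_comm, Finset.sum_mul, Finset.sum_congr rfl h2, Finset.sum_neg_distrib, ← Finset.sum_mul,
      ← map_sum, ← sum_bcoef hm, Complex.ofReal_sum]
  rw [mul_left_comm]
  have h5 : ∀ (i : ℕ) (P : Prop) [Decidable P], aeval y (if P then (-1) ^ i * esymm (Fin r) ℂ i *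
      psum (Fin r) ℂ (k - i) else 0) = if P then aeval y ((-1) ^ i * esymm (Fin r) ℂ i *
      psum (Fin r) ℂ (k - i)) else 0 := fun i P _ => by split_ifs <;> simp
  simp only [h5] at *
  rw [h4]
  simp only [Complex.ofReal_mul, Complex.ofReal_natCast, map_mul, map_natCast, map_pow, map_neg,
    map_one]
  ring

lemma esymm_eq_of_powerSums {r m : ℕ} (hm : 0 < m) (y : Fin r → A) (w : A) (n : ℕ)
    (hp : ∀ i, 1 ≤ i → i ≤ n → (m : A) * ∑ j, y j ^ i + w ^ i = 0) :
    ∀ k ≤ n, aeval y (esymm (Fin r) ℂ k) = algebraMap ℂ A ((-1) ^ k * (bcoef m k : ℝ)) * w ^ k := by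
  intro k
  induction k using Nat.strong_induction_on with
  | _ k ih =>
    intro hk
    rcases Nat.eq_zero_or_pos k with rfl | hk0
    · simp [bcoef_zero]
    · have hu : IsUnit (k : A) := by
        have := (IsUnit.mk0 (k : ℂ) (Nat.cast_ne_zero.mpr hk0.ne')).map (algebraMap ℂ A)
        rwa [map_natCast] at this
      exact hu.mul_left_cancel (newton_step hm y w k (fun i h1 h2 => hp i h1 (h2.trans hk))
        fun i hi => ih i hi (hi.le.trans hk))

lemma pow_eq_zero_of_powerSums {r m : ℕ} (hm : 0 < m) (y : Fin r → A) (w : A)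
    (hp : ∀ i, 1 ≤ i → i ≤ r + 1 → (m : A) * ∑ j, y j ^ i + w ^ i = 0) : w ^ (r + 1) = 0 := by
  have h := esymm_eq_of_powerSums hm y w (r + 1) hp (r + 1) le_rfl
  have h0 : esymm (Fin r) ℂ (r + 1) = 0 := by
    rw [esymm, Finset.powersetCard_eq_empty.mpr (by simp), Finset.sum_empty]
  rw [h0, map_zero] at h
  have hu : IsUnit (algebraMap ℂ A ((-1) ^ (r + 1) * (bcoef m (r + 1) : ℝ))) := by
    refine (IsUnit.mk0 _ ?_).map (algebraMap ℂ A)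
    exact mul_ne_zero (pow_ne_zero _ (by norm_num))
      (Complex.ofReal_ne_zero.mpr (bcoef_pos hm _).ne')
  exact (hu.mul_right_eq_zero).mp h.symm

end Newton

section Staircase

variable {A : Type*} [CommRing A] [Algebra ℂ A]

lemma coeff_mem_of_mul_X_sub_C {S : Subalgebra ℂ A} {q : Polynomial A} {y : A} (hy : y ∈ S)
    (h : ∀ n, (q * (Polynomial.X - Polynomial.C y)).coeff n ∈ S) (n : ℕ) : q.coeff n ∈ S := by
  have key : ∀ i n, q.natDegree < n + i → q.coeff n ∈ S := by
    intro i
    induction i with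
    | zero =>
      intro n hn
      rw [Polynomial.coeff_eq_zero_of_natDegree_lt (by omega)]
      exact S.zero_mem
    | succ i ih =>
      intro n hn
      have h1 := h (n + 1)
      rw [mul_sub, Polynomial.coeff_sub, Polynomial.coeff_mul_X, Polynomial.coeff_mul_C] at h1
      have h2 := ih (n + 1) (by omega)
      have := S.add_mem h1 (S.mul_mem h2 hy)
      rwa [sub_add_cancel] at this
  exact key (q.natDegree + 1) n (by omega)

lemma adjoin_insert_le_mul_span {S : Subalgebra ℂ A} {y : A} {q : Polynomial A} (hq : q.Monic)
    (hqS : ∀ n, q.coeff n ∈ S) (hy : q.eval y = 0) {T : Set A} (hT : T ⊆ insert y S) :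
    Subalgebra.toSubmodule (Algebra.adjoin ℂ T) ≤
      Subalgebra.toSubmodule S * Submodule.span ℂ {x | ∃ a < q.natDegree, x = y ^ a} := by
  set V := Subalgebra.toSubmodule S * Submodule.span ℂ {x | ∃ a < q.natDegree, x = y ^ a} with hV
  have hS : ∀ t ∈ S, ∀ v ∈ V, t * v ∈ V := by
    intro t ht v hv
    have h1 : t * v ∈ Subalgebra.toSubmodule S * V := Submodule.mul_mem_mul ht hv
    rw [hV, ← mul_assoc, Subalgebra.mul_toSubmodule, sup_idem] at h1
    exact h1
  have hmem : ∀ t ∈ S, ∀ a < q.natDegree, t * y ^ a ∈ V := fun t ht a ha =>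
    Submodule.mul_mem_mul ht (Submodule.subset_span ⟨a, ha, rfl⟩)
  have hpow : y ^ q.natDegree ∈ V := by
    have h1 := congrArg (Polynomial.eval y) hq.as_sum
    rw [hy, Polynomial.eval_add, Polynomial.eval_pow, Polynomial.eval_X,
      Polynomial.eval_finsetSum] at h1
    rw [eq_neg_of_add_eq_zero_left h1.symm]
    refine V.neg_mem (V.sum_mem fun i hi => ?_)
    rw [Polynomial.eval_mul, Polynomial.eval_C, Polynomial.eval_pow, Polynomial.eval_X]
    exact hmem _ (hqS i) i (Finset.mem_range.mp hi)
  have hyV : ∀ v ∈ V, y * v ∈ V := by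
    intro v hv
    induction hv using Submodule.mul_induction_on' with
    | mem_mul_mem t ht w hw =>
      induction hw using Submodule.span_induction with
      | mem x hx =>
        obtain ⟨a, ha, rfl⟩ := hx
        rw [mul_left_comm, ← pow_succ']
        rcases Nat.lt_or_ge (a + 1) q.natDegree with h | h
        · exact hmem t ht _ h
        · rw [show a + 1 = q.natDegree by omega]
          exact hS t ht _ hpow
      | zero => rw [mul_zero, mul_zero]; exact V.zero_mem
      | add a b _ _ ha hb => rw [mul_add, mul_add]; exact V.add_mem ha hb
      | smul c a _ ha => rw [mul_smul_comm, mul_smul_comm]; exact V.smul_mem c ha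
    | add a _ b _ ha hb => rw [mul_add]; exact V.add_mem ha hb
  have h1 : (1 : A) ∈ V := by
    rcases Nat.eq_zero_or_pos q.natDegree with h | h
    · rw [h, pow_zero] at hpow; exact hpow
    · have := hmem 1 S.one_mem 0 h
      rwa [pow_zero, one_mul] at this
  have hst : ∀ x ∈ Algebra.adjoin ℂ T, ∀ v ∈ V, x * v ∈ V := by
    intro x hx
    induction hx using Algebra.adjoin_induction with
    | mem x hx =>
      rcases hT hx with rfl | h
      · exact hyV
      · exact hS x h
    | algebraMap c => intro v hv; rw [← Algebra.smul_def]; exact V.smul_mem c hv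
    | add a b _ _ ha hb => intro v hv; rw [add_mul]; exact V.add_mem (ha v hv) (hb v hv)
    | mul a b _ _ ha hb => intro v hv; rw [mul_assoc]; exact ha _ (hb v hv)
  intro x hx
  have := hst x hx 1 h1
  rwa [mul_one] at this

/-- The subalgebra generated by `w` and the `y l` with `j ≤ l < r`. -/
def tailAlg (r : ℕ) (y : ℕ → A) (w : A) (j : ℕ) : Subalgebra ℂ A :=
  Algebra.adjoin ℂ (insert w {x | ∃ l, j ≤ l ∧ l < r ∧ x = y l})

lemma tailAlg_le {r : ℕ} {y : ℕ → A} {w : A} {j : ℕ} :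
    tailAlg r y w (j + 1) ≤ tailAlg r y w j := by
  refine Algebra.adjoin_mono (Set.insert_subset_insert ?_)
  rintro x ⟨l, h1, h2, rfl⟩
  exact ⟨l, by omega, h2, rfl⟩

lemma mem_tailAlg {r : ℕ} {y : ℕ → A} {w : A} {j : ℕ} (hj : j < r) : y j ∈ tailAlg r y w j :=
  Algebra.subset_adjoin (Set.mem_insert_of_mem _ ⟨j, le_rfl, hj, rfl⟩)

lemma tailAlg_le_prod {r : ℕ} {y : ℕ → A} {w : A} (hw : w ^ (r + 1) = 0)
    (hp : ∀ n, (∏ l ∈ Finset.range r, (Polynomial.X - Polynomial.C (y l))).coeff n ∈ tailAlg r y w r) {j : ℕ}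
    (hj : j ≤ r) :
    (∀ n, (∏ l ∈ Finset.range j, (Polynomial.X - Polynomial.C (y l))).coeff n ∈ tailAlg r y w j) ∧
      Subalgebra.toSubmodule (tailAlg r y w j) ≤
        Submodule.span ℂ {x | ∃ a < r + 1, x = w ^ a} *
          ∏ l ∈ Finset.Ico j r, Submodule.span ℂ {x | ∃ a < l + 1, x = y l ^ a} := by
  induction hj using Nat.decreasingInduction with
  | self =>
    refine ⟨hp, ?_⟩
    nontriviality A
    have h1 := adjoin_insert_le_mul_span (S := ⊥) (y := w) (q := (Polynomial.X : Polynomial A) ^ (r + 1))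
      (Polynomial.monic_X_pow _) (fun n => by
        rw [Polynomial.coeff_X_pow]
        split_ifs
        exacts [one_mem _, zero_mem _]) (by simpa using hw)
      (T := insert w {x | ∃ l, r ≤ l ∧ l < r ∧ x = y l}) (by
        refine Set.insert_subset_insert ?_
        rintro x ⟨l, h1, h2, _⟩
        omega)
    rw [Polynomial.natDegree_X_pow] at h1
    rw [Finset.Ico_self, Finset.prod_empty, mul_one]
    refine h1.trans ?_
    rw [Algebra.toSubmodule_bot, one_mul]
  | of_succ j hj ih =>
    obtain ⟨h1, h2⟩ := ih
    rw [Finset.prod_range_succ] at h1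
    have h3 : ∀ n, (∏ l ∈ Finset.range j, (Polynomial.X - Polynomial.C (y l))).coeff n ∈ tailAlg r y w j :=
      coeff_mem_of_mul_X_sub_C (mem_tailAlg hj) fun n => tailAlg_le (h1 n)
    refine ⟨h3, ?_⟩
    nontriviality A
    have h4 := adjoin_insert_le_mul_span (S := tailAlg r y w (j + 1)) (y := y j)
      (q := (∏ l ∈ Finset.range j, (Polynomial.X - Polynomial.C (y l))) * (Polynomial.X - Polynomial.C (y j)))
      ((Polynomial.monic_prod_of_monic _ _ fun l _ => Polynomial.monic_X_sub_C _).mul (Polynomial.monic_X_sub_C _)) h1 (by simp)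
      (T := insert w {x | ∃ l, j ≤ l ∧ l < r ∧ x = y l}) (by
        rintro x (rfl | ⟨l, hl, hlr, rfl⟩)
        · exact Or.inr (Algebra.subset_adjoin (Set.mem_insert _ _))
        · rcases hl.eq_or_lt with rfl | hl
          · exact Or.inl rfl
          · exact Or.inr (Algebra.subset_adjoin (Set.mem_insert_of_mem _ ⟨l, hl, hlr, rfl⟩)))
    refine h4.trans ?_
    have hdeg : ((∏ l ∈ Finset.range j, (Polynomial.X - Polynomial.C (y l))) * (Polynomial.X - Polynomial.C (y j))).natDegree = j + 1 := by
      rw [← Finset.prod_range_succ (fun l => (Polynomial.X - Polynomial.C (y l))), Polynomial.natDegree_prod_of_monic _ _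
        fun l _ => Polynomial.monic_X_sub_C _]
      simp
    rw [hdeg, Finset.prod_eq_prod_Ico_succ_bot hj, mul_left_comm, mul_comm (Submodule.span ℂ {x | ∃ a < j + 1, x = y j ^ a})]
    exact mul_le_mul' h2 le_rfl

end Staircase

section StaircaseBasis

variable {r m : ℕ}

/-- The weights in the power sums `m ∑ y_j^i + z^i`. -/
def cw (r m : ℕ) : Fin r ⊕ Unit → ℂ := Sum.elim (fun _ => (m : ℂ)) (fun _ => 1)

/-- The weights in the deformed Laplacian. -/
def gw (r m : ℕ) : Fin r ⊕ Unit → ℝ := Sum.elim (fun _ => 1) (fun _ => (m : ℝ))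

/-- The leading symbol of the integral attached to the power sum of exponent `i`. -/
def lsym (r m i : ℕ) : Rr1 r :=
  ∑ s, (cw r m s * (2 * (gw r m s : ℂ)) ^ i) • X s ^ i

/-- The index set of the staircase monomials. -/
abbrev StIdx (r : ℕ) := Fin (r + 1) × ∀ l : Fin r, Fin ((l : ℕ) + 1)

/-- The staircase monomials. -/
def stMon (r : ℕ) (a : StIdx r) : Rr1 r :=
  X (Sum.inr ()) ^ (a.1 : ℕ) * ∏ l, X (Sum.inl l) ^ (a.2 l : ℕ)

lemma card_StIdx (r : ℕ) : Fintype.card (StIdx r) = (r + 1).factorial := by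
  rw [Fintype.card_prod, Fintype.card_fin, Fintype.card_pi, Nat.factorial_succ]
  simp only [Fintype.card_fin]
  rw [Fin.prod_univ_eq_prod_range (fun i => i + 1), Finset.prod_range_add_one_eq_factorial]

lemma stMon_hom (r : ℕ) (a : StIdx r) :
    (stMon r a).IsHomogeneous ((a.1 : ℕ) + ∑ l, (a.2 l : ℕ)) := by
  refine (isHomogeneous_X_pow _ _).mul ?_
  exact IsHomogeneous.prod _ _ _ fun l _ => isHomogeneous_X_pow _ _

lemma span_stMon_of_surjective {A : Type*} [CommRing A] [Algebra ℂ A] (hm : 0 < m)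
    (π : Rr1 r →ₐ[ℂ] A) (hπ : Function.Surjective π)
    (h0 : ∀ i, 1 ≤ i → i ≤ r + 1 → π (lsym r m i) = 0) (x : A) :
    x ∈ Submodule.span ℂ (Set.range fun a => π (stMon r a)) := by
  have hm' : (m : ℂ) ≠ 0 := by exact_mod_cast hm.ne'
  set y : ℕ → A := fun l => if h : l < r then π (X (Sum.inl ⟨l, h⟩)) else 0 with hy
  set w : A := (m : ℂ) • π (X (Sum.inr ())) with hw
  have hyj : ∀ j : Fin r, y j = π (X (Sum.inl j)) := fun j => by simp [hy]
  have hp : ∀ i, 1 ≤ i → i ≤ r + 1 → (m : A) * ∑ j : Fin r, y j ^ i + w ^ i = 0 := by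
    intro i h1 h2
    have h3 := h0 i h1 h2
    rw [lsym, Fintype.sum_sum_type, map_add, map_sum, map_sum] at h3
    simp only [cw, gw, Sum.elim_inl, Sum.elim_inr, map_smul, map_pow, Finset.univ_unique,
      Finset.sum_singleton, Complex.ofReal_one, mul_one, Complex.ofReal_natCast, one_mul] at h3
    have h4 : (2 : ℂ) ^ i • ((m : A) * ∑ j : Fin r, y j ^ i + w ^ i) = 0 := by
      rw [← h3, hw, smul_add, smul_pow, smul_smul, ← mul_pow, Finset.mul_sum, Finset.smul_sum]
      refine congrArg (· + _) (Finset.sum_congr rfl fun j _ => ?_)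
      rw [hyj, ← nsmul_eq_mul, ← Nat.cast_smul_eq_nsmul ℂ, smul_smul, mul_comm]
    exact (smul_eq_zero_iff_right (pow_ne_zero i two_ne_zero)).mp h4
  have hwr := pow_eq_zero_of_powerSums hm (fun j : Fin r => y j) w hp
  have hes := esymm_eq_of_powerSums hm (fun j : Fin r => y j) w (r + 1) hp
  have hc : ∀ n, (∏ l ∈ Finset.range r, (Polynomial.X - Polynomial.C (y l))).coeff n ∈
      tailAlg r y w r := by
    intro n
    have h1 : (∏ l ∈ Finset.range r, (Polynomial.X - Polynomial.C (y l))) =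
        (Multiset.map (fun t => Polynomial.X - Polynomial.C t)
          (Finset.univ.val.map fun j : Fin r => y j)).prod := by
      rw [Finset.prod_range, Multiset.map_map]
      rfl
    have hcard : Multiset.card (Finset.univ.val.map fun j : Fin r => y j) = r := by simp
    rcases Nat.lt_or_ge r n with hn | hn
    · nontriviality A
      rw [Polynomial.coeff_eq_zero_of_natDegree_lt]
      · exact zero_mem _
      · refine lt_of_le_of_lt ?_ hn
        rw [h1]
        exact (Polynomial.natDegree_multiset_prod_X_sub_C_eq_card _).le.trans hcard.le
    · rw [h1, Multiset.prod_X_sub_C_coeff _ (by rw [hcard]; exact hn), hcard,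
        ← aeval_esymm_eq_multiset_esymm (Fin r) ℂ, hes _ (by omega)]
      refine mul_mem (pow_mem (neg_mem (one_mem _)) _) (mul_mem (Subalgebra.algebraMap_mem _ _)
        (pow_mem (Algebra.subset_adjoin (Set.mem_insert _ _)) _))
  obtain ⟨-, h2⟩ := tailAlg_le_prod hwr hc (Nat.zero_le r)
  have h3 : x ∈ Subalgebra.toSubmodule (tailAlg r y w 0) := by
    obtain ⟨p, rfl⟩ := hπ x
    rw [Subalgebra.mem_toSubmodule]
    induction p using MvPolynomial.induction_on with
    | C c => rw [← algebraMap_eq, AlgHom.commutes]; exact Subalgebra.algebraMap_mem _ _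
    | add p q hp hq => rw [map_add]; exact add_mem hp hq
    | mul_X p s hp =>
      rw [map_mul]
      refine mul_mem hp ?_
      rcases s with j | u
      · exact Algebra.subset_adjoin (Set.mem_insert_of_mem _ ⟨j, Nat.zero_le _, j.2, (hyj j).symm⟩)
      · have h4 : π (X (Sum.inr u)) = (m : ℂ)⁻¹ • w := by
          rw [hw, smul_smul, inv_mul_cancel₀ hm', one_smul]
        rw [h4]
        exact Subalgebra.smul_mem _ (Algebra.subset_adjoin (Set.mem_insert _ _)) _
  have h4 := h2 h3
  rw [Submodule.prod_span, Submodule.span_mul_span] at h4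
  refine Submodule.span_le.mpr ?_ h4
  rintro t ⟨u, ⟨a0, ha0, rfl⟩, v, hv, rfl⟩
  obtain ⟨g, hg, rfl⟩ := Set.mem_finsetProd _ _ _ |>.mp hv
  choose! a ha hga using fun i (hi : i ∈ Finset.Ico 0 r) => hg hi
  have h5 : w ^ a0 * ∏ l ∈ Finset.Ico 0 r, g l =
      (m : ℂ) ^ a0 • π (stMon r (⟨a0, ha0⟩, fun l => ⟨a l, ha l (by simp)⟩)) := by
    have h6 : ∏ l ∈ Finset.Ico 0 r, g l = ∏ l : Fin r, g l := by
      rw [← Finset.range_eq_Ico, Finset.prod_range]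
    rw [stMon, map_mul, map_pow, map_prod, ← smul_mul_assoc, hw, smul_pow, h6]
    refine congrArg _ (Finset.prod_congr rfl fun l _ => ?_)
    rw [map_pow, ← hyj, hga l (by simp)]
  simp only [h5]
  exact Submodule.smul_mem _ _ (Submodule.subset_span ⟨_, rfl⟩)

lemma mem_span_stMon_sup (hm : 0 < m) (k : ℕ) (h : Rr1 r) (hh : h.IsHomogeneous k) :
    h ∈ Submodule.span ℂ (Set.range (stMon r)) ⊔
      Submodule.span ℂ {f | ∃ (i : Fin (r + 1)) (a : ℕ) (g : Rr1 r), g.IsHomogeneous a ∧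
        a + (i + 1) = k ∧ f = lsym r m (i + 1) * g} := by
  set I : Ideal (Rr1 r) := Ideal.span (Set.range fun i : Fin (r + 1) => lsym r m (i + 1)) with hI
  have h1 := span_stMon_of_surjective hm (Ideal.Quotient.mkₐ ℂ I)
    (Ideal.Quotient.mkₐ_surjective ℂ I) (fun i h1 h2 => by
      rw [Ideal.Quotient.mkₐ_eq_mk, Ideal.Quotient.eq_zero_iff_mem]
      exact Ideal.subset_span ⟨⟨i - 1, by omega⟩, by simp only [Nat.sub_add_cancel h1]⟩)
    (Ideal.Quotient.mkₐ ℂ I h)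
  have h2 : (Set.range fun a => Ideal.Quotient.mkₐ ℂ I (stMon r a)) =
      (Ideal.Quotient.mkₐ ℂ I).toLinearMap '' Set.range (stMon r) := by
    rw [← Set.range_comp]; rfl
  rw [h2, Submodule.span_image] at h1
  obtain ⟨b, hb, hbh⟩ := h1
  have h3 : h - b ∈ I := by
    rw [← Ideal.Quotient.eq_zero_iff_mem, map_sub, sub_eq_zero]
    exact hbh.symm
  have hlh : ∀ i, (lsym r m i).IsHomogeneous i := fun i => by
    refine IsHomogeneous.sum _ _ _ fun s _ => ?_
    rw [smul_eq_C_mul]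
    exact (isHomogeneous_X_pow s i).C_mul _
  have h4 : homogeneousComponent k (h - b) ∈ Submodule.span ℂ {f | ∃ (i : Fin (r + 1)) (a : ℕ)
      (g : Rr1 r), g.IsHomogeneous a ∧ a + (i + 1) = k ∧ f = lsym r m (i + 1) * g} := by
    obtain ⟨c, hc⟩ := Ideal.mem_span_range_iff_exists_fun.mp h3
    rw [← hc, map_sum]
    refine Submodule.sum_mem _ fun i _ => ?_
    rw [← sum_homogeneousComponent (c i), Finset.sum_mul, map_sum]
    refine Submodule.sum_mem _ fun a _ => ?_
    have h5 := (homogeneousComponent_isHomogeneous a (c i)).mul (hlh (i + 1))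
    rw [homogeneousComponent_of_mem ((mem_homogeneousSubmodule _ _).mpr h5)]
    split_ifs with h6
    · exact Submodule.subset_span ⟨i, a, _, homogeneousComponent_isHomogeneous a (c i), h6.symm,
        mul_comm _ _⟩
    · exact zero_mem _
  have h5 : homogeneousComponent k b ∈ Submodule.span ℂ (Set.range (stMon r)) := by
    clear h4 h3 hbh
    induction hb using Submodule.span_induction with
    | mem x hx =>
      obtain ⟨a, rfl⟩ := hx
      rw [homogeneousComponent_of_mem ((mem_homogeneousSubmodule _ _).mpr (stMon_hom r a))]
      split_ifs
      · exact Submodule.subset_span ⟨a, rfl⟩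
      · exact zero_mem _
    | zero => rw [map_zero]; exact zero_mem _
    | add x y _ _ hx hy => rw [map_add]; exact add_mem hx hy
    | smul c x _ hx => rw [map_smul]; exact Submodule.smul_mem _ _ hx
  have h6 : h = homogeneousComponent k b + homogeneousComponent k (h - b) := by
    rw [← map_add, add_sub_cancel, homogeneousComponent_of_mem ((mem_homogeneousSubmodule _ _).mpr hh),
      if_pos rfl]
  rw [h6]
  exact Submodule.add_mem_sup h5 h4

end StaircaseBasis

section GaussianIntegral

open MeasureTheory

lemma integrable_pow_mul_cexp_neg_mul_sq {b : ℝ} (hb : 0 < b) (c : ℝ) (n : ℕ) :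
    Integrable fun t : ℝ => ((t : ℂ) + c * Complex.I) ^ n *
      Complex.exp (-(b : ℂ) * ((t : ℂ) + c * Complex.I) ^ 2) := by
  have h1 : ∀ k : ℕ, Integrable fun t : ℝ => (t : ℂ) ^ k *
      Complex.exp (-(b : ℂ) * ((t : ℂ) + c * Complex.I) ^ 2) := by
    intro k
    have h2 := (integrable_rpow_mul_exp_neg_mul_sq hb (s := (k : ℝ))
      (by linarith [(Nat.cast_nonneg k : (0 : ℝ) ≤ k)])).norm.const_mul (Real.exp (b * c ^ 2))
    refine h2.mono' (by fun_prop) (Filter.Eventually.of_forall fun t => ?_)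
    rw [norm_mul, norm_pow, Complex.norm_real, GaussianFourier.norm_cexp_neg_mul_sq_add_mul_I,
      Real.rpow_natCast, norm_mul, norm_pow, Real.norm_eq_abs (Real.exp _), Real.abs_exp]
    simp only [Complex.ofReal_re, Complex.ofReal_im]
    rw [mul_left_comm, ← Real.exp_add]
    exact le_of_eq (congrArg _ (congrArg _ (by ring)))
  simp only [add_pow, Finset.sum_mul]
  refine integrable_finsetSum _ fun k _ => ?_
  refine ((h1 k).const_mul ((c * Complex.I) ^ (n - k) * (n.choose k : ℂ))).congr
    (Filter.Eventually.of_forall fun t => ?_)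
  simp only
  rw [Commute.add_pow (Commute.all _ _)]
  ring

variable {σ : Type*} [Fintype σ]

/-- The point with real part `x` and imaginary part `η`. -/
def shiftPt (η x : σ → ℝ) (s : σ) : ℂ := (x s : ℂ) + η s * Complex.I

/-- The Gaussian weight on a shifted real subspace. -/
def gaussW (γ η x : σ → ℝ) : ℂ :=
  ∏ s, Complex.exp (-((((γ s)⁻¹ / 2 : ℝ)) : ℂ) * ((x s : ℂ) + η s * Complex.I) ^ 2)

lemma integrable_eval_mul_gaussW {γ : σ → ℝ} (hγ : ∀ s, 0 < γ s) (η : σ → ℝ)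
    (w : MvPolynomial σ ℂ) : Integrable fun x => eval (shiftPt η x) w * gaussW γ η x := by
  simp only [eval_eq', Finset.sum_mul]
  refine integrable_finsetSum _ fun d _ => ?_
  have h1 := Integrable.fintype_prod (μ := fun _ : σ => (volume : Measure ℝ)) fun s =>
    integrable_pow_mul_cexp_neg_mul_sq (half_pos (inv_pos.mpr (hγ s))) (η s) (d s)
  refine (h1.const_mul (coeff d w)).congr (Filter.Eventually.of_forall fun x => ?_)
  simp only [gaussW, shiftPt, Finset.prod_mul_distrib]
  ring

omit [Fintype σ] in
lemma continuous_eval_shiftPt (η : σ → ℝ) (w : MvPolynomial σ ℂ) :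
    Continuous fun x => eval (shiftPt η x) w := by
  refine (MvPolynomial.continuous_eval w).comp ?_
  unfold shiftPt
  fun_prop

omit [Fintype σ] in
lemma hasDerivAt_eval [DecidableEq σ] (p : σ → ℂ) (s : σ) (w : MvPolynomial σ ℂ) :
    HasDerivAt (fun t : ℝ => eval (fun i => p i + ((Pi.single s t : σ → ℝ) i : ℂ)) w)
      (eval p (pderiv s w)) 0 := by
  induction w using MvPolynomial.induction_on with
  | C c => simpa using hasDerivAt_const (0 : ℝ) c
  | add f g hf hg => simp only [map_add]; exact hf.add hg
  | mul_X f i hf =>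
    have h1 : HasDerivAt (fun t : ℝ => p i + ((Pi.single s t : σ → ℝ) i : ℂ))
        (eval p (pderiv s (X i))) 0 := by
      by_cases h : i = s
      · subst h
        simpa using (Complex.ofRealCLM.hasDerivAt (x := (0 : ℝ))).const_add (p i)
      · simpa [h, pderiv_X, Pi.single_apply, Ne.symm h] using hasDerivAt_const (0 : ℝ) (p i)
    have h2 := hf.mul h1
    simp only [Pi.single_zero, Pi.zero_apply, Complex.ofReal_zero, add_zero] at h2
    simp only [map_mul, eval_X, Derivation.leibniz, map_add, smul_eq_mul]
    refine h2.congr_deriv ?_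
    ring

omit [Fintype σ] in
lemma exists_le_norm_eval {η : σ → ℝ} (hη : Function.Injective η) {κ : MvPolynomial σ ℂ}
    (hκ : κ ∈ Submonoid.closure {p : MvPolynomial σ ℂ | ∃ a b, a ≠ b ∧ p = X a - X b}) :
    ∃ c : ℝ, 0 < c ∧ ∀ x, c ≤ ‖eval (shiftPt η x) κ‖ := by
  induction hκ using Submonoid.closure_induction with
  | mem p hp =>
    obtain ⟨a, b, hab, rfl⟩ := hp
    refine ⟨|η a - η b|, abs_pos.mpr (sub_ne_zero.mpr fun h => hab (hη h)), fun x => ?_⟩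
    refine le_trans (le_of_eq ?_) (Complex.abs_im_le_norm _)
    simp [shiftPt]
  | one => exact ⟨1, one_pos, fun x => by simp⟩
  | mul p q _ _ hp hq =>
    obtain ⟨c, hc, h1⟩ := hp
    obtain ⟨d, hd, h2⟩ := hq
    refine ⟨c * d, mul_pos hc hd, fun x => ?_⟩
    rw [map_mul, norm_mul]
    exact mul_le_mul (h1 x) (h2 x) hd.le (norm_nonneg _)

lemma gaussW_eq (γ η x : σ → ℝ) : gaussW γ η x =
    Complex.exp (eval (shiftPt η x) (∑ s, C (-((((γ s)⁻¹ / 2 : ℝ)) : ℂ)) * X s ^ 2)) := by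
  rw [gaussW, ← Complex.exp_sum, map_sum]
  simp [shiftPt]

omit [Fintype σ] in
lemma hasLineDerivAt_eval [DecidableEq σ] (η x : σ → ℝ) (s : σ) (w : MvPolynomial σ ℂ) :
    HasLineDerivAt ℝ (fun x => eval (shiftPt η x) w) (eval (shiftPt η x) (pderiv s w)) x
      (Pi.single s 1) := by
  unfold HasLineDerivAt
  have h : ∀ t : ℝ, shiftPt η (x + t • Pi.single s 1) =
      fun i => shiftPt η x i + ((Pi.single s t : σ → ℝ) i : ℂ) := by
    intro t
    funext i
    by_cases h : i = s
    · subst h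
      simp [shiftPt]
      ring
    · simp [shiftPt, h]
  simp only [h]
  exact hasDerivAt_eval _ _ _

lemma hasLineDerivAt_gaussW [DecidableEq σ] (γ η x : σ → ℝ) (s : σ) :
    HasLineDerivAt ℝ (gaussW γ η) (gaussW γ η x * (-(((γ s)⁻¹ : ℝ) : ℂ) * shiftPt η x s)) x
      (Pi.single s 1) := by
  have h := hasLineDerivAt_eval η x s (∑ s, C (-((((γ s)⁻¹ / 2 : ℝ)) : ℂ)) * X s ^ 2)
  have h2 : eval (shiftPt η x) (pderiv s (∑ s, C (-((((γ s)⁻¹ / 2 : ℝ)) : ℂ)) * X s ^ 2)) =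
      -(((γ s)⁻¹ : ℝ) : ℂ) * shiftPt η x s := by
    rw [map_sum, Finset.sum_eq_single s]
    · simp [Derivation.leibniz_pow]
      ring
    · intro i _ hi
      simp [Derivation.leibniz_pow, pderiv_X, hi]
    · simp
  rw [h2] at h
  have h3 := HasDerivAt.cexp h
  simp only [zero_smul, add_zero] at h3
  rw [← gaussW_eq] at h3
  refine HasDerivAt.congr_of_eventuallyEq h3 (Filter.Eventually.of_forall fun t => ?_)
  exact gaussW_eq _ _ _

/-- A quasi-invariant system carries a Gaussian functional, obtained by integrating along a
shifted real subspace avoiding the hyperplanes. -/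
lemma QSys.nonempty_gauss (S : QSys σ) : Nonempty S.Gauss := by
  classical
  set η : σ → ℝ := fun s => ((Fintype.equivFin σ s : ℕ) : ℝ) with hη
  have hinj : Function.Injective η := fun a b h => by
    exact (Fintype.equivFin σ).injective (Fin.ext (Nat.cast_injective (R := ℝ) h))
  obtain ⟨c, hc, hcκ⟩ := exists_le_norm_eval hinj S.κ_mem
  have hκ0 : ∀ x, eval (shiftPt η x) S.κ ≠ 0 := fun x h => by
    have := hcκ x
    rw [h, norm_zero] at this
    linarith
  have hbd : ∀ (n : ℕ) (w : MvPolynomial σ ℂ), Integrable fun x =>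
      ((eval (shiftPt η x) S.κ) ^ n)⁻¹ * (eval (shiftPt η x) w * gaussW S.γ η x) := by
    intro n w
    refine (integrable_eval_mul_gaussW S.γ_pos η w).bdd_mul (c := (c ^ n)⁻¹) ?_ ?_
    · exact (((continuous_eval_shiftPt η S.κ).pow n).inv₀ fun x =>
        pow_ne_zero _ (hκ0 x)).aestronglyMeasurable
    · refine Filter.Eventually.of_forall fun x => ?_
      rw [norm_inv, norm_pow]
      exact inv_anti₀ (pow_pos hc n) (pow_le_pow_left₀ hc.le (hcκ x) n)
  let J : MvPolynomial σ ℂ →ₗ[ℂ] ℂ :=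
    { toFun := fun w => ∫ x, ((eval (shiftPt η x) S.κ) ^ 2)⁻¹ *
        (eval (shiftPt η x) w * gaussW S.γ η x)
      map_add' := fun a b => by
        rw [← integral_add (hbd 2 a) (hbd 2 b)]
        refine integral_congr_ae (Filter.Eventually.of_forall fun x => ?_)
        simp only [map_add]
        ring
      map_smul' := fun a b => by
        rw [RingHom.id_apply, smul_eq_mul, ← integral_const_mul]
        refine integral_congr_ae (Filter.Eventually.of_forall fun x => ?_)
        simp only [smul_eval]
        ring }
  have hJ : ∀ w, J w = ∫ x, ((eval (shiftPt η x) S.κ) ^ 2)⁻¹ *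
        (eval (shiftPt η x) w * gaussW S.γ η x) := fun w => rfl
  refine ⟨⟨J, fun s w => ?_, ?_⟩⟩
  · set B := ContinuousLinearMap.mul ℝ ℂ with hB
    have h1 := integral_bilinear_hasLineDerivAt_right_eq_neg_left_of_integrable
      (μ := (volume : Measure (σ → ℝ))) (B := B) (f := fun _ => (1 : ℂ)) (f' := fun _ => 0)
      (g := fun x => (eval (shiftPt η x) S.κ)⁻¹ * (eval (shiftPt η x) w * gaussW S.γ η x))
      (g' := fun x => ((eval (shiftPt η x) S.κ) ^ 2)⁻¹ *
        (eval (shiftPt η x) (S.κ * pderiv s w - w * pderiv s S.κ) * gaussW S.γ η x) -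
        (((S.γ s)⁻¹ : ℝ) : ℂ) * (((eval (shiftPt η x) S.κ) ^ 2)⁻¹ *
        (eval (shiftPt η x) (S.κ * (X s * w)) * gaussW S.γ η x)))
      (v := Pi.single s 1) (by simp [hB]) ?_ ?_ (fun x _ => ?_) (fun x _ => ?_)
    · simp only [hB, ContinuousLinearMap.mul_apply', one_mul, zero_mul, integral_zero,
        neg_zero] at h1
      rw [integral_sub (hbd 2 _) ((hbd 2 _).const_mul _), integral_const_mul, ← hJ, ← hJ] at h1
      rw [← Complex.ofReal_inv]
      exact sub_eq_zero.mp h1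
    · simp only [hB, ContinuousLinearMap.mul_apply', one_mul]
      exact (hbd 2 _).sub ((hbd 2 _).const_mul _)
    · simp only [hB, ContinuousLinearMap.mul_apply', one_mul]
      simpa only [pow_one] using hbd 1 w
    · exact hasDerivAt_const _ _
    · have e1 := hasLineDerivAt_eval η x s S.κ
      have e2 := hasLineDerivAt_eval η x s w
      have e3 := hasLineDerivAt_gaussW S.γ η x s
      unfold HasLineDerivAt at e1 e2 e3 ⊢
      have e4 := (HasDerivAt.inv e1 (by simpa using hκ0 x)).mul (e2.mul e3)
      refine HasDerivAt.congr_deriv e4 ?_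
      have h0 := hκ0 x
      simp only [Pi.mul_apply, Pi.inv_apply, zero_smul, add_zero, map_sub, map_mul, eval_X]
      field_simp
      ring
  · have h1 : J (S.κ * S.κ) = ∫ x, gaussW S.γ η x := by
      rw [hJ]
      refine integral_congr_ae (Filter.Eventually.of_forall fun x => ?_)
      simp only [map_mul]
      have h0 := hκ0 x
      field_simp
    rw [h1]
    unfold gaussW
    rw [integral_fintype_prod_volume_eq_prod (f := fun s (t : ℝ) =>
      Complex.exp (-((((S.γ s)⁻¹ / 2 : ℝ)) : ℂ) * ((t : ℂ) + η s * Complex.I) ^ 2))]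
    refine Finset.prod_ne_zero_iff.mpr fun s _ => ?_
    have hpos : 0 < (S.γ s)⁻¹ / 2 := half_pos (inv_pos.mpr (S.γ_pos s))
    rw [GaussianFourier.integral_cexp_neg_mul_sq_add_real_mul_I (by simpa using hpos)]
    rw [Complex.cpow_ne_zero_iff]
    left
    refine div_ne_zero (by exact_mod_cast Real.pi_ne_zero) ?_
    exact_mod_cast hpos.ne'

end GaussianIntegral

section HyperplaneCalculus

variable {σ : Type*}

lemma X_sub_X_dvd_iff_aeval [DecidableEq σ] (a b : σ) (p : MvPolynomial σ ℂ) :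
    X a - X b ∣ p ↔ aeval (Function.update X a (X b) : σ → MvPolynomial σ ℂ) p = 0 := by
  set φ := aeval (R := ℂ) (Function.update X a (X b) : σ → MvPolynomial σ ℂ) with hφ
  have h1 : ∀ q, X a - X b ∣ q - φ q := by
    intro q
    induction q using MvPolynomial.induction_on with
    | C c => rw [← algebraMap_eq, AlgHom.commutes, sub_self]; exact dvd_zero _
    | add p q hp hq => rw [map_add, add_sub_add_comm]; exact dvd_add hp hq
    | mul_X p i hp =>
      rw [map_mul, hφ, aeval_X, ← hφ]
      by_cases h : i = a
      · subst h
        rw [Function.update_self]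
        have : p * X i - φ p * X b = (p - φ p) * X b + p * (X i - X b) := by ring
        rw [this]
        exact dvd_add (hp.mul_right _) (dvd_mul_left _ _)
      · rw [Function.update_of_ne h, ← sub_mul]
        exact hp.mul_right _
  constructor
  · rintro ⟨q, rfl⟩
    have h : φ (X a - X b) = 0 := by
      rw [map_sub, hφ, aeval_X, aeval_X, Function.update_self]
      by_cases h : b = a
      · subst h; simp
      · rw [Function.update_of_ne h, sub_self]
    rw [map_mul, h, zero_mul]
  · intro h
    have := h1 p
    rwa [h, sub_zero] at this

lemma X_sub_X_dvd_iff (a b : σ) (p : MvPolynomial σ ℂ) :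
    X a - X b ∣ p ↔ ∀ v : σ → ℂ, v a = v b → eval v p = 0 := by
  classical
  constructor
  · rintro ⟨q, rfl⟩ v hv
    simp [hv]
  · intro h
    rw [X_sub_X_dvd_iff_aeval]
    refine MvPolynomial.funext fun v => ?_
    have h1 : eval v (aeval (Function.update X a (X b) : σ → MvPolynomial σ ℂ) p) =
        eval (Function.update v a (v b)) p := by
      rw [← coe_aeval_eq_eval, RingHom.coe_coe, ← coe_aeval_eq_eval, RingHom.coe_coe,
        ← AlgHom.comp_apply]
      refine congrArg (fun g : MvPolynomial σ ℂ →ₐ[ℂ] ℂ => g p) (algHom_ext fun i => ?_)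
      by_cases h : i = a
      · subst h; simp
      · simp [h]
    rw [h1, map_zero]
    refine h _ ?_
    by_cases hb : b = a
    · rw [hb]
    · rw [Function.update_self, Function.update_of_ne hb]

lemma X_sub_X_ne_zero {a b : σ} (hab : a ≠ b) : (X a - X b : MvPolynomial σ ℂ) ≠ 0 :=
  sub_ne_zero.mpr fun h => hab (X_injective h)

lemma prime_X_sub_X {a b : σ} (hab : a ≠ b) : Prime (X a - X b : MvPolynomial σ ℂ) := by
  classical
  refine ⟨X_sub_X_ne_zero hab, fun h => ?_, fun p q h => ?_⟩
  · have h1 := (X_sub_X_dvd_iff a b 1).mp h.dvd 0 rfl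
    simp at h1
  · rw [X_sub_X_dvd_iff_aeval, map_mul, mul_eq_zero] at h
    simpa only [X_sub_X_dvd_iff_aeval] using h

variable [Fintype σ] {γ : σ → ℝ}

lemma grad_X_sub_X_right (u : MvPolynomial σ ℂ) (a b : σ) :
    grad γ u (X a - X b) = C (γ a : ℂ) * pderiv a u - C (γ b : ℂ) * pderiv b u := by
  classical
  have h : ∀ a, grad γ u (X a) = C (γ a : ℂ) * pderiv a u := by
    intro a
    rw [grad_apply, Finset.sum_eq_single a]
    · rw [pderiv_X_self, mul_one]
    · intro b _ hb
      rw [pderiv_X_of_ne hb.symm, mul_zero]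
    · intro h; exact absurd (Finset.mem_univ a) h
  rw [map_sub, h, h]

lemma grad_X_sub_X (u : MvPolynomial σ ℂ) (a b : σ) :
    grad γ (X a - X b) u = C (γ a : ℂ) * pderiv a u - C (γ b : ℂ) * pderiv b u := by
  rw [grad_comm, grad_X_sub_X_right]

lemma grad_X_sub_X_self {a b : σ} (hab : a ≠ b) :
    grad γ (X a - X b) (X a - X b) = C ((γ a : ℂ) + γ b) := by
  rw [grad_X_sub_X, map_sub, map_sub, pderiv_X_self, pderiv_X_self, pderiv_X_of_ne hab.symm,
    pderiv_X_of_ne hab, C_add]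
  ring

lemma lapl_X_sub_X (a b : σ) : lapl γ (X a - X b) = 0 := by
  classical
  rw [lapl_apply]
  refine Finset.sum_eq_zero fun s _ => ?_
  rw [map_sub, pderiv_X, pderiv_X]
  simp only [Pi.single_apply]
  split_ifs <;> simp

lemma lapl_X_sub_X_pow {a b : σ} (hab : a ≠ b) (n : ℕ) :
    lapl γ ((X a - X b) ^ (n + 2)) =
      C ((γ a : ℂ) + γ b) * (((n + 2 : ℕ) : MvPolynomial σ ℂ) * ((n + 1 : ℕ) : MvPolynomial σ ℂ)) *
        (X a - X b) ^ n := by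
  induction n with
  | zero =>
    rw [pow_succ', lapl_mul, zero_add, pow_one, lapl_X_sub_X, grad_X_sub_X_self hab]
    push_cast
    ring
  | succ n ih =>
    rw [pow_succ', lapl_mul, ih, lapl_X_sub_X, Derivation.leibniz_pow, grad_X_sub_X_self hab]
    simp only [smul_eq_mul, nsmul_eq_mul, show n + 2 - 1 = n + 1 from rfl]
    push_cast
    ring

lemma grad_X_sub_X_lapl (a b : σ) (f : MvPolynomial σ ℂ) :
    grad γ (X a - X b) (lapl γ f) = lapl γ (grad γ (X a - X b) f) := by
  have hC : ∀ (s : σ) (c : ℂ) (g : MvPolynomial σ ℂ), pderiv s (C c * g) = C c * pderiv s g :=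
    fun s c g => by rw [← smul_eq_C_mul, Derivation.map_smul, smul_eq_C_mul]
  simp only [grad_X_sub_X, lapl_apply, map_sum, map_sub, hC,
    ← Finset.sum_sub_distrib]
  refine Finset.sum_congr rfl fun s _ => ?_
  rw [pderiv_comm a s, pderiv_comm a s, pderiv_comm b s, pderiv_comm b s]
  ring

lemma grad_X_sub_X_grad (a b : σ) (u v : MvPolynomial σ ℂ) :
    grad γ (X a - X b) (grad γ u v) =
      grad γ (grad γ (X a - X b) u) v + grad γ u (grad γ (X a - X b) v) := by
  have hC : ∀ (s : σ) (c : ℂ) (g : MvPolynomial σ ℂ), pderiv s (C c * g) = C c * pderiv s g :=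
    fun s c g => by rw [← smul_eq_C_mul, Derivation.map_smul, smul_eq_C_mul]
  rw [grad_X_sub_X, grad_X_sub_X, grad_X_sub_X, grad_apply γ u v, grad_apply, grad_apply]
  simp only [map_sum, map_sub, hC, mul_assoc, pderiv_mul]
  rw [Finset.mul_sum, Finset.mul_sum, ← Finset.sum_sub_distrib, ← Finset.sum_add_distrib]
  refine Finset.sum_congr rfl fun s _ => ?_
  rw [pderiv_comm a s, pderiv_comm a s, pderiv_comm b s, pderiv_comm b s]
  ring

lemma grad_mul_left (u v f : MvPolynomial σ ℂ) :
    grad γ (u * v) f = u * grad γ v f + v * grad γ u f := by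
  rw [grad_comm, Derivation.leibniz, grad_comm γ f v, grad_comm γ f u, smul_eq_mul, smul_eq_mul]

lemma grad_pow_left (u f : MvPolynomial σ ℂ) (n : ℕ) :
    grad γ (u ^ (n + 1)) f = (n + 1 : ℕ) * u ^ n * grad γ u f := by
  rw [grad_comm, Derivation.leibniz_pow, grad_comm γ f u, Nat.add_sub_cancel, smul_eq_mul,
    nsmul_eq_mul, mul_assoc]

/-- Radial part of the divisibility of the image of an antisymmetric element. -/
lemma pow_dvd_of_antisymmetric {a b : σ} (hab : a ≠ b) (ha : γ a = 1) (hb : γ b = 1) {k : ℕ}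
    {κ' F H g : MvPolynomial σ ℂ} (hκ : ¬ X a - X b ∣ κ') (hF : F = (X a - X b) ^ (k + 2) * g)
    (h : (X a - X b) ^ (k + 1) * κ' * H =
      (X a - X b) ^ (k + 1) * κ' * lapl γ F - grad γ ((X a - X b) ^ (k + 1) * κ') F) :
    (X a - X b) ^ (k + 1) ∣ H := by
  have hp := prime_X_sub_X hab
  refine hp.pow_dvd_of_dvd_mul_left (a := κ') (k + 1) hκ ?_
  have hss := grad_X_sub_X_self (γ := γ) hab
  rw [ha, hb] at hss
  have hlp := lapl_X_sub_X_pow (γ := γ) hab k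
  rw [ha, hb] at hlp
  have hC : (C (((1 : ℝ) : ℂ) + ((1 : ℝ) : ℂ)) : MvPolynomial σ ℂ) = 2 := by
    rw [Complex.ofReal_one, one_add_one_eq_two]; rfl
  rw [hC] at hss hlp
  set s : MvPolynomial σ ℂ := X a - X b with hs
  have h1 : grad γ s F = (k + 2 : ℕ) * s ^ (k + 1) * g * 2 + s ^ (k + 2) * grad γ s g := by
    rw [hF, Derivation.leibniz, Derivation.leibniz_pow, hss]
    simp only [smul_eq_mul, nsmul_eq_mul, show k + 2 - 1 = k + 1 from rfl]
    ring
  have h2 : lapl γ F = s ^ (k + 2) * lapl γ g + g * (2 * ((k + 2 : ℕ) * (k + 1 : ℕ)) * s ^ k) +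
      2 * ((k + 2 : ℕ) * s ^ (k + 1) * grad γ s g) := by
    rw [hF, lapl_mul, hlp, grad_pow_left]
  have h3 : grad γ κ' F = s ^ (k + 1) * ((k + 2 : ℕ) * g * grad γ κ' s + s * grad γ κ' g) := by
    rw [hF, Derivation.leibniz, Derivation.leibniz_pow]
    simp only [smul_eq_mul, nsmul_eq_mul, show k + 2 - 1 = k + 1 from rfl]
    ring
  rw [grad_mul_left, grad_pow_left, h1, h2, h3] at h
  refine ⟨κ' * (s * lapl γ g + 2 * ((k + 2 : ℕ) * grad γ s g) - (k + 1 : ℕ) * grad γ s g) -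
    ((k + 2 : ℕ) * g * grad γ κ' s + s * grad γ κ' g), ?_⟩
  refine mul_left_cancel₀ (pow_ne_zero (k + 1) hp.ne_zero) ?_
  push_cast at h ⊢
  linear_combination h

/-- The first-order condition along `X a = X b` passes to the image. -/
lemma dvd_grad_of_first_order {a b : σ} (hab : a ≠ b)
    {κ' f h : MvPolynomial σ ℂ} (hκ : ¬ X a - X b ∣ κ')
    (hκE : X a - X b ∣ grad γ (X a - X b) κ') (hf : X a - X b ∣ grad γ (X a - X b) f)
    (hh : (X a - X b) ^ 2 * κ' * h =
      (X a - X b) ^ 2 * κ' * lapl γ f - grad γ ((X a - X b) ^ 2 * κ') f) :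
    X a - X b ∣ grad γ (X a - X b) h := by
  have hp := prime_X_sub_X hab
  have hEl := grad_X_sub_X_lapl (γ := γ) a b f
  have hEg := grad_X_sub_X_grad (γ := γ) a b κ' f
  have hl0 := lapl_X_sub_X (γ := γ) a b
  set s : MvPolynomial σ ℂ := X a - X b with hs
  obtain ⟨b', hb⟩ := hf
  obtain ⟨e, he⟩ := hκE
  have h1 : κ' * h = κ' * lapl γ f - grad γ κ' f - 2 * (κ' * b') := by
    refine mul_left_cancel₀ (pow_ne_zero 2 hp.ne_zero) ?_
    rw [grad_mul_left, grad_pow_left, hb] at hh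
    push_cast at hh
    linear_combination hh
  have h2 := congrArg (grad γ s) h1
  have h3 : grad γ s (2 * (κ' * b')) = 2 * (κ' * grad γ s b' + b' * (s * e)) := by
    rw [two_mul, two_mul, map_add, Derivation.leibniz, he, smul_eq_mul, smul_eq_mul]
  rw [map_sub, map_sub, h3, Derivation.leibniz, Derivation.leibniz, hEg, hEl, hb, he, lapl_mul, hl0,
    Derivation.leibniz (grad γ κ'), grad_comm γ κ' s, he, grad_mul_left, hb] at h2
  simp only [smul_eq_mul] at h2
  refine (hp.dvd_or_dvd (a := κ') ?_).resolve_left hκ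
  refine ⟨-h * e + κ' * lapl γ b' + lapl γ f * e - (grad γ e f + e * b' + grad γ κ' b' + b' * e) -
    2 * b' * e, ?_⟩
  linear_combination h2

lemma dvd_grad_mul {s p q : MvPolynomial σ ℂ} (hp : s ∣ grad γ s p) (hq : s ∣ grad γ s q) :
    s ∣ grad γ s (p * q) := by
  rw [Derivation.leibniz]
  exact dvd_add (hq.mul_left p) (hp.mul_left q)

lemma dvd_grad_prod {ι : Type*} {s : MvPolynomial σ ℂ} (t : Finset ι) {p : ι → MvPolynomial σ ℂ}
    (hp : ∀ i ∈ t, s ∣ grad γ s (p i)) : s ∣ grad γ s (∏ i ∈ t, p i) := by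
  classical
  induction t using Finset.induction_on with
  | empty => rw [Finset.prod_empty, Derivation.map_one_eq_zero]; exact dvd_zero _
  | insert a t ha ih =>
    rw [Finset.prod_insert ha]
    exact dvd_grad_mul (hp a (Finset.mem_insert_self _ _)) (ih fun i hi => hp i (Finset.mem_insert_of_mem hi))

omit [Fintype σ] in
lemma pderiv_rename_equiv (e : σ ≃ σ) (s : σ) (f : MvPolynomial σ ℂ) :
    pderiv (e s) (rename e f) = rename e (pderiv s f) :=
  pderiv_rename e.injective s f

lemma lapl_rename {e : σ ≃ σ} (he : ∀ s, γ (e s) = γ s) (f : MvPolynomial σ ℂ) :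
    lapl γ (rename e f) = rename e (lapl γ f) := by
  rw [lapl_apply, lapl_apply, map_sum, ← e.sum_comp]
  refine Finset.sum_congr rfl fun s _ => ?_
  rw [pderiv_rename_equiv, pderiv_rename_equiv, he, map_mul, rename_C]

lemma grad_rename {e : σ ≃ σ} (he : ∀ s, γ (e s) = γ s) (u f : MvPolynomial σ ℂ) :
    grad γ (rename e u) (rename e f) = rename e (grad γ u f) := by
  rw [grad_apply, grad_apply, map_sum, ← e.sum_comp]
  refine Finset.sum_congr rfl fun s _ => ?_
  rw [pderiv_rename_equiv, pderiv_rename_equiv, he, map_mul, map_mul, rename_C]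

end HyperplaneCalculus

section QuasiInvariants

lemma homogeneousComponent_eq_of_sum {σ : Type*} (T : MvPolynomial σ ℂ →ₗ[ℂ] MvPolynomial σ ℂ)
    (d : ℕ → ℕ) (hT : ∀ i f, f.IsHomogeneous i → (T f).IsHomogeneous (d i)) (n : ℕ)
    (hd : ∀ i f, f.IsHomogeneous i → d i = d n → i ≠ n → T f = 0) (f : MvPolynomial σ ℂ) :
    homogeneousComponent (d n) (T f) = T (homogeneousComponent n f) := by
  conv_lhs => rw [← sum_homogeneousComponent f, map_sum, map_sum]
  have : ∀ i ∈ Finset.range (f.totalDegree + 1),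
      homogeneousComponent (d n) (T (homogeneousComponent i f)) =
      if i = n then T (homogeneousComponent n f) else 0 := by
    intro i _
    have hi := homogeneousComponent_isHomogeneous i f
    rw [homogeneousComponent_of_mem (hT i _ hi)]
    by_cases h : i = n
    · subst h; simp
    · rw [if_neg h]
      split_ifs with h'
      · exact hd i _ hi h'.symm h
      · rfl
  rw [Finset.sum_congr rfl this, Finset.sum_ite_eq']
  split_ifs with h
  · rfl
  · rw [homogeneousComponent_eq_zero, map_zero]
    simpa [Nat.lt_succ_iff] using h

lemma dvd_homogeneousComponent {σ : Type*} {s p : MvPolynomial σ ℂ} {d : ℕ}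
    (hs : s.IsHomogeneous d) (h : s ∣ p) (n : ℕ) : s ∣ homogeneousComponent n p := by
  obtain ⟨g, rfl⟩ := h
  rw [← sum_homogeneousComponent g, Finset.mul_sum, map_sum]
  refine Finset.dvd_sum fun i _ => ?_
  rw [homogeneousComponent_of_mem (hs.mul (homogeneousComponent_isHomogeneous i g))]
  split_ifs
  · exact dvd_mul_right _ _
  · exact dvd_zero _

/-- The permutation of the variables exchanging `y_j` and `y_k`. -/
def ysw {r : ℕ} (j k : Fin r) : Fin r ⊕ Unit ≃ Fin r ⊕ Unit :=
  Equiv.sumCongr (Equiv.swap j k) (Equiv.refl Unit)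

lemma rename_ysw {r : ℕ} (j k : Fin r) (f : Rr1 r) :
    rename (Sum.map (⇑(Equiv.swap j k)) id) f = rename (ysw j k) f := rfl

lemma gw_ysw {r m : ℕ} (j k : Fin r) (s : Fin r ⊕ Unit) : gw r m (ysw j k s) = gw r m s := by
  rcases s with s | s <;> rfl

/-- The linear form `y_j - z`. -/
def yz {r : ℕ} (j : Fin r) : Rr1 r := X (Sum.inl j) - X (Sum.inr ())

/-- The linear form `y_j - y_k`. -/
def yy {r : ℕ} (j k : Fin r) : Rr1 r := X (Sum.inl j) - X (Sum.inl k)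

lemma prime_yz {r : ℕ} (j : Fin r) : Prime (yz j) := prime_X_sub_X (by simp)

lemma prime_yy {r : ℕ} {j k : Fin r} (h : j ≠ k) : Prime (yy j k) :=
  prime_X_sub_X (by simpa using h)

lemma yz_hom {r : ℕ} (j : Fin r) : (yz j).IsHomogeneous 1 :=
  (isHomogeneous_X _ _).sub (isHomogeneous_X _ _)

lemma yy_hom {r : ℕ} (j k : Fin r) : (yy j k).IsHomogeneous 1 :=
  (isHomogeneous_X _ _).sub (isHomogeneous_X _ _)

lemma yy_comm {r : ℕ} (j k : Fin r) : yy k j = - yy j k := (neg_sub _ _).symm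

lemma grad_yz {r m : ℕ} (j : Fin r) (f : Rr1 r) :
    grad (gw r m) (yz j) f = -(C (m : ℂ) * pderiv (Sum.inr ()) f - pderiv (Sum.inl j) f) := by
  rw [yz, grad_X_sub_X]
  simp [gw]

lemma mem_QI1 {r m : ℕ} {f : Rr1 r} : f ∈ QI1 r m ↔
    (∀ j, yz j ∣ grad (gw r m) (yz j) f) ∧
      ∀ j k, j ≠ k → yy j k ^ (2 * m + 1) ∣ f - rename (ysw j k) f := by
  refine and_congr (forall_congr' fun j => ?_) Iff.rfl
  rw [grad_yz, dvd_neg, yz, X_sub_X_dvd_iff]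

/-- The quasi-invariants as a subalgebra. -/
def QIalg (r m : ℕ) : Subalgebra ℂ (Rr1 r) where
  carrier := QI1 r m
  mul_mem' {f g} hf hg := by
    rw [mem_QI1] at hf hg ⊢
    refine ⟨fun j => ?_, fun j k h => ?_⟩
    · exact dvd_grad_mul (hf.1 j) (hg.1 j)
    · rw [map_mul]
      have : f * g - rename (ysw j k) f * rename (ysw j k) g =
        (f - rename (ysw j k) f) * g + rename (ysw j k) f * (g - rename (ysw j k) g) := by ring
      rw [this]
      exact dvd_add ((hf.2 j k h).mul_right _) ((hg.2 j k h).mul_left _)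
  add_mem' {f g} hf hg := by
    rw [mem_QI1] at hf hg ⊢
    refine ⟨fun j => ?_, fun j k h => ?_⟩
    · rw [map_add]; exact dvd_add (hf.1 j) (hg.1 j)
    · rw [map_add, add_sub_add_comm]
      exact dvd_add (hf.2 j k h) (hg.2 j k h)
  algebraMap_mem' c := by
    rw [mem_QI1]
    refine ⟨fun j => ?_, fun j k h => ?_⟩
    · rw [Derivation.map_algebraMap]; exact dvd_zero _
    · rw [AlgHom.commutes, sub_self]; exact dvd_zero _

lemma mem_QIalg {r m : ℕ} {f : Rr1 r} : f ∈ QIalg r m ↔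
    (∀ j, yz j ∣ grad (gw r m) (yz j) f) ∧
      ∀ j k, j ≠ k → yy j k ^ (2 * m + 1) ∣ f - rename (ysw j k) f := mem_QI1

lemma grad_yz_hom {r m : ℕ} (j : Fin r) {f : Rr1 r} {n : ℕ} (hf : f.IsHomogeneous n) :
    (grad (gw r m) (yz j) f).IsHomogeneous (n - 1) := by
  rw [grad_yz]
  refine IsHomogeneous.neg ?_
  have h := (isHomogeneous_C (Fin r ⊕ Unit) (m : ℂ)).mul (hf.pderiv (i := Sum.inr ()))
  rw [zero_add] at h
  exact h.sub hf.pderiv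

lemma QIalg_hom {r m : ℕ} (f : Rr1 r) (hf : f ∈ QIalg r m) (n : ℕ) :
    homogeneousComponent n f ∈ QIalg r m := by
  rw [mem_QIalg] at hf ⊢
  refine ⟨fun j => ?_, fun j k h => ?_⟩
  · have h0 : ∀ g : Rr1 r, g.IsHomogeneous 0 → grad (gw r m) (yz j) g = 0 := fun g hg => by
      rw [← homogeneousComponent_of_mem (m := 0) (n := 0) hg |>.trans (if_pos rfl),
        homogeneousComponent_zero, ← algebraMap_eq, Derivation.map_algebraMap]
    rcases Nat.eq_zero_or_pos n with rfl | hn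
    · rw [h0 _ (homogeneousComponent_isHomogeneous 0 f)]
      exact dvd_zero _
    · have := homogeneousComponent_eq_of_sum (grad (gw r m) (yz j)).toLinearMap (fun i => i - 1)
        (fun i f hf => grad_yz_hom j hf) n (fun i g hg h1 h2 => ?_) f
      · change homogeneousComponent (n - 1) (grad (gw r m) (yz j) f) = grad (gw r m) (yz j) _ at this
        rw [← this]
        exact dvd_homogeneousComponent (yz_hom j) (hf.1 j) _
      · have h3 : i = 0 := by have h4 : i - 1 = n - 1 := h1; omega
        subst h3
        exact h0 g hg
  · have := homogeneousComponent_eq_of_sum (LinearMap.id - (rename (ysw j k)).toLinearMap : Rr1 r →ₗ[ℂ] Rr1 r)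
      (fun i => i) (fun i f hf => hf.sub (hf.rename_isHomogeneous)) n (fun i g hg h1 h2 => absurd h1 h2) f
    simp only [LinearMap.sub_apply, LinearMap.id_apply, AlgHom.toLinearMap_apply] at this
    rw [← this]
    exact dvd_homogeneousComponent ((yy_hom j k).pow _) (hf.2 j k h) _

end QuasiInvariants

section Kappa

/-- Logarithmic derivatives of products add up. -/
lemma exists_grad_prod {σ ι : Type*} [Fintype σ] {γ : σ → ℝ} (t : Finset ι)
    {p : ι → MvPolynomial σ ℂ} {f : MvPolynomial σ ℂ} (h : ∀ i ∈ t, p i ∣ grad γ (p i) f) :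
    (∏ i ∈ t, p i) ∣ grad γ (∏ i ∈ t, p i) f := by
  classical
  induction t using Finset.induction_on with
  | empty => rw [Finset.prod_empty]; exact one_dvd _
  | insert a t ha ih =>
    obtain ⟨u, hu⟩ := h a (Finset.mem_insert_self _ _)
    obtain ⟨v, hv⟩ := ih fun i hi => h i (Finset.mem_insert_of_mem hi)
    rw [Finset.prod_insert ha, grad_mul_left, hu, hv]
    exact ⟨u + v, by ring⟩

lemma dvd_grad_pow {σ : Type*} [Fintype σ] {γ : σ → ℝ} {s f : MvPolynomial σ ℂ}
    (h : s ∣ grad γ s f) (n : ℕ) : s ^ n ∣ grad γ (s ^ n) f := by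
  rw [← Finset.card_range n, ← Finset.prod_const]
  exact exists_grad_prod _ fun _ _ => h

/-- The product of linear forms clearing the denominators of the deformed Laplacian. -/
def kap (r m : ℕ) : Rr1 r :=
  (∏ i, ∏ l ∈ Finset.univ.erase i, yy i l ^ m) * ∏ j, yz j ^ 2

lemma kap_mem (r m : ℕ) :
    kap r m ∈ Submonoid.closure {p : Rr1 r | ∃ a b, a ≠ b ∧ p = X a - X b} := by
  refine mul_mem (prod_mem fun i _ => prod_mem fun l hl => pow_mem ?_ _)
    (prod_mem fun j _ => pow_mem ?_ _)
  · exact Submonoid.subset_closure ⟨_, _, by simpa using (Finset.ne_of_mem_erase hl).symm, rfl⟩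
  · exact Submonoid.subset_closure ⟨_, _, by simp, rfl⟩

/-- The cofactor of `(y_j - z)^2` in `kap`. -/
def kapz (r m : ℕ) (j : Fin r) : Rr1 r :=
  ∏ i ∈ Finset.univ.erase j, (yy j i ^ m * yy i j ^ m * yz i ^ 2 *
    ∏ l ∈ (Finset.univ.erase i).erase j, yy i l ^ m)

lemma kap_eq (r m : ℕ) (j : Fin r) : kap r m = yz j ^ 2 * kapz r m j := by
  rw [kap, kapz, ← Finset.mul_prod_erase _ _ (Finset.mem_univ j),
    ← Finset.mul_prod_erase _ (fun j => yz j ^ 2) (Finset.mem_univ j)]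
  have : ∀ i ∈ Finset.univ.erase j, ∏ l ∈ Finset.univ.erase i, yy i l ^ m =
      yy i j ^ m * ∏ l ∈ (Finset.univ.erase i).erase j, yy i l ^ m := fun i hi =>
    (Finset.mul_prod_erase _ _ (by simpa using (Finset.ne_of_mem_erase hi).symm)).symm
  rw [Finset.prod_congr rfl this]
  simp only [Finset.prod_mul_distrib]
  ring

/-- The cofactor of `(y_j - y_k)^(2 * m)` in `kap`. -/
def kapy (r m : ℕ) (j k : Fin r) : Rr1 r :=
  (-1) ^ m * yz j ^ 2 * (yz k ^ 2 * ∏ l ∈ (Finset.univ.erase k).erase j, yy k l ^ m) *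
    ∏ i ∈ (Finset.univ.erase j).erase k, (yy j i ^ m * yy i j ^ m * yz i ^ 2 *
    ∏ l ∈ (Finset.univ.erase i).erase j, yy i l ^ m)

lemma kap_eq' (r m : ℕ) {j k : Fin r} (h : j ≠ k) : kap r m = yy j k ^ (2 * m) * kapy r m j k := by
  rw [kap_eq r m j, kapz, kapy, ← Finset.mul_prod_erase (Finset.univ.erase j) _ (a := k) (by simpa using h.symm),
    yy_comm j k, neg_pow (yy j k)]
  ring

lemma not_X_sub_X_dvd {σ : Type*} {a b c d : σ} (hcd : c ≠ d) (h : c ≠ a ∧ c ≠ b ∨ d ≠ a ∧ d ≠ b) :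
    ¬ (X a - X b ∣ (X c - X d : MvPolynomial σ ℂ)) := by
  classical
  rw [X_sub_X_dvd_iff]
  push Not
  rcases h with h | h
  · exact ⟨Pi.single c 1, by simp [h.1.symm, h.2.symm], by simp [hcd.symm]⟩
  · exact ⟨Pi.single d 1, by simp [h.1.symm, h.2.symm], by simp [hcd]⟩

lemma not_dvd_mul_of_prime {R : Type*} [CommRing R] {s p q : R} (hs : Prime s) (hp : ¬ s ∣ p)
    (hq : ¬ s ∣ q) : ¬ s ∣ p * q := fun h => (hs.dvd_or_dvd h).elim hp hq

lemma not_dvd_prod_of_prime {ι R : Type*} [CommRing R] {s : R} (hs : Prime s) {t : Finset ι}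
    {p : ι → R} (hp : ∀ i ∈ t, ¬ s ∣ p i) : ¬ s ∣ ∏ i ∈ t, p i := fun h => by
  obtain ⟨i, hi, h⟩ := (hs.dvd_finsetProd_iff _).mp h
  exact hp i hi h

lemma not_dvd_pow_of_prime {R : Type*} [CommRing R] {s p : R} (hs : Prime s) (hp : ¬ s ∣ p)
    (n : ℕ) : ¬ s ∣ p ^ n := fun h => hp (hs.dvd_of_dvd_pow h)

lemma not_dvd_kapz (r m : ℕ) (j : Fin r) : ¬ yz j ∣ kapz r m j := by
  have hs := prime_yz j
  refine not_dvd_prod_of_prime hs fun i hi => ?_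
  have hij : i ≠ j := Finset.ne_of_mem_erase hi
  refine not_dvd_mul_of_prime hs (not_dvd_mul_of_prime hs (not_dvd_mul_of_prime hs ?_ ?_) ?_) (not_dvd_prod_of_prime hs fun l hl => ?_)
  · exact not_dvd_pow_of_prime hs (not_X_sub_X_dvd (by simpa using hij.symm) (by simp [hij])) _
  · exact not_dvd_pow_of_prime hs (not_X_sub_X_dvd (by simpa using hij) (by simp [hij])) _
  · exact not_dvd_pow_of_prime hs (not_X_sub_X_dvd (by simp) (by simp [hij])) _
  · have hl2 := Finset.mem_erase.mp hl
    exact not_dvd_pow_of_prime hs (not_X_sub_X_dvd (by simpa using (Finset.ne_of_mem_erase hl2.2).symm) (by simp [hij])) _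

lemma not_dvd_kapy (r m : ℕ) {j k : Fin r} (h : j ≠ k) : ¬ yy j k ∣ kapy r m j k := by
  have hs := prime_yy h
  refine not_dvd_mul_of_prime hs (not_dvd_mul_of_prime hs (not_dvd_mul_of_prime hs ?_ ?_) (not_dvd_mul_of_prime hs ?_
    (not_dvd_prod_of_prime hs fun l hl => ?_))) (not_dvd_prod_of_prime hs fun i hi => ?_)
  · exact fun hd => hs.not_isUnit (isUnit_of_dvd_unit hd (isUnit_one.neg.pow m))
  · exact not_dvd_pow_of_prime hs (not_X_sub_X_dvd (by simp) (by simp)) _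
  · exact not_dvd_pow_of_prime hs (not_X_sub_X_dvd (by simp) (by simp)) _
  · have h1 : l ≠ j := Finset.ne_of_mem_erase hl
    have h2 : l ≠ k := Finset.ne_of_mem_erase (Finset.mem_erase.mp hl).2
    exact not_dvd_pow_of_prime hs (not_X_sub_X_dvd (by simpa using h2.symm) (by simp [h1, h2])) _
  · have h1 : i ≠ k := Finset.ne_of_mem_erase hi
    have h2 : i ≠ j := Finset.ne_of_mem_erase (Finset.mem_erase.mp hi).2
    refine not_dvd_mul_of_prime hs (not_dvd_mul_of_prime hs (not_dvd_mul_of_prime hs ?_ ?_) ?_) (not_dvd_prod_of_prime hs fun l hl => ?_)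
    · exact not_dvd_pow_of_prime hs (not_X_sub_X_dvd (by simpa using h2.symm) (by simp [h1, h2])) _
    · exact not_dvd_pow_of_prime hs (not_X_sub_X_dvd (by simpa using h2) (by simp [h1, h2])) _
    · exact not_dvd_pow_of_prime hs (not_X_sub_X_dvd (by simp) (by simp [h1, h2])) _
    · have hl2 := Finset.mem_erase.mp hl
      exact not_dvd_pow_of_prime hs (not_X_sub_X_dvd (by simpa using (Finset.ne_of_mem_erase hl2.2).symm)
        (by simp [h1, h2])) _

lemma kap_symm (r m : ℕ) (j k : Fin r) : rename (ysw j k) (kap r m) = kap r m := by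
  have hy : ∀ i l, rename (ysw j k) (yy i l) = yy (Equiv.swap j k i) (Equiv.swap j k l) := by
    intro i l
    rw [yy, map_sub, rename_X, rename_X]; rfl
  have hz : ∀ i, rename (ysw j k) (yz i) = yz (Equiv.swap j k i) := by
    intro i
    rw [yz, map_sub, rename_X, rename_X]; rfl
  simp only [kap, map_mul, map_prod, map_pow, hy, hz]
  rw [Equiv.prod_comp (Equiv.swap j k) (fun i => yz i ^ 2),
    ← Equiv.prod_comp (Equiv.swap j k) (fun i => ∏ l ∈ Finset.univ.erase i, yy i l ^ m)]
  congr 1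
  refine Finset.prod_congr rfl fun i _ => ?_
  refine Finset.prod_equiv (Equiv.swap j k) (fun l => ?_) fun l _ => rfl
  simp

end Kappa

section ConcreteSystem

variable {r m : ℕ}

lemma yy_dvd_sub_rename (j k : Fin r) (p : Rr1 r) : yy j k ∣ p - rename (ysw j k) p := by
  rw [yy, X_sub_X_dvd_iff]
  intro v hv
  rw [map_sub, eval_rename]
  have : v ∘ ysw j k = v := by
    funext s
    rcases s with s | s
    · change v (Sum.inl (Equiv.swap j k s)) = v (Sum.inl s)
      rcases eq_or_ne s j with rfl | h1
      · rw [Equiv.swap_apply_left, hv]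
      · rcases eq_or_ne s k with rfl | h2
        · rw [Equiv.swap_apply_right, hv]
        · rw [Equiv.swap_apply_of_ne_of_ne h1 h2]
    · rfl
  rw [this, sub_self]

lemma rename_yy (j k : Fin r) : rename (ysw j k) (yy j k) = - yy j k := by
  rw [← yy_comm, yy, map_sub, rename_X, rename_X]
  simp [ysw, yy]

lemma rename_ysw_self (j k : Fin r) (p : Rr1 r) : rename (ysw j k) (rename (ysw j k) p) = p := by
  rw [rename_rename]
  have : (ysw j k ∘ ysw j k : Fin r ⊕ Unit → Fin r ⊕ Unit) = id := by
    funext s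
    rcases s with s | s <;> simp [ysw]
  rw [this, rename_id_apply]

lemma two_dvd_cancel {σ : Type*} {s p : MvPolynomial σ ℂ} (h : s ∣ 2 * p) : s ∣ p := by
  have h1 : p = C (1 / 2 : ℂ) * (2 * p) := by
    rw [← mul_assoc, show (2 : MvPolynomial σ ℂ) = C 2 from rfl, ← C_mul]
    norm_num
  rw [h1]
  exact h.mul_left _

lemma yy_dvd_grad (hm : 0 < m) {f : Rr1 r} (hf : f ∈ QIalg r m) {j k : Fin r} (h : j ≠ k) :
    yy j k ∣ grad (gw r m) (yy j k) f := by
  obtain ⟨g, hg⟩ := (mem_QIalg.mp hf).2 j k h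
  obtain ⟨m, rfl⟩ : ∃ m', m = m' + 1 := ⟨m - 1, by omega⟩
  have h1 := grad_rename (gw_ysw (m := m + 1) j k) (yy j k) f
  rw [rename_yy, grad_comm, map_neg, grad_comm] at h1
  have h2 := congrArg (grad (gw r (m + 1)) (yy j k)) hg
  rw [map_sub, Derivation.leibniz, Derivation.leibniz_pow] at h2
  have h3 := yy_dvd_sub_rename j k (grad (gw r (m + 1)) (yy j k) f)
  refine two_dvd_cancel ?_
  have h4 : yy j k ∣ grad (gw r (m + 1)) (yy j k) f - grad (gw r (m + 1)) (yy j k) (rename (ysw j k) f) := by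
    rw [h2]
    simp only [smul_eq_mul, nsmul_eq_mul]
    refine dvd_add ((dvd_pow_self _ (by omega)).mul_right _) (Dvd.dvd.mul_left (Dvd.dvd.mul_left
      (Dvd.dvd.mul_right (dvd_pow_self _ (by omega)) _) _) _)
  have h5 := dvd_add h3 h4
  rw [← h1] at h5
  have h6 : 2 * grad (gw r (m + 1)) (yy j k) f = grad (gw r (m + 1)) (yy j k) f - -(grad (gw r (m + 1)) (yy j k)) ((rename ⇑(ysw j k)) f) +
      (grad (gw r (m + 1)) (yy j k) f - grad (gw r (m + 1)) (yy j k) (rename (ysw j k) f)) := by ring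
  rw [h6]
  exact h5

lemma kap_dvd_grad (hm : 0 < m) {f : Rr1 r} (hf : f ∈ QIalg r m) :
    kap r m ∣ grad (gw r m) (kap r m) f := by
  have h1 : (∏ i : Fin r, ∏ l ∈ Finset.univ.erase i, yy i l ^ m) ∣
      grad (gw r m) (∏ i : Fin r, ∏ l ∈ Finset.univ.erase i, yy i l ^ m) f :=
    exists_grad_prod _ fun i _ => exists_grad_prod _ fun l hl =>
      dvd_grad_pow (yy_dvd_grad hm hf (Finset.ne_of_mem_erase hl).symm) _
  have h2 : (∏ j : Fin r, yz j ^ 2) ∣ grad (gw r m) (∏ j : Fin r, yz j ^ 2) f :=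
    exists_grad_prod _ fun i _ => dvd_grad_pow ((mem_QIalg.mp hf).1 i) _
  rw [kap, grad_mul_left]
  refine dvd_add (mul_dvd_mul_left _ h2) ?_
  rw [mul_comm]
  exact mul_dvd_mul_left _ h1

lemma kap_mul_mem (w : Rr1 r) : kap r m * w ∈ QIalg r m := by
  refine mem_QIalg.mpr ⟨fun j => ?_, fun j k h => ?_⟩
  · rw [kap_eq r m j, pow_two, mul_assoc, mul_assoc, Derivation.leibniz]
    refine dvd_add (dvd_mul_right _ _) ?_
    rw [smul_eq_mul, mul_assoc]
    exact dvd_mul_right _ _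
  · rw [map_mul, kap_symm, ← mul_sub, kap_eq' r m h, mul_assoc, pow_succ]
    exact mul_dvd_mul_left _ ((yy_dvd_sub_rename j k w).mul_left _)

lemma yz_dvd_grad_kapz (hm : 0 < m) (j : Fin r) : yz j ∣ grad (gw r m) (yz j) (kapz r m j) := by
  obtain ⟨m, rfl⟩ : ∃ m', m = m' + 1 := ⟨m - 1, by omega⟩
  refine dvd_grad_prod _ fun i hi => ?_
  have hij : i ≠ j := Finset.ne_of_mem_erase hi
  have hu : grad (gw r (m + 1)) (yz j) (yy j i) = 1 := by
    rw [grad_yz, yy]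
    simp [pderiv_X, hij]
  have ht : grad (gw r (m + 1)) (yz j) (yz i) = C ((m + 1 : ℕ) : ℂ) := by
    rw [grad_yz, yz]
    simp [pderiv_X, hij]
  have hs : yz j = yy j i + yz i := by rw [yz, yz, yy]; ring
  refine dvd_grad_mul ?_ (dvd_grad_prod _ fun l hl => ?_)
  · have e : yy j i ^ (m + 1) * yy i j ^ (m + 1) * yz i ^ 2 =
        yy j i ^ (2 * m + 2) * ((-1 : ℂ) ^ (m + 1) • yz i ^ 2) := by
      rw [yy_comm j i, neg_pow (yy j i), smul_eq_C_mul, C_pow, C_neg, C_1]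
      ring
    rw [e, Derivation.leibniz, Derivation.map_smul, Derivation.leibniz_pow, Derivation.leibniz_pow,
      hu, ht]
    simp only [smul_eq_mul, nsmul_eq_mul, smul_eq_C_mul, show 2 * m + 2 - 1 = 2 * m + 1 from rfl,
      show 2 - 1 = 1 from rfl]
    rw [hs]
    refine ⟨2 * ((m : Rr1 r) + 1) * yy j i ^ (2 * m + 1) * yz i * C ((-1 : ℂ) ^ (m + 1)), ?_⟩
    have : (C ((m + 1 : ℕ) : ℂ) : Rr1 r) = ((m + 1 : ℕ) : Rr1 r) := map_natCast C _
    rw [this]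
    push_cast
    ring
  · have hlj : l ≠ j := Finset.ne_of_mem_erase hl
    have h0 : grad (gw r (m + 1)) (yz j) (yy i l) = 0 := by
      rw [grad_yz, yy]
      simp [pderiv_X, hij, hlj]
    rw [Derivation.leibniz_pow, h0, smul_zero, smul_zero]
    exact dvd_zero _

lemma mem_of_kap_mul (hm : 0 < m) {f h : Rr1 r} (hf : f ∈ QIalg r m)
    (hh : kap r m * h = kap r m * lapl (gw r m) f - grad (gw r m) (kap r m) f) :
    h ∈ QIalg r m := by
  have hf' := mem_QIalg.mp hf
  refine mem_QIalg.mpr ⟨fun j => ?_, fun j k hjk => ?_⟩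
  · rw [kap_eq r m j] at hh
    exact dvd_grad_of_first_order (by simp) (not_dvd_kapz r m j) (yz_dvd_grad_kapz hm j) (hf'.1 j) hh
  · have h1 := congrArg (rename (ysw j k)) hh
    rw [map_mul, map_sub, map_mul, kap_symm, ← lapl_rename (gw_ysw j k),
      ← grad_rename (gw_ysw j k), kap_symm] at h1
    obtain ⟨g, hg⟩ := hf'.2 j k hjk
    have h2 : kap r m * (h - rename (ysw j k) h) = kap r m * lapl (gw r m) (f - rename (ysw j k) f) -
        grad (gw r m) (kap r m) (f - rename (ysw j k) f) := by
      rw [map_sub, map_sub]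
      linear_combination hh - h1
    obtain ⟨m, rfl⟩ : ∃ m', m = m' + 1 := ⟨m - 1, by omega⟩
    rw [kap_eq' r _ hjk] at h2
    obtain ⟨g', hg'⟩ := pow_dvd_of_antisymmetric (γ := gw r (m + 1)) (a := Sum.inl j)
      (b := Sum.inl k) (k := 2 * m + 1) (by simpa using hjk) rfl rfl
      (not_dvd_kapy r (m + 1) hjk) hg h2
    change h - rename (ysw j k) h = yy j k ^ (2 * m + 2) * g' at hg'
    have h3 := congrArg (rename (ysw j k)) hg'
    rw [map_sub, map_mul, map_pow, rename_ysw_self, rename_yy, Even.neg_pow ⟨m + 1, by ring⟩] at h3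
    have h4 : rename (ysw j k) g' = - g' := by
      refine mul_left_cancel₀ (pow_ne_zero (2 * m + 2) (prime_yy hjk).ne_zero) ?_
      linear_combination - h3 - hg'
    have h5 := yy_dvd_sub_rename j k g'
    rw [h4, sub_neg_eq_add, ← two_mul] at h5
    rw [hg', show 2 * (m + 1) + 1 = 2 * m + 2 + 1 from rfl, pow_succ]
    exact mul_dvd_mul_left _ (two_dvd_cancel h5)

lemma kap_ne_zero : kap r m ≠ 0 := (QSys.closure_hom (kap_mem r m)).1

/-- The system of quasi-invariants attached to `(r, m)`. -/
def qsys (r m : ℕ) (hm : 0 < m) : QSys (Fin r ⊕ Unit) :=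
  let M : Rr1 r →ₗ[ℂ] Rr1 r := LinearMap.mulLeft ℂ (kap r m)
  let N := M ∘ₗ lapl (gw r m) - (grad (gw r m) (kap r m)).toLinearMap
  let ρ := (LinearMap.exists_leftInverse_of_injective M
    (LinearMap.ker_eq_bot.mpr fun _ _ h => mul_left_cancel₀ kap_ne_zero h)).choose
  have hρ : ρ ∘ₗ M = LinearMap.id := (LinearMap.exists_leftInverse_of_injective M
    (LinearMap.ker_eq_bot.mpr fun _ _ h => mul_left_cancel₀ kap_ne_zero h)).choose_spec
  have hL : ∀ f ∈ QIalg r m, kap r m * ρ (N f) =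
      kap r m * lapl (gw r m) f - grad (gw r m) (kap r m) f := fun f hf => by
    obtain ⟨h, hh⟩ := dvd_sub (dvd_mul_right (kap r m) (lapl (gw r m) f)) (kap_dvd_grad hm hf)
    have h1 : N f = M h := hh
    have h2 : ρ (M h) = h := LinearMap.congr_fun hρ h
    rw [h1, h2, hh]
  { γ := gw r m
    γ_pos := fun s => by rcases s with s | s <;> simp [gw, hm]
    κ := kap r m
    κ_mem := kap_mem r m
    Q := QIalg r m
    κ_mul := kap_mul_mem
    hom := fun f hf n => QIalg_hom f hf n
    L := ρ ∘ₗ N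
    L_mem := fun f hf => mem_of_kap_mul hm hf (hL f hf)
    L_spec := hL }

/-- The deformed power sums are quasi-invariant. -/
lemma powerSum_mem (r m i : ℕ) : (∑ s, cw r m s • X s ^ i : Rr1 r) ∈ QIalg r m := by
  refine ⟨fun j v hv => ?_, fun j k h => ⟨0, ?_⟩⟩
  · rw [map_sum, map_sum, Fintype.sum_sum_type, Fintype.sum_sum_type]
    simp [cw, pderiv_X, Pi.single_apply, hv, Derivation.leibniz_pow, smul_eq_C_mul]
  · rw [mul_zero, sub_eq_zero, rename_ysw, map_sum, ← Equiv.sum_comp (ysw j k)]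
    refine Finset.sum_congr rfl fun s _ => ?_
    rw [map_smul, map_pow, rename_X]
    rcases s with s | s <;> rfl

end ConcreteSystem

section Codimension

variable {σ : Type*} [Fintype σ]

lemma dvd_of_dvd_iterate_grad {γ : σ → ℝ} {a b : σ} (hab : a ≠ b) (hγ : γ a + γ b ≠ 0) (n : ℕ) :
    ∀ g : MvPolynomial σ ℂ, X a - X b ∣ (grad γ (X a - X b))^[n] ((X a - X b) ^ n * g) →
      X a - X b ∣ g := by
  induction n with
  | zero => intro g h; simpa using h
  | succ n ih =>
    intro g h
    have h1 : grad γ (X a - X b) ((X a - X b) ^ (n + 1) * g) =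
        (X a - X b) ^ n * (C (((n + 1 : ℕ) : ℂ) * ((γ a : ℂ) + γ b)) * g + (X a - X b) * grad γ (X a - X b) g) := by
      rw [Derivation.leibniz, Derivation.leibniz_pow, grad_X_sub_X_self hab]
      simp only [smul_eq_mul, nsmul_eq_mul, Nat.add_sub_cancel]
      rw [C_mul, map_natCast]
      ring
    rw [Function.iterate_succ_apply, h1] at h
    have h2 := (dvd_add_left (dvd_mul_right _ _)).mp (ih _ h)
    have h3 : ((n + 1 : ℕ) : ℂ) * ((γ a : ℂ) + γ b) ≠ 0 := by
      refine mul_ne_zero (Nat.cast_ne_zero.mpr (Nat.succ_ne_zero n)) ?_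
      exact_mod_cast hγ
    have h4 : g = C ((((n + 1 : ℕ) : ℂ) * ((γ a : ℂ) + γ b))⁻¹) * (C (((n + 1 : ℕ) : ℂ) * ((γ a : ℂ) + γ b)) * g) := by
      rw [← mul_assoc, ← C_mul, inv_mul_cancel₀ h3, C_1, one_mul]
    rw [h4]
    exact h2.mul_left _

lemma pow_dvd_of_dvd_iterate_grad {γ : σ → ℝ} {a b : σ} (hab : a ≠ b) (hγ : γ a + γ b ≠ 0) (n : ℕ)
    {F : MvPolynomial σ ℂ} (h : ∀ c < n, X a - X b ∣ (grad γ (X a - X b))^[c] F) :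
    (X a - X b) ^ n ∣ F := by
  induction n with
  | zero => rw [pow_zero]; exact one_dvd _
  | succ n ih =>
    obtain ⟨g, hg⟩ := ih fun c hc => h c (by omega)
    have h1 := h n (by omega)
    rw [hg] at h1
    rw [hg, pow_succ]
    exact mul_dvd_mul_left _ (dvd_of_dvd_iterate_grad hab hγ n g h1)

/-- The dimension of the space of homogeneous polynomials. -/
def rho (σ : Type*) (k : ℕ) : ℕ := Module.finrank ℂ (homogeneousSubmodule σ ℂ k)

/-- The dimension of the space of homogeneous polynomials on a hyperplane. -/
lemma finrank_map_restrict_le [DecidableEq σ] {a b : σ} (hab : a ≠ b) (k : ℕ) :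
    Module.finrank ℂ ((homogeneousSubmodule σ ℂ k).map
      (aeval (R := ℂ) (Function.update X a (X b) : σ → MvPolynomial σ ℂ)).toLinearMap) +
      (if k = 0 then 0 else rho σ (k - 1)) ≤ rho σ k := by
  set φ := (aeval (R := ℂ) (Function.update X a (X b) : σ → MvPolynomial σ ℂ)).toLinearMap with hφ
  have h1 := LinearMap.finrank_range_add_finrank_ker (φ.domRestrict (homogeneousSubmodule σ ℂ k))
  rw [LinearMap.range_domRestrict] at h1
  rw [show rho σ k = _ from h1.symm]
  refine Nat.add_le_add_left ?_ _
  split_ifs with hk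
  · exact Nat.zero_le _
  · let T : homogeneousSubmodule σ ℂ (k - 1) →ₗ[ℂ] LinearMap.ker (φ.domRestrict (homogeneousSubmodule σ ℂ k)) :=
      { toFun := fun p => ⟨⟨(X a - X b) * (p : MvPolynomial σ ℂ), by
          have h2 : (X a - X b : MvPolynomial σ ℂ).IsHomogeneous 1 :=
            (isHomogeneous_X _ _).sub (isHomogeneous_X _ _)
          have h3 := h2.mul ((mem_homogeneousSubmodule _ _).mp p.2)
          rw [mem_homogeneousSubmodule]
          rwa [show 1 + (k - 1) = k by omega] at h3⟩, by
          rw [LinearMap.mem_ker]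
          exact (X_sub_X_dvd_iff_aeval a b _).mp (dvd_mul_right _ _)⟩
        map_add' := fun p q => by ext1; ext1; exact mul_add _ _ _
        map_smul' := fun c p => by ext1; ext1; exact mul_smul_comm _ _ _ }
    refine LinearMap.finrank_le_finrank_of_injective (f := T) fun p q h => ?_
    have h2 := congrArg (fun x : LinearMap.ker (φ.domRestrict (homogeneousSubmodule σ ℂ k)) =>
      ((x : homogeneousSubmodule σ ℂ k) : MvPolynomial σ ℂ)) h
    exact Subtype.ext (mul_left_cancel₀ (X_sub_X_ne_zero hab) h2)

lemma rho_le_of_conditions {ι : Type*} [Fintype ι] (a b : ι → σ) (hab : ∀ i, a i ≠ b i)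
    (T : ι → MvPolynomial σ ℂ →ₗ[ℂ] MvPolynomial σ ℂ) (k : ℕ)
    (hT : ∀ i f, f.IsHomogeneous k → (T i f).IsHomogeneous k) (V : Submodule ℂ (MvPolynomial σ ℂ))
    [FiniteDimensional ℂ V]
    (hV : ∀ f, f.IsHomogeneous k → (∀ i, X (a i) - X (b i) ∣ T i f) → f ∈ V) :
    rho σ k + Fintype.card ι * (if k = 0 then 0 else rho σ (k - 1)) ≤
      Module.finrank ℂ V + Fintype.card ι * rho σ k := by
  classical
  let φ : ι → MvPolynomial σ ℂ →ₗ[ℂ] MvPolynomial σ ℂ := fun i =>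
    (aeval (R := ℂ) (Function.update X (a i) (X (b i)) : σ → MvPolynomial σ ℂ)).toLinearMap
  let W : ι → Submodule ℂ (MvPolynomial σ ℂ) := fun i => (homogeneousSubmodule σ ℂ k).map (φ i)
  let Ψ : homogeneousSubmodule σ ℂ k →ₗ[ℂ] (∀ i, W i) := LinearMap.pi fun i =>
    ((φ i) ∘ₗ (T i)).restrict (p := homogeneousSubmodule σ ℂ k) (q := W i)
      fun f hf => Submodule.mem_map_of_mem ((mem_homogeneousSubmodule _ _).mpr
        (hT i f ((mem_homogeneousSubmodule _ _).mp hf)))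
  have h1 := LinearMap.finrank_range_add_finrank_ker Ψ
  have h2 : Module.finrank ℂ (LinearMap.range Ψ) ≤ ∑ i, Module.finrank ℂ (W i) := by
    rw [← Module.finrank_pi_fintype]
    exact Submodule.finrank_le _
  have h3 : Module.finrank ℂ (LinearMap.ker Ψ) ≤ Module.finrank ℂ V := by
    let E : LinearMap.ker Ψ →ₗ[ℂ] V :=
      ((homogeneousSubmodule σ ℂ k).subtype ∘ₗ (LinearMap.ker Ψ).subtype).codRestrict V (fun f => by
        refine hV _ ((mem_homogeneousSubmodule _ _).mp f.1.2) fun i => ?_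
        have h4 := congrArg Subtype.val (congrFun (LinearMap.mem_ker.mp f.2) i)
        exact (X_sub_X_dvd_iff_aeval _ _ _).mpr h4)
    refine LinearMap.finrank_le_finrank_of_injective (f := E) fun p q h => ?_
    exact Subtype.ext (Subtype.ext (congrArg (fun x : V => (x : MvPolynomial σ ℂ)) h))
  have h4 : ∑ i, Module.finrank ℂ (W i) + Fintype.card ι * (if k = 0 then 0 else rho σ (k - 1)) ≤
      Fintype.card ι * rho σ k := by
    rw [← smul_eq_mul, ← smul_eq_mul, ← Finset.card_univ, ← Finset.sum_const, ← Finset.sum_const,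
      ← Finset.sum_add_distrib]
    exact Finset.sum_le_sum fun i _ => finrank_map_restrict_le (hab i) k
  have h5 : rho σ k = Module.finrank ℂ (homogeneousSubmodule σ ℂ k) := rfl
  omega

/-- The index set of the linear conditions defining quasi-invariants. -/
abbrev CondIdx (r m : ℕ) := (Σ j : Fin r, Fin j) × Fin m ⊕ Fin r

lemma two_mul_card_CondIdx (r m : ℕ) :
    2 * Fintype.card (CondIdx r m) = m * (r * (r - 1)) + 2 * r := by
  have h : 2 * Fintype.card (Σ j : Fin r, Fin j) = r * (r - 1) := by
    rw [Fintype.card_sigma, mul_comm]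
    simp only [Fintype.card_fin]
    rw [Fin.sum_univ_eq_sum_range (fun i => i) r, Finset.sum_range_id_mul_two]
  rw [Fintype.card_sum, Fintype.card_prod, Fintype.card_fin, Fintype.card_fin, mul_add, ← mul_assoc,
    h, mul_comm m]

omit [Fintype σ] in
lemma iterate_hom {T : MvPolynomial σ ℂ → MvPolynomial σ ℂ}
    (hT : ∀ n f, f.IsHomogeneous n → (T f).IsHomogeneous (n - 1)) (c : ℕ) :
    ∀ n f, f.IsHomogeneous n → (T^[c] f).IsHomogeneous (n - c) := by
  induction c with
  | zero => intro n f h; exact h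
  | succ c ih =>
    intro n f h
    rw [Function.iterate_succ_apply]
    have := ih _ _ (hT n f h)
    rwa [Nat.sub_sub, add_comm 1 c] at this

variable {r m : ℕ}

lemma isHomogeneous_grad_sub {γ : σ → ℝ} (a b : σ) {n : ℕ} {f : MvPolynomial σ ℂ}
    (hf : f.IsHomogeneous n) : (grad γ (X a - X b) f).IsHomogeneous (n - 1) := by
  rw [grad_X_sub_X, ← smul_eq_C_mul, ← smul_eq_C_mul]
  exact ((homogeneousSubmodule σ ℂ (n - 1)).smul_mem _ hf.pderiv).sub
    ((homogeneousSubmodule σ ℂ (n - 1)).smul_mem _ hf.pderiv)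

lemma iterate_eq_zero {γ : σ → ℝ} (a b : σ) {n : ℕ} {f : MvPolynomial σ ℂ}
    (hf : f.IsHomogeneous n) {c : ℕ} (hc : n < c) : (grad γ (X a - X b))^[c] f = 0 := by
  obtain ⟨d, rfl⟩ : ∃ d, c = d + 1 + n := ⟨c - n - 1, by omega⟩
  have h1 := iterate_hom (fun n f hf => isHomogeneous_grad_sub (γ := γ) a b hf) n n f hf
  rw [Nat.sub_self] at h1
  rw [Function.iterate_add_apply, Function.iterate_succ_apply,
    ← (homogeneousComponent_of_mem (m := 0) (n := 0) h1 |>.trans (if_pos rfl)),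
    homogeneousComponent_zero, ← algebraMap_eq, Derivation.map_algebraMap]
  exact Function.iterate_fixed (map_zero _) d

lemma rename_iterate_grad (j k : Fin r) (f : Rr1 r) (c : ℕ) :
    (grad (gw r m) (yy j k))^[c] (rename (ysw j k) f) =
      (-1) ^ c * rename (ysw j k) ((grad (gw r m) (yy j k))^[c] f) := by
  induction c with
  | zero => simp
  | succ c ih =>
    have h1 : ∀ g, grad (gw r m) (yy j k) (rename (ysw j k) g) =
        - rename (ysw j k) (grad (gw r m) (yy j k) g) := by
      intro g
      rw [← grad_rename (gw_ysw j k), rename_yy, grad_comm _ (-yy j k), map_neg, grad_comm, neg_neg]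
    have h2 : ∀ g : Rr1 r, grad (gw r m) (yy j k) ((-1) ^ c * g) =
        (-1) ^ c * grad (gw r m) (yy j k) g := by
      intro g
      have : ((-1) ^ c : Rr1 r) = C ((-1) ^ c) := by simp
      rw [this, ← smul_eq_C_mul, Derivation.map_smul, smul_eq_C_mul]
    rw [Function.iterate_succ_apply', ih, h2, h1, Function.iterate_succ_apply', pow_succ]
    ring

lemma mem_QIalg_of_conditions {f : Rr1 r} (hz : ∀ j, yz j ∣ grad (gw r m) (yz j) f)
    (hy : ∀ j k : Fin r, k < j → ∀ b < m, yy j k ∣ (grad (gw r m) (yy j k))^[2 * b + 1] f) :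
    f ∈ QIalg r m := by
  have key : ∀ j k : Fin r, k < j → yy j k ^ (2 * m + 1) ∣ f - rename (ysw j k) f := by
    intro j k hjk
    refine pow_dvd_of_dvd_iterate_grad (γ := gw r m) (by simpa using hjk.ne') (by simp [gw]) _ fun c hc => ?_
    change yy j k ∣ (grad (gw r m) (yy j k))^[c] (f - rename (ysw j k) f)
    rw [iterate_map_sub, rename_iterate_grad]
    have h0 := yy_dvd_sub_rename j k ((grad (gw r m) (yy j k))^[c] f)
    rcases Nat.even_or_odd c with h | h
    · rw [h.neg_one_pow, one_mul]
      exact h0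
    · obtain ⟨b, rfl⟩ := h
      rw [Odd.neg_one_pow ⟨b, rfl⟩, neg_one_mul, sub_neg_eq_add]
      have h1 := hy j k hjk b (by omega)
      have h2 := dvd_sub (h1.mul_left 2) h0
      have h3 : ∀ p q : Rr1 r, 2 * p - (p - q) = p + q := fun p q => by ring
      rwa [h3] at h2
  refine mem_QIalg.mpr ⟨hz, fun j k hjk => ?_⟩
  rcases lt_or_gt_of_ne hjk with h | h
  · have h1 := key k j h
    rw [yy_comm j k, neg_pow, ysw, Equiv.swap_comm] at h1
    exact (dvd_mul_left _ _).trans h1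
  · exact key j k h

lemma rho_le (r m : ℕ) (hm : 0 < m) (k : ℕ) :
    rho (Fin r ⊕ Unit) k + Fintype.card (CondIdx r m) *
      (if k = 0 then 0 else rho (Fin r ⊕ Unit) (k - 1)) ≤
      Module.finrank ℂ ((qsys r m hm).Qk k) + Fintype.card (CondIdx r m) * rho (Fin r ⊕ Unit) k := by
  let a : CondIdx r m → Fin r ⊕ Unit := Sum.elim (fun p => Sum.inl p.1.1) Sum.inl
  let b : CondIdx r m → Fin r ⊕ Unit :=
    Sum.elim (fun p => Sum.inl ⟨p.1.2, p.1.2.2.trans p.1.1.2⟩) (fun _ => Sum.inr ())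
  let e : CondIdx r m → ℕ := Sum.elim (fun p => 2 * (p.2 : ℕ) + 1) (fun _ => 1)
  have hab : ∀ i, a i ≠ b i := by
    rintro (⟨⟨j, l⟩, c⟩ | j)
    · have := l.2.ne'
      simp [a, b, Fin.ext_iff, this]
    · simp [a, b]
  have hdvd : ∀ i (p : Rr1 r) n, X (a i) - X (b i) ∣ X (b i) ^ n * p → X (a i) - X (b i) ∣ p := by
    intro i p n h
    refine ((prime_X_sub_X (hab i)).dvd_or_dvd h).resolve_left fun h1 => ?_
    have h2 := (X_sub_X_dvd_iff _ _ _).mp ((prime_X_sub_X (hab i)).dvd_of_dvd_pow h1) (fun _ => 1) rfl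
    simp at h2
  refine rho_le_of_conditions a b hab (fun i => LinearMap.mulLeft ℂ (X (b i) ^ e i) ∘ₗ
    ((grad (gw r m) (X (a i) - X (b i))).toLinearMap ^ e i)) k (fun i f hf => ?_) _ fun f hf h => ?_
  · rw [LinearMap.comp_apply, Module.End.pow_apply, LinearMap.mulLeft_apply]
    change (X (b i) ^ e i * (grad (gw r m) (X (a i) - X (b i)))^[e i] f).IsHomogeneous k
    rcases le_or_gt (e i) k with h | h
    · have h1 := ((isHomogeneous_X ℂ (b i)).pow (e i)).mul (iterate_hom
        (fun n f hf => isHomogeneous_grad_sub (γ := gw r m) (a i) (b i) hf) (e i) k f hf)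
      rwa [one_mul, Nat.add_sub_cancel' h] at h1
    · rw [iterate_eq_zero _ _ hf h, mul_zero]
      exact isHomogeneous_zero _ _ _
  · have h' : ∀ i, X (a i) - X (b i) ∣ (grad (gw r m) (X (a i) - X (b i)))^[e i] f := by
      intro i
      have h1 := h i
      rw [LinearMap.comp_apply, Module.End.pow_apply, LinearMap.mulLeft_apply] at h1
      exact hdvd i _ _ h1
    refine QSys.mem_Qk.mpr ⟨mem_QIalg_of_conditions (fun j => h' (Sum.inr j)) fun j k hjk c hc => ?_, hf⟩
    exact h' (Sum.inl (⟨j, ⟨k, hjk⟩⟩, ⟨c, hc⟩))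

end Codimension

section WeightedCounting

variable {ι : Type*}

/-- The number of monomials of weighted degree `k`. -/
def wcount (w : ι → ℕ) (k : ℕ) : ℕ := Module.finrank ℂ (weightedHomogeneousSubmodule ℂ w k)

lemma rho_eq_wcount (k : ℕ) : rho ι k = wcount (1 : ι → ℕ) k := rfl

variable [Fintype ι] {w : ι → ℕ}

lemma wcount_eq_card [DecidableEq ι] (hw : ∀ i, 0 < w i) (k : ℕ) :
    wcount w k = ((Finset.univ.finsuppAntidiag k).filter fun l : ι →₀ ℕ => ∀ i, w i ∣ l i).card := by
  have h1 : wcount w k = Nat.card {d : ι →₀ ℕ | Finsupp.weight w d = k} := by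
    rw [wcount, weightedHomogeneousSubmodule_eq_finsupp_supported]
    exact Module.finrank_eq_nat_card_basis (basisRestrictSupport ℂ {d | Finsupp.weight w d = k})
  rw [h1, ← Nat.card_eq_finsetCard]
  refine Nat.card_eq_of_bijective (fun d : {d : ι →₀ ℕ | Finsupp.weight w d = k} =>
    (⟨Finsupp.equivFunOnFinite.symm fun i => w i * d.1 i, ?_⟩ : {l // l ∈ Finset.filter
      (fun l : ι →₀ ℕ => ∀ i, w i ∣ l i) (Finset.univ.finsuppAntidiag k)})) ⟨?_, ?_⟩
  · have hd : Finsupp.weight w d.1 = k := d.2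
    rw [Finsupp.weight_apply, Finsupp.sum_fintype _ _ (by simp)] at hd
    simp only [Finset.mem_filter, Finset.mem_finsuppAntidiag, Finset.subset_univ, and_true,
      Finsupp.equivFunOnFinite_symm_apply_apply, dvd_mul_right, implies_true]
    exact (Finset.sum_congr rfl fun i _ => by rw [smul_eq_mul, mul_comm]).trans hd
  · intro d e h
    have h2 := congrArg (fun x => x.1) h
    refine Subtype.ext (Finsupp.ext fun i => ?_)
    have h3 := DFunLike.congr_fun h2 i
    exact Nat.eq_of_mul_eq_mul_left (hw i) h3
  · rintro ⟨l, hl⟩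
    rw [Finset.mem_filter, Finset.mem_finsuppAntidiag] at hl
    refine ⟨⟨Finsupp.equivFunOnFinite.symm fun i => l i / w i, ?_⟩, ?_⟩
    · rw [Set.mem_ofPred_eq, Finsupp.weight_apply, Finsupp.sum_fintype _ _ (by simp), ← hl.1.1]
      exact Finset.sum_congr rfl fun i _ => Nat.div_mul_cancel (hl.2 i)
    · exact Subtype.ext (Finsupp.ext fun i => Nat.mul_div_cancel' (hl.2 i))

lemma mk_wcount_eq_prod (R : Type*) [CommRing R] (hw : ∀ i, 0 < w i) :
    (PowerSeries.mk fun k => (wcount w k : R)) =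
      ∏ i, PowerSeries.mk fun n => if w i ∣ n then (1 : R) else 0 := by
  classical
  ext k
  rw [PowerSeries.coeff_prod, PowerSeries.coeff_mk, wcount_eq_card hw, Finset.card_filter]
  push_cast
  refine Finset.sum_congr rfl fun l _ => ?_
  simp only [PowerSeries.coeff_mk]
  rw [Finset.prod_ite_zero]
  simp

lemma mk_dvd_mul (R : Type*) [CommRing R] {w : ℕ} (hw : 0 < w) :
    (1 - PowerSeries.X ^ w) * (PowerSeries.mk fun n => if w ∣ n then (1 : R) else 0) = 1 := by
  ext n
  rw [sub_mul, one_mul, map_sub, PowerSeries.coeff_X_pow_mul', PowerSeries.coeff_mk,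
    PowerSeries.coeff_one]
  rcases lt_or_ge n w with h | h
  · rw [if_neg (not_le.2 h), sub_zero]
    refine if_congr ⟨fun h2 => Nat.eq_zero_of_dvd_of_lt h2 h, ?_⟩ rfl rfl
    rintro rfl
    exact dvd_zero _
  · rw [if_pos h, PowerSeries.coeff_mk, if_neg (by omega : n ≠ 0), sub_eq_zero]
    exact if_congr ((Nat.dvd_sub_iff_left h dvd_rfl).symm) rfl rfl

lemma prod_mul_mk_wcount (R : Type*) [CommRing R] (hw : ∀ i, 0 < w i) :
    (∏ i, (1 - PowerSeries.X ^ w i)) * (PowerSeries.mk fun k => (wcount w k : R)) = 1 := by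
  rw [mk_wcount_eq_prod R hw, ← Finset.prod_mul_distrib]
  exact Finset.prod_eq_one fun i _ => mk_dvd_mul R (hw i)

lemma hasSum_coeff_mul {F G : PowerSeries ℝ} {t f g : ℝ}
    (hF : HasSum (fun k => F.coeff k * t ^ k) f) (hG : HasSum (fun k => G.coeff k * t ^ k) g) :
    HasSum (fun k => (F * G).coeff k * t ^ k) (f * g) := by
  have h1 := hF.summable.norm
  have h2 := hG.summable.norm
  have h3 := tsum_mul_tsum_eq_tsum_sum_antidiagonal_of_summable_norm h1 h2
  have h4 := (summable_norm_sum_mul_antidiagonal_of_summable_norm h1 h2).of_norm.hasSum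
  rw [← h3, hF.tsum_eq, hG.tsum_eq] at h4
  refine h4.congr_fun fun k => ?_
  rw [PowerSeries.coeff_mul, Finset.sum_mul]
  refine Finset.sum_congr rfl fun p hp => ?_
  rw [← Finset.HasAntidiagonal.mem_antidiagonal.1 hp, pow_add]
  ring

lemma hasSum_coeff_prod {κ : Type*} (s : Finset κ) {F : κ → PowerSeries ℝ} {t : ℝ} {f : κ → ℝ}
    (h : ∀ i ∈ s, HasSum (fun k => (F i).coeff k * t ^ k) (f i)) :
    HasSum (fun k => (∏ i ∈ s, F i).coeff k * t ^ k) (∏ i ∈ s, f i) := by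
  classical
  induction s using Finset.induction_on with
  | empty =>
    rw [Finset.prod_empty, Finset.prod_empty]
    have := hasSum_single (f := fun k => (1 : PowerSeries ℝ).coeff k * t ^ k) 0 (fun k hk => by
      simp [PowerSeries.coeff_one, hk])
    simpa using this
  | insert a s ha ih =>
    rw [Finset.prod_insert ha, Finset.prod_insert ha]
    exact hasSum_coeff_mul (h a (Finset.mem_insert_self _ _))
      (ih fun i hi => h i (Finset.mem_insert_of_mem hi))

lemma hasSum_wcount (hw : ∀ i, 0 < w i) {t : ℝ} (h0 : 0 < t) (h1 : t < 1) :
    HasSum (fun k => (wcount w k : ℝ) * t ^ k) (∏ i, (1 - t ^ w i)⁻¹) := by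
  have h := hasSum_coeff_prod (t := t) Finset.univ
    (F := fun i => PowerSeries.mk fun n => if w i ∣ n then (1 : ℝ) else 0)
    (f := fun i => (1 - t ^ w i)⁻¹) (fun i _ => ?_)
  · rw [← mk_wcount_eq_prod ℝ hw] at h
    simpa only [PowerSeries.coeff_mk] using h
  · have h2 := hasSum_geometric_of_lt_one (pow_nonneg h0.le (w i)) (pow_lt_one₀ h0.le h1 (hw i).ne')
    have h3 : Function.Injective fun n : ℕ => w i * n := fun a b hab => Nat.eq_of_mul_eq_mul_left (hw i) hab
    rw [← h3.hasSum_iff]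
    · refine h2.congr_fun fun n => ?_
      rw [Function.comp_apply, PowerSeries.coeff_mk, if_pos (dvd_mul_right _ _), one_mul, pow_mul]
    · intro n hn
      rw [PowerSeries.coeff_mk, if_neg, zero_mul]
      rintro ⟨c, rfl⟩
      exact hn ⟨c, rfl⟩

end WeightedCounting

section Generators

lemma exists_generators_of_le {E : Type*} [AddCommGroup E] [Module ℂ E] {U V : Submodule ℂ E}
    [FiniteDimensional ℂ V] (h : U ≤ V) :
    ∃ g : Fin (Module.finrank ℂ V - Module.finrank ℂ U) → E,
      (∀ i, g i ∈ V) ∧ V ≤ U ⊔ Submodule.span ℂ (Set.range g) := by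
  set U' := U.comap V.subtype with hU'
  have h1 : Module.finrank ℂ U' = Module.finrank ℂ U :=
    (Submodule.comapSubtypeEquivOfLe h).finrank_eq
  have h2 : Module.finrank ℂ (V ⧸ U') = Module.finrank ℂ V - Module.finrank ℂ U := by
    have := Submodule.finrank_quotient_add_finrank U'
    omega
  set b := Module.finBasisOfFinrankEq ℂ (V ⧸ U') h2
  choose g hg using fun i => U'.mkQ_surjective (b i)
  refine ⟨fun i => (g i : E), fun i => (g i).2, fun v hv => ?_⟩
  have h3 : (⟨v, hv⟩ : V) - ∑ i, b.repr (U'.mkQ ⟨v, hv⟩) i • g i ∈ U' := by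
    rw [← Submodule.Quotient.mk_eq_zero, ← Submodule.mkQ_apply, map_sub, map_sum, sub_eq_zero]
    conv_lhs => rw [← b.sum_repr (U'.mkQ ⟨v, hv⟩)]
    exact Finset.sum_congr rfl fun i _ => by rw [map_smul, hg]
  rw [Submodule.mem_sup]
  refine ⟨_, h3, ∑ i, b.repr (U'.mkQ ⟨v, hv⟩) i • (g i : E), ?_, ?_⟩
  · exact Submodule.sum_mem _ fun i _ => Submodule.smul_mem _ _ (Submodule.subset_span ⟨i, rfl⟩)
  · simp

lemma exists_forall_ge_eq_zero {c : ℕ → ℕ} {N : ℕ} (h : ∀ M, ∑ k ∈ Finset.range M, c k ≤ N) :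
    ∃ M, ∀ k, M ≤ k → c k = 0 := by
  have h1 : BddAbove (Set.range fun M => ∑ k ∈ Finset.range M, c k) :=
    ⟨N, by rintro _ ⟨M, rfl⟩; exact h M⟩
  obtain ⟨M, hM⟩ := Nat.sSup_mem (Set.range_nonempty _) h1
  refine ⟨M, fun k hk => ?_⟩
  have h2 : ∑ k ∈ Finset.range (k + 1), c k ≤ ∑ k ∈ Finset.range M, c k :=
    (le_csSup h1 ⟨k + 1, rfl⟩).trans hM.ge
  have h3 : ∑ k ∈ Finset.range M, c k ≤ ∑ k ∈ Finset.range k, c k :=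
    Finset.sum_le_sum_of_subset (Finset.range_mono hk)
  rw [Finset.sum_range_succ] at h2
  omega

variable {σ : Type*} [Fintype σ]

/-- The weights `1, 2, …, n`. -/
def wts (n : ℕ) : Fin n → ℕ := fun i => i + 1

lemma wts_pos (n : ℕ) (i : Fin n) : 0 < wts n i := Nat.succ_pos _

/-- The weighted homogeneous polynomials of weighted degree `k - d`. -/
def wshift (n d k : ℕ) : Submodule ℂ (MvPolynomial (Fin n) ℂ) :=
  if d ≤ k then weightedHomogeneousSubmodule ℂ (wts n) (k - d) else ⊥

lemma finrank_wshift (n d k : ℕ) :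
    Module.finrank ℂ (wshift n d k) = if d ≤ k then wcount (wts n) (k - d) else 0 := by
  by_cases h : d ≤ k
  · rw [wshift, if_pos h, if_pos h, wcount]
  · rw [wshift, if_neg h, if_neg h, finrank_bot]

instance (n k : ℕ) : FiniteDimensional ℂ (weightedHomogeneousSubmodule ℂ (wts n) k) :=
  Module.Finite.iff_fg.2 (weightedHomogeneousSubmodule_fg ℂ (wts n) (fun i => (wts_pos n i).ne') k)

instance (n d k : ℕ) : FiniteDimensional ℂ (wshift n d k) := by
  by_cases h : d ≤ k
  · rw [wshift, if_pos h]
    infer_instance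
  · rw [wshift, if_neg h]
    infer_instance

lemma wshift_mul {n d k b : ℕ} {p c : MvPolynomial (Fin n) ℂ}
    (hp : IsWeightedHomogeneous (wts n) p b) (hc : c ∈ wshift n d k) :
    p * c ∈ wshift n d (b + k) := by
  unfold wshift at hc ⊢
  split_ifs at hc with h
  · rw [if_pos (by omega), Nat.add_sub_assoc h, mem_weightedHomogeneousSubmodule]
    exact hp.mul hc
  · rw [(Submodule.mem_bot ℂ).1 hc, mul_zero]
    exact Submodule.zero_mem _

namespace QSys

/-- Homogeneous generators `g i` of degree `d i` of `S.Q` as a module over the algebra generated by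
the `P j`. -/
structure IsGen (S : QSys σ) {n : ℕ} (P : Fin n → MvPolynomial σ ℂ) {ι : Type} [Fintype ι]
    (d : ι → ℕ) (g : ι → MvPolynomial σ ℂ) : Prop where
  hP : ∀ i : Fin n, P i ∈ S.Qk (i + 1)
  mem : ∀ i, g i ∈ S.Qk (d i)
  le_sup : ∀ k, S.Qk k ≤ S.Uk P k ⊔ Submodule.span ℂ {f | ∃ i, d i = k ∧ f = g i}

theorem exists_isGen (S : QSys σ) {n N : ℕ} {P : Fin n → MvPolynomial σ ℂ}
    (hP : ∀ i : Fin n, P i ∈ S.Qk (i + 1))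
    (hN : ∀ M, ∑ k ∈ Finset.range M,
      (Module.finrank ℂ (S.Qk k) - Module.finrank ℂ (S.Uk P k)) ≤ N) :
    ∃ (ι : Type) (_ : Fintype ι) (d : ι → ℕ) (g : ι → MvPolynomial σ ℂ),
      Fintype.card ι ≤ N ∧ S.IsGen P d g := by
  obtain ⟨M, hM⟩ := exists_forall_ge_eq_zero hN
  choose g hg hg2 using fun k => exists_generators_of_le (S.Uk_le hP k)
  refine ⟨Σ k : Fin M, Fin (Module.finrank ℂ (S.Qk k) - Module.finrank ℂ (S.Uk P k)), inferInstance,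
    fun x => x.1, fun x => g x.1 x.2, ?_, hP, fun x => hg _ _, fun k => (hg2 k).trans ?_⟩
  · rw [Fintype.card_sigma]
    simp only [Fintype.card_fin]
    rw [Fin.sum_univ_eq_sum_range fun k => Module.finrank ℂ (S.Qk k) - Module.finrank ℂ (S.Uk P k)]
    exact hN M
  · refine sup_le_sup_left (Submodule.span_mono ?_) _
    rintro _ ⟨i, rfl⟩
    have hk : k < M := by
      by_contra h
      have := hM k (not_lt.1 h)
      exact absurd i.2 (by omega)
    exact ⟨⟨⟨k, hk⟩, i⟩, rfl, rfl⟩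

variable {S : QSys σ} {n : ℕ} {P : Fin n → MvPolynomial σ ℂ} {ι : Type} [Fintype ι]
  {d : ι → ℕ} {g : ι → MvPolynomial σ ℂ}

lemma mul_mem_Qk {a b : ℕ} {p q : MvPolynomial σ ℂ} (hp : p ∈ S.Qk a) (hq : q ∈ S.Qk b) :
    p * q ∈ S.Qk (a + b) := by
  rw [mem_Qk] at *
  exact ⟨Subalgebra.mul_mem _ hp.1 hq.1, hp.2.mul hq.2⟩

lemma aeval_mem_Qk (hP : ∀ i : Fin n, P i ∈ S.Qk (i + 1)) {p : MvPolynomial (Fin n) ℂ} {b : ℕ}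
    (hp : IsWeightedHomogeneous (wts n) p b) : aeval P p ∈ S.Qk b := by
  rw [p.as_sum, map_sum]
  refine Submodule.sum_mem _ fun m hm => ?_
  have h1 := hp (mem_support_iff.1 hm)
  rw [aeval_monomial, ← Algebra.smul_def]
  refine Submodule.smul_mem _ _ ?_
  rw [Finsupp.weight_apply] at h1
  rw [mem_Qk, ← h1]
  refine ⟨Subalgebra.prod_mem _ fun i _ => Subalgebra.pow_mem _ (mem_Qk.1 (hP i)).1 _, ?_⟩
  refine IsHomogeneous.prod _ _ _ fun i _ => ?_
  have h2 := (mem_Qk.1 (hP i)).2.pow (m i)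
  rwa [mul_comm] at h2

variable (n d) in
/-- The homogeneous coefficient vectors of degree `k`. -/
abbrev Coef (k : ℕ) := ∀ i, wshift n (d i) k

variable (P g) in
/-- The linear combination of the generators. -/
def genMap (c : ι → MvPolynomial (Fin n) ℂ) : MvPolynomial σ ℂ := ∑ i, aeval P (c i) * g i

variable (P d g) in
/-- The linear combination of the generators, in degree `k`. -/
def genLin (k : ℕ) : Coef n d k →ₗ[ℂ] MvPolynomial σ ℂ where
  toFun c := genMap P g fun i => c i
  map_add' c e := by simp [genMap, add_mul, Finset.sum_add_distrib]
  map_smul' a c := by simp [genMap, Finset.smul_sum]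

omit [Fintype σ] in
lemma genLin_apply (k : ℕ) (c : Coef n d k) : genLin P d g k c = genMap P g fun i => c i := rfl

omit [Fintype σ] in
lemma genMap_mul (p : MvPolynomial (Fin n) ℂ) (c : ι → MvPolynomial (Fin n) ℂ) :
    genMap P g (fun i => p * c i) = aeval P p * genMap P g c := by
  simp only [genMap, map_mul, Finset.mul_sum, mul_assoc]

/-- Multiplication of a coefficient vector by a weighted homogeneous polynomial. -/
def Coef.mul {k b : ℕ} {p : MvPolynomial (Fin n) ℂ} (hp : IsWeightedHomogeneous (wts n) p b)
    (c : Coef n d k) : Coef n d (b + k) := fun i => ⟨p * c i, wshift_mul hp (c i).2⟩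

omit [Fintype σ] in
lemma genLin_mul {k b : ℕ} {p : MvPolynomial (Fin n) ℂ} (hp : IsWeightedHomogeneous (wts n) p b)
    (c : Coef n d k) : genLin P d g (b + k) (c.mul hp) = aeval P p * genLin P d g k c :=
  genMap_mul p _

lemma finrank_Coef (k : ℕ) : Module.finrank ℂ (Coef n d k) =
    ∑ i, if d i ≤ k then wcount (wts n) (k - d i) else 0 := by
  rw [Module.finrank_pi_fintype]
  exact Finset.sum_congr rfl fun i _ => finrank_wshift _ _ _

namespace IsGen

variable (H : S.IsGen P d g)
include H

lemma range_genLin (k : ℕ) : LinearMap.range (genLin P d g k) = S.Qk k := by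
  classical
  apply le_antisymm
  · rintro _ ⟨c, rfl⟩
    rw [genLin_apply, genMap]
    refine Submodule.sum_mem _ fun i _ => ?_
    have h1 := (c i).2
    unfold wshift at h1
    split_ifs at h1 with h
    · have := mul_mem_Qk (aeval_mem_Qk H.hP h1) (H.mem i)
      rwa [Nat.sub_add_cancel h] at this
    · rw [(Submodule.mem_bot ℂ).1 h1, map_zero, zero_mul]
      exact Submodule.zero_mem _
  · induction k using Nat.strong_induction_on with
    | _ k ih =>
    refine (H.le_sup k).trans (sup_le (Submodule.span_le.2 ?_) (Submodule.span_le.2 ?_))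
    · rintro _ ⟨i, a, q, hk, hq, rfl⟩
      obtain ⟨c, rfl⟩ := ih a (by omega) hq
      have hX : IsWeightedHomogeneous (wts n) (X i : MvPolynomial (Fin n) ℂ) (i + 1) :=
        isWeightedHomogeneous_X _ _ _
      have hk' : (i + 1 : ℕ) + a = k := by omega
      subst hk'
      exact ⟨c.mul hX, by rw [genLin_mul, aeval_X]⟩
    · rintro _ ⟨i, rfl, rfl⟩
      have h1 : (1 : MvPolynomial (Fin n) ℂ) ∈ wshift n (d i) (d i) := by
        rw [wshift, if_pos le_rfl, Nat.sub_self]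
        exact isWeightedHomogeneous_one _ _
      refine ⟨Pi.single i ⟨1, h1⟩, ?_⟩
      rw [genLin_apply, genMap, Finset.sum_eq_single i]
      · simp
      · intro j _ hj
        simp [Pi.single_eq_of_ne hj]
      · simp

lemma finrank_add_finrank_ker (k : ℕ) :
    Module.finrank ℂ (S.Qk k) + Module.finrank ℂ (LinearMap.ker (genLin P d g k)) =
      ∑ i, if d i ≤ k then wcount (wts n) (k - d i) else 0 := by
  rw [← H.range_genLin, LinearMap.finrank_range_add_finrank_ker, finrank_Coef]

lemma finrank_add_le {e : ℕ} {c : Coef n d e} (hc : c ≠ 0) (h0 : genLin P d g e c = 0) (k : ℕ) :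
    Module.finrank ℂ (S.Qk k) + (if e ≤ k then wcount (wts n) (k - e) else 0) ≤
      ∑ i, if d i ≤ k then wcount (wts n) (k - d i) else 0 := by
  rw [← H.finrank_add_finrank_ker]
  refine Nat.add_le_add_left ?_ _
  split_ifs with h
  · obtain ⟨b, rfl⟩ := Nat.exists_eq_add_of_le' h
    rw [Nat.add_sub_cancel]
    let φ : weightedHomogeneousSubmodule ℂ (wts n) b →ₗ[ℂ] LinearMap.ker (genLin P d g (b + e)) :=
      { toFun p := ⟨c.mul p.2, LinearMap.mem_ker.2 ((genLin_mul p.2 c).trans (by rw [h0, mul_zero]))⟩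
        map_add' p q := by
          refine Subtype.ext (funext fun i => Subtype.ext ?_)
          exact add_mul p.1 q.1 _
        map_smul' a p := by
          refine Subtype.ext (funext fun i => Subtype.ext ?_)
          exact smul_mul_assoc a p.1 _ }
    refine LinearMap.finrank_le_finrank_of_injective (f := φ) ?_
    refine (injective_iff_map_eq_zero φ).2 fun p hp => ?_
    obtain ⟨i, hi⟩ := Function.ne_iff.1 hc
    have h1 : p.1 * (c i).1 = 0 := congrArg (fun x => ((x.1 i).1)) hp
    refine Subtype.ext ((mul_eq_zero.1 h1).resolve_right fun h2 => hi (Subtype.ext h2))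
  · exact Nat.zero_le _

end IsGen

end QSys

end Generators

section Asymptotics

lemma eval_one_nonneg {F : Polynomial ℝ} (h : ∀ t : ℝ, 0 < t → t < 1 → 0 ≤ F.eval t) :
    0 ≤ F.eval 1 := by
  have h1 : Filter.Tendsto (fun t => F.eval t) (nhdsWithin 1 (Set.Iio 1)) (nhds (F.eval 1)) :=
    (F.continuous.tendsto 1).mono_left nhdsWithin_le_nhds
  refine ge_of_tendsto h1 ?_
  filter_upwards [Ioo_mem_nhdsLT (zero_lt_one' ℝ)] with t ht
  exact h t ht.1 ht.2

lemma eval_one_derivative_nonpos {F : Polynomial ℝ} (h : ∀ t : ℝ, 0 < t → t < 1 → 0 ≤ F.eval t)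
    (h1 : F.eval 1 = 0) : F.derivative.eval 1 ≤ 0 := by
  obtain ⟨q, rfl⟩ := Polynomial.dvd_iff_isRoot.2 h1
  have h2 : 0 ≤ (-q).eval 1 := eval_one_nonneg fun t ht0 ht1 => by
    have := h t ht0 ht1
    rw [Polynomial.eval_mul] at this
    simp only [Polynomial.eval_sub, Polynomial.eval_X, Polynomial.eval_C, Polynomial.eval_neg] at this ⊢
    nlinarith
  simp only [Polynomial.eval_neg] at h2
  simp only [Polynomial.derivative_mul, Polynomial.derivative_sub, Polynomial.derivative_X,
    Polynomial.derivative_C, Polynomial.eval_add, Polynomial.eval_mul, Polynomial.eval_sub,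
    Polynomial.eval_X, Polynomial.eval_C, Polynomial.eval_one, Polynomial.eval_zero]
  linarith

/-- The polynomial `∏ (1 + t + ⋯ + t^i)` over `i < n`. -/
def geo (n : ℕ) : Polynomial ℝ :=
  ∏ i ∈ Finset.range n, ∑ l ∈ Finset.range (i + 1), Polynomial.X ^ l

lemma geo_succ (n : ℕ) :
    geo (n + 1) = geo n * ∑ l ∈ Finset.range (n + 1), Polynomial.X ^ l :=
  Finset.prod_range_succ _ _

lemma eval_one_geo (n : ℕ) : (geo n).eval 1 = n.factorial := by
  induction n with
  | zero => simp [geo]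
  | succ n ih =>
    rw [geo_succ, Polynomial.eval_mul, ih, Polynomial.eval_finsetSum, Nat.factorial_succ]
    simp
    ring

lemma four_mul_eval_one_derivative_geo (n : ℕ) :
    4 * (geo n).derivative.eval 1 = n.factorial * ((n : ℝ) * (n - 1)) := by
  induction n with
  | zero => simp [geo]
  | succ n ih =>
    have h1 : ((∑ l ∈ Finset.range (n + 1), Polynomial.X ^ l : Polynomial ℝ)).eval 1 = n + 1 := by
      rw [Polynomial.eval_finsetSum]
      simp
    have h2 : 2 * ((∑ l ∈ Finset.range (n + 1), Polynomial.X ^ l : Polynomial ℝ)).derivative.eval 1 =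
        n * (n + 1) := by
      have h3 := Finset.sum_range_id_mul_two (n + 1)
      rw [Nat.add_sub_cancel] at h3
      rw [Polynomial.derivative_sum, Polynomial.eval_finsetSum]
      simp only [Polynomial.derivative_X_pow, Polynomial.eval_mul, Polynomial.eval_pow,
        Polynomial.eval_X, one_pow, mul_one, Polynomial.eval_C]
      have h4 := congrArg (fun a : ℕ => (a : ℝ)) h3
      push_cast at h4
      linarith
    rw [geo_succ, Polynomial.derivative_mul, Polynomial.eval_add, Polynomial.eval_mul,
      Polynomial.eval_mul, h1, eval_one_geo, Nat.factorial_succ]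
    push_cast
    linear_combination (n + 1 : ℝ) * ih + 2 * (n.factorial : ℝ) * h2

lemma eval_geo_eq {n : ℕ} {t : ℝ} (h1 : t < 1) :
    (geo n).eval t = (∏ i : Fin n, (1 - t ^ wts n i)) * ((1 - t)⁻¹) ^ n := by
  rw [geo, Polynomial.eval_prod, ← Fin.prod_univ_eq_prod_range
    fun i => ((∑ l ∈ Finset.range (i + 1), Polynomial.X ^ l : Polynomial ℝ)).eval t]
  have h2 : ((1 - t)⁻¹) ^ n = ∏ _i : Fin n, (1 - t)⁻¹ := by simp
  rw [h2, ← Finset.prod_mul_distrib]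
  refine Finset.prod_congr rfl fun i _ => ?_
  rw [Polynomial.eval_finsetSum]
  simp only [Polynomial.eval_pow, Polynomial.eval_X]
  rw [geom_sum_eq h1.ne, wts]
  have h3 : (1 - t) ≠ 0 := by linarith
  have h4 : (t - 1) ≠ 0 := by linarith
  field_simp
  ring

lemma hasSum_shift {a : ℕ → ℝ} {t A : ℝ} (h : HasSum (fun k => a k * t ^ k) A) (d : ℕ) :
    HasSum (fun k => (if d ≤ k then a (k - d) else 0) * t ^ k) (t ^ d * A) := by
  rw [← (add_left_injective d).hasSum_iff]
  · refine (h.mul_left (t ^ d)).congr_fun fun k => ?_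
    simp only [Function.comp_apply]
    rw [if_pos (Nat.le_add_left d k), Nat.add_sub_cancel, pow_add]
    ring
  · intro k hk
    rw [if_neg, zero_mul]
    intro h
    exact hk ⟨k - d, Nat.sub_add_cancel h⟩

variable {σ : Type*} [Fintype σ]

lemma hasSum_rho {n : ℕ} (hσ : Fintype.card σ = n) {t : ℝ} (h0 : 0 < t) (h1 : t < 1) :
    HasSum (fun k => (rho σ k : ℝ) * t ^ k) (((1 - t)⁻¹) ^ n) := by
  have h := hasSum_wcount (w := (1 : σ → ℕ)) (fun _ => one_pos) h0 h1
  simpa [hσ, rho_eq_wcount] using h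

/-- The inverse of the Hilbert series of the polynomial algebra with weights `1, …, n`. -/
def wprod (n : ℕ) (t : ℝ) : ℝ := ∏ i : Fin n, (1 - t ^ wts n i)

lemma wprod_pos (n : ℕ) {t : ℝ} (h0 : 0 < t) (h1 : t < 1) : 0 < wprod n t :=
  Finset.prod_pos fun i _ => sub_pos.2 (pow_lt_one₀ h0.le h1 (wts_pos n i).ne')

lemma hasSum_wcount_shift (n d : ℕ) {t : ℝ} (h0 : 0 < t) (h1 : t < 1) :
    HasSum (fun k => (((if d ≤ k then wcount (wts n) (k - d) else 0 : ℕ)) : ℝ) * t ^ k)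
      (t ^ d * (wprod n t)⁻¹) := by
  have h := hasSum_shift (hasSum_wcount (wts_pos n) h0 h1) d
  rw [Finset.prod_inv_distrib] at h
  push_cast
  exact h

lemma hasSum_rhs {n : ℕ} {ι : Type} [Fintype ι] {d : ι → ℕ} {t : ℝ} (h0 : 0 < t) (h1 : t < 1) :
    HasSum (fun k => ((∑ i, if d i ≤ k then wcount (wts n) (k - d i) else 0 : ℕ) : ℝ) * t ^ k)
      ((∑ i, t ^ d i) * (wprod n t)⁻¹) := by
  have h := hasSum_sum (s := Finset.univ) fun i _ => hasSum_wcount_shift n (d i) h0 h1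
  rw [← Finset.sum_mul] at h
  refine h.congr_fun fun k => ?_
  push_cast
  rw [Finset.sum_mul]

namespace QSys

variable {S : QSys σ} {n : ℕ} {P : Fin n → MvPolynomial σ ℂ} {ι : Type} [Fintype ι]
  {d : ι → ℕ} {g : ι → MvPolynomial σ ℂ}

lemma rho_le_finrank {K : ℕ} (hK : S.κ.IsHomogeneous K) (k : ℕ) :
    rho σ k ≤ Module.finrank ℂ (S.Qk (K + k)) := by
  let φ : homogeneousSubmodule σ ℂ k →ₗ[ℂ] S.Qk (K + k) :=
    (LinearMap.mulLeft ℂ S.κ).restrict fun p hp => mem_Qk.2 ⟨S.κ_mul p, hK.mul hp⟩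
  refine LinearMap.finrank_le_finrank_of_injective (f := φ) ?_
  refine (injective_iff_map_eq_zero φ).2 fun p hp => ?_
  have h1 : S.κ * p.1 = 0 := congrArg Subtype.val hp
  exact Subtype.ext ((mul_eq_zero.1 h1).resolve_left (closure_hom S.κ_mem).1)

namespace IsGen

variable (H : S.IsGen P d g)
include H

omit H in
lemma factorial_add_le (hσ : Fintype.card σ = n) (b : ℕ → ℕ) (B : Polynomial ℝ)
    (hb : ∀ k, Module.finrank ℂ (S.Qk k) + b k ≤
      ∑ i, if d i ≤ k then wcount (wts n) (k - d i) else 0)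
    (hB : ∀ t : ℝ, 0 < t → t < 1 →
      HasSum (fun k => (b k : ℝ) * t ^ k) (B.eval t * (wprod n t)⁻¹)) :
    (n.factorial : ℝ) + B.eval 1 ≤ Fintype.card ι := by
  obtain ⟨K, hK⟩ : ∃ K, S.κ.IsHomogeneous K := (closure_hom S.κ_mem).2
  have h := eval_one_nonneg
    (F := (∑ i, Polynomial.X ^ d i) - Polynomial.X ^ K * geo n - B) fun t h0 h1 => ?_
  · simp only [Polynomial.eval_sub, Polynomial.eval_finsetSum, Polynomial.eval_pow,
      Polynomial.eval_X, one_pow, Polynomial.eval_mul, one_mul, eval_one_geo, Finset.sum_const,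
      Finset.card_univ, nsmul_eq_mul, mul_one] at h
    linarith
  · have h2 := hasSum_shift (hasSum_rho hσ h0 h1) K
    have h3 := hasSum_le (fun k => ?_) (h2.add (hB t h0 h1)) (hasSum_rhs (n := n) (d := d) h0 h1)
    · have hw := wprod_pos n h0 h1
      have h4 := mul_le_mul_of_nonneg_right h3 hw.le
      rw [add_mul, mul_assoc _ _ (wprod n t), mul_assoc _ _ (wprod n t),
        mul_assoc _ _ (wprod n t), inv_mul_cancel₀ hw.ne'] at h4
      simp only [Polynomial.eval_sub, Polynomial.eval_finsetSum, Polynomial.eval_pow,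
        Polynomial.eval_X, Polynomial.eval_mul, eval_geo_eq h1]
      rw [← wprod]
      linarith
    · rw [← add_mul]
      refine mul_le_mul_of_nonneg_right ?_ (pow_nonneg h0.le k)
      refine le_trans ?_ (Nat.cast_le.2 (hb k))
      push_cast
      refine add_le_add_left ?_ _
      split_ifs with hk
      · have := rho_le_finrank hK (k - K)
        rw [Nat.add_sub_cancel' hk] at this
        exact_mod_cast this
      · positivity

theorem ker_eq_bot (hσ : Fintype.card σ = n) (hN : Fintype.card ι ≤ n.factorial) (k : ℕ) :
    LinearMap.ker (genLin P d g k) = ⊥ := by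
  rw [LinearMap.ker_eq_bot']
  intro c hc
  by_contra h0
  have h := factorial_add_le (S := S) hσ (fun j => if k ≤ j then wcount (wts n) (j - k) else 0)
    (Polynomial.X ^ k) (H.finrank_add_le h0 hc) fun t h0 h1 => by
      simpa using hasSum_wcount_shift n k h0 h1
  have h2 : (Fintype.card ι : ℝ) ≤ n.factorial := by exact_mod_cast hN
  simp at h
  linarith

theorem card_eq (hσ : Fintype.card σ = n) (hN : Fintype.card ι ≤ n.factorial) :
    Fintype.card ι = n.factorial := by
  refine le_antisymm hN ?_
  have h := factorial_add_le (S := S) hσ (fun j => 0) 0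
    (fun k => by rw [← H.finrank_add_finrank_ker k]; omega) fun t h0 h1 => by
      simp
  simpa using h

theorem finrank_eq (hσ : Fintype.card σ = n) (hN : Fintype.card ι ≤ n.factorial) (k : ℕ) :
    Module.finrank ℂ (S.Qk k) = ∑ i, if d i ≤ k then wcount (wts n) (k - d i) else 0 := by
  rw [← H.finrank_add_finrank_ker k, H.ker_eq_bot hσ hN, finrank_bot, add_zero]

theorem four_mul_sum_le (hσ : Fintype.card σ = n) (hN : Fintype.card ι ≤ n.factorial) (M : ℕ)
    (hM : ∀ k, rho σ k + M * (if k = 0 then 0 else rho σ (k - 1)) ≤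
      Module.finrank ℂ (S.Qk k) + M * rho σ k) :
    4 * ∑ i, d i ≤ n.factorial * (4 * M + n * (n - 1)) := by
  have h := eval_one_derivative_nonpos (F := (∑ i, Polynomial.X ^ d i) +
    (Polynomial.C (M : ℝ) - Polynomial.C (M : ℝ) * Polynomial.X - 1) * geo n) ?_ ?_
  · have h2 := four_mul_eval_one_derivative_geo n
    have h3 : (∑ i, Polynomial.X ^ d i : Polynomial ℝ).derivative.eval 1 = ∑ i, (d i : ℝ) := by
      rw [Polynomial.derivative_sum, Polynomial.eval_finsetSum]
      exact Finset.sum_congr rfl fun i _ => by simp [Polynomial.derivative_X_pow]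
    rw [Polynomial.derivative_add, Polynomial.eval_add, h3] at h
    simp [eval_one_geo, Polynomial.derivative_mul] at h
    have h3 : (4 : ℝ) * ∑ i, (d i : ℝ) ≤ n.factorial * (4 * M + n * (n - 1)) := by
      nlinarith
    rcases n with _ | n
    · have h4 : (4 * ∑ i, (d i : ℝ)) ≤ Nat.factorial 0 * (4 * M + 0) := by simpa using h3
      exact_mod_cast h4
    · have h4 : (4 * ∑ i, (d i : ℝ)) ≤ (n + 1).factorial * (4 * M + ((n + 1 : ℕ) : ℝ) * n) := by
        simpa using h3
      exact_mod_cast h4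
  · intro t h0 h1
    have h2 := hasSum_rho hσ h0 h1
    have h3 := h2.add ((hasSum_shift h2 1).mul_left (M : ℝ))
    have h4 := (hasSum_rhs (n := n) (d := d) h0 h1).add (h2.mul_left (M : ℝ))
    have h5 := hasSum_le (fun k => ?_) h3 h4
    · have hw := wprod_pos n h0 h1
      have h6 := mul_le_mul_of_nonneg_right h5 hw.le
      rw [add_mul (_ * _), mul_assoc _ _ (wprod n t), inv_mul_cancel₀ hw.ne'] at h6
      simp only [Polynomial.eval_sub, Polynomial.eval_add, Polynomial.eval_finsetSum,
        Polynomial.eval_pow, Polynomial.eval_X, Polynomial.eval_mul, Polynomial.eval_C,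
        Polynomial.eval_one, eval_geo_eq h1]
      rw [← wprod]
      linarith
    · have h6 := hM k
      rw [H.finrank_eq hσ hN] at h6
      have h7 := mul_le_mul_of_nonneg_right
        ((Nat.cast_le (α := ℝ)).2 h6) (pow_nonneg h0.le k)
      rw [Nat.cast_add, Nat.cast_add, Nat.cast_mul, Nat.cast_mul] at h7
      rcases k with _ | k
      · simpa [add_mul, mul_assoc] using h7
      · simpa [add_mul, mul_assoc] using h7
  · simp [eval_one_geo, Polynomial.eval_finsetSum, H.card_eq hσ hN]

end IsGen

end QSys

end Asymptotics

section Duality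

lemma det_coord_mul_ne_zero {A B ι : Type*} [CommRing A] [IsDomain A] [CommRing B] [IsDomain B]
    [Algebra A B] [Fintype ι] [DecidableEq ι] (b : Module.Basis ι A B) (i₀ : ι) :
    (Matrix.of fun i j => b.repr (b i * b j) i₀).det ≠ 0 := by
  intro h
  obtain ⟨v, hv, h0⟩ := Matrix.exists_mulVec_eq_zero_iff.2 h
  have hfin : Module.Finite A B := Module.Finite.of_basis b
  have hinj : FaithfulSMul A B := by
    have : Nonempty ι := ⟨i₀⟩
    have := b.isTorsionFree
    infer_instance
  set f := ∑ j, v j • b j with hf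
  have hf0 : f ≠ 0 := fun h1 => hv (funext fun j => by
    have := Fintype.linearIndependent_iff.1 b.linearIndependent v h1 j
    simpa using this)
  have h1 : (b.coord i₀) ∘ₗ LinearMap.mulLeft A f = 0 := by
    refine b.ext fun i => ?_
    have h2 := congrFun h0 i
    simp only [Matrix.mulVec, dotProduct, Matrix.of_apply, Pi.zero_apply] at h2
    simp only [LinearMap.comp_apply, LinearMap.mulLeft_apply, hf, Finset.sum_mul, smul_mul_assoc,
      map_sum, map_smul, Module.Basis.coord_apply, smul_eq_mul, LinearMap.zero_apply]
    rw [← h2]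
    exact Finset.sum_congr rfl fun j _ => by rw [mul_comm, mul_comm (b j)]
  obtain ⟨a, ha, q, hq⟩ := (Algebra.IsIntegral.isIntegral (R := A) f).isAlgebraic.exists_nonzero_dvd
    (mem_nonZeroDivisors_of_ne_zero hf0)
  have h3 := LinearMap.congr_fun h1 (q * b i₀)
  rw [LinearMap.comp_apply, LinearMap.mulLeft_apply, ← mul_assoc, ← hq, ← Algebra.smul_def,
    map_smul, Module.Basis.coord_apply, b.repr_self, Finsupp.single_eq_same] at h3
  exact ha (by simpa using h3)

lemma exists_perm_of_det_ne_zero {A ι : Type*} [CommRing A] [Fintype ι] [DecidableEq ι]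
    {M : Matrix ι ι A} (h : M.det ≠ 0) : ∃ τ : Equiv.Perm ι, ∀ i, M (τ i) i ≠ 0 := by
  by_contra hτ
  push Not at hτ
  refine h ?_
  rw [Matrix.det_apply]
  refine Finset.sum_eq_zero fun τ _ => ?_
  obtain ⟨i, hi⟩ := hτ τ
  rw [Finset.prod_eq_zero (f := fun j => M (τ j) j) (Finset.mem_univ i) hi, smul_zero]

variable {σ : Type*} [Fintype σ]

namespace QSys

variable {S : QSys σ} {n : ℕ} {P : Fin n → MvPolynomial σ ℂ} {ι : Type} [Fintype ι]
  {d : ι → ℕ} {g : ι → MvPolynomial σ ℂ}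

namespace IsGen

/-- The component of weighted degree `k - d`. -/
def shiftComp (n d k : ℕ) : MvPolynomial (Fin n) ℂ →ₗ[ℂ] MvPolynomial (Fin n) ℂ :=
  if d ≤ k then weightedHomogeneousComponent (wts n) (k - d) else 0

lemma shiftComp_mem (n d k : ℕ) (p : MvPolynomial (Fin n) ℂ) : shiftComp n d k p ∈ wshift n d k := by
  by_cases h : d ≤ k
  · rw [shiftComp, wshift, if_pos h, if_pos h]
    exact weightedHomogeneousComponent_isWeightedHomogeneous (w := wts n) _ _
  · rw [shiftComp, wshift, if_neg h, if_neg h]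
    exact Submodule.zero_mem _

lemma eq_zero_of_mem_wshift {n d k : ℕ} (h : ¬ d ≤ k) {p : MvPolynomial (Fin n) ℂ}
    (hp : p ∈ wshift n d k) : p = 0 := by
  rwa [wshift, if_neg h, Submodule.mem_bot] at hp

lemma eq_zero_of_shiftComp {n d : ℕ} {p : MvPolynomial (Fin n) ℂ}
    (h : ∀ k, shiftComp n d k p = 0) : p = 0 := by
  rw [← sum_weightedHomogeneousComponent (wts n) p]
  refine finsum_eq_zero_of_forall_eq_zero fun k => ?_
  have := h (k + d)
  rwa [shiftComp, if_pos (Nat.le_add_left d k), Nat.add_sub_cancel] at this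

variable (H : S.IsGen P d g)
include H

lemma homogeneousComponent_aeval_mul (k : ℕ) (i : ι) (p : MvPolynomial (Fin n) ℂ) :
    homogeneousComponent k (aeval P p * g i) = aeval P (shiftComp n (d i) k p) * g i := by
  induction p using MvPolynomial.induction_on' with
  | add p q hp hq => rw [map_add, add_mul, map_add, hp, hq, map_add, map_add, add_mul]
  | monomial m a =>
    have h1 : IsWeightedHomogeneous (wts n) (monomial m a) (Finsupp.weight (wts n) m) :=
      isWeightedHomogeneous_monomial _ _ _ rfl
    have h2 := mul_mem_Qk (aeval_mem_Qk H.hP h1) (H.mem i)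
    rw [homogeneousComponent_of_mem (mem_Qk.1 h2).2, shiftComp]
    split_ifs with h3 h4 h4
    · subst h3
      rw [Nat.add_sub_cancel, h1.weightedHomogeneousComponent_same]
    · omega
    · rw [weightedHomogeneousComponent_of_mem h1, if_neg (by omega), map_zero, zero_mul]
    · simp

lemma homogeneousComponent_genMap (k : ℕ) (c : ι → MvPolynomial (Fin n) ℂ) :
    homogeneousComponent k (genMap P g c) =
      genLin P d g k fun i => ⟨_, shiftComp_mem n (d i) k (c i)⟩ := by
  rw [genLin_apply, genMap, map_sum, genMap]
  exact Finset.sum_congr rfl fun i _ => H.homogeneousComponent_aeval_mul k i _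

lemma genMap_injective (hk : ∀ k, LinearMap.ker (genLin P d g k) = ⊥)
    {c : ι → MvPolynomial (Fin n) ℂ} (hc : genMap P g c = 0) : c = 0 := by
  funext i
  refine eq_zero_of_shiftComp (d := d i) fun k => ?_
  have h1 := H.homogeneousComponent_genMap k c
  rw [hc, map_zero] at h1
  have h2 := LinearMap.ker_eq_bot'.1 (hk k) _ h1.symm
  exact congrArg Subtype.val (congrFun h2 i)

lemma exists_genMap_eq {f : MvPolynomial σ ℂ} (hf : f ∈ S.Q) :
    ∃ c, genMap P g c = f := by
  choose c hc using fun k => (H.range_genLin k).ge (hc_mem_Qk hf k)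
  refine ⟨fun i => ∑ k ∈ Finset.range (f.totalDegree + 1), (c k i : MvPolynomial (Fin n) ℂ), ?_⟩
  conv_rhs => rw [← sum_homogeneousComponent f]
  rw [genMap]
  simp only [map_sum, Finset.sum_mul]
  rw [Finset.sum_comm]
  exact Finset.sum_congr rfl fun k _ => hc k

/-- The generators form a self-dual system: the top degree pairs the generators. -/
theorem exists_perm (hk : ∀ k, LinearMap.ker (genLin P d g k) = ⊥) (i₀ : ι) :
    ∃ τ : Equiv.Perm ι, ∀ i, d i₀ ≤ d (τ i) + d i := by
  classical
  have hPQ : ∀ i, P i ∈ S.Q := fun i => (mem_Qk.1 (H.hP i)).1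
  have hgQ : ∀ i, g i ∈ S.Q := fun i => (mem_Qk.1 (H.mem i)).1
  let φ : MvPolynomial (Fin n) ℂ →ₐ[ℂ] S.Q := aeval fun i => ⟨P i, hPQ i⟩
  let _ : Algebra (MvPolynomial (Fin n) ℂ) S.Q := φ.toRingHom.toAlgebra
  have hφ : ∀ p, (φ p : MvPolynomial σ ℂ) = aeval P p := fun p => by
    have h1 : S.Q.val.comp φ = aeval P := by
      ext i
      simp [φ]
    exact DFunLike.congr_fun h1 p
  have hsmul : ∀ (p : MvPolynomial (Fin n) ℂ) (q : S.Q), ((p • q : S.Q) : MvPolynomial σ ℂ) =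
      aeval P p * q := fun p q => by
    rw [Algebra.smul_def, ← hφ]
    rfl
  let ψ : (ι → MvPolynomial (Fin n) ℂ) →ₗ[MvPolynomial (Fin n) ℂ] S.Q :=
    Fintype.linearCombination (MvPolynomial (Fin n) ℂ) fun i => (⟨g i, hgQ i⟩ : S.Q)
  have hψ : ∀ c, (ψ c : MvPolynomial σ ℂ) = genMap P g c := fun c => by
    rw [Fintype.linearCombination_apply, AddSubmonoidClass.coe_finsetSum, genMap]
    exact Finset.sum_congr rfl fun i _ => hsmul _ _
  have hbij : Function.Bijective ψ := by
    constructor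
    · refine (injective_iff_map_eq_zero ψ).2 fun c hc => ?_
      refine H.genMap_injective hk ?_
      rw [← hψ, hc]
      rfl
    · intro q
      obtain ⟨c, hc⟩ := H.exists_genMap_eq q.2
      exact ⟨c, Subtype.ext ((hψ c).trans hc)⟩
  let e := LinearEquiv.ofBijective ψ hbij
  let b : Module.Basis ι (MvPolynomial (Fin n) ℂ) S.Q := Module.Basis.ofEquivFun e.symm
  have hb : ∀ i, (b i : MvPolynomial σ ℂ) = g i := fun i => by
    have : b i = ψ (Pi.single i 1) := by simp [b, e]
    rw [this, hψ, genMap, Finset.sum_eq_single i]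
    · simp
    · intro j _ hj
      simp [Pi.single_eq_of_ne hj]
    · simp
  obtain ⟨τ, hτ⟩ := exists_perm_of_det_ne_zero (det_coord_mul_ne_zero b i₀)
  refine ⟨τ, fun i => ?_⟩
  by_contra hlt
  refine hτ i ?_
  obtain ⟨c, hc⟩ := (H.range_genLin _).ge (mul_mem_Qk (H.mem (τ i)) (H.mem i))
  have h1 : b (τ i) * b i = e fun j => (c j : MvPolynomial (Fin n) ℂ) := by
    refine Subtype.ext ?_
    have h2 : ((e fun j => (c j : MvPolynomial (Fin n) ℂ) : S.Q) : MvPolynomial σ ℂ) = _ := hψ _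
    rw [h2, ← genLin_apply, hc, ← hb, ← hb]
    rfl
  have h3 : b.repr (b (τ i) * b i) i₀ = (c i₀ : MvPolynomial (Fin n) ℂ) := by
    rw [h1, ← Module.Basis.equivFun_apply, Module.Basis.equivFun_ofEquivFun,
      LinearEquiv.symm_apply_apply]
  rw [Matrix.of_apply, h3]
  exact eq_zero_of_mem_wshift hlt (c i₀).2

end IsGen

end QSys

end Duality

section SpecialPoints

lemma coeff_sum_C_mul_X_pow_sub {A : Type*} [CommRing A] (n : ℕ) (a : ℕ → A) {k : ℕ} (hk : k ≤ n) :
    (∑ i ∈ Finset.range (n + 1), Polynomial.C (a i) * Polynomial.X ^ (n - i)).coeff (n - k) = a k := by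
  rw [Polynomial.finsetSum_coeff, Finset.sum_eq_single k]
  · rw [Polynomial.coeff_C_mul_X_pow, if_pos rfl]
  · intro i hi hik
    have := Finset.mem_range.mp hi
    rw [Polynomial.coeff_C_mul_X_pow, if_neg (by omega)]
  · intro h
    exact absurd (Finset.mem_range.mpr (by omega)) h

lemma aeval_esymm_eq_coeff {A : Type*} [CommRing A] [Algebra ℂ A] {n : ℕ} (Y : Fin n → A) {k : ℕ}
    (hk : k ≤ n) : aeval Y (esymm (Fin n) ℂ k) =
      (-1) ^ k * (∏ j, (Polynomial.X - Polynomial.C (Y j))).coeff (n - k) := by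
  have h1 : (∏ j, (Polynomial.X - Polynomial.C (Y j))) =
      ((Finset.univ.val.map Y).map fun t => Polynomial.X - Polynomial.C t).prod := by
    rw [Multiset.map_map]; rfl
  have hc : (Finset.univ.val.map Y).card = n := by simp
  rw [h1, Multiset.prod_X_sub_C_coeff _ (by rw [hc]; omega), hc, aeval_esymm_eq_multiset_esymm,
    Nat.sub_sub_self hk, ← mul_assoc, ← mul_pow, neg_one_mul, neg_neg, one_pow, one_mul]

lemma exists_prod_X_sub_C {K : Type*} [Field K] [IsAlgClosed K] (n : ℕ) (p : Polynomial K) (hp : p.Monic)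
    (hn : p.natDegree = n) :
    ∃ y : Fin n → K, ∏ j, (Polynomial.X - Polynomial.C (y j)) = p := by
  induction n generalizing p with
  | zero => exact ⟨Fin.elim0, by rw [Finset.univ_eq_empty, Finset.prod_empty, (hp.natDegree_eq_zero.mp hn)]⟩
  | succ n ih =>
    obtain ⟨a, ha⟩ := IsAlgClosed.exists_root p (by
      rw [Polynomial.degree_eq_natDegree hp.ne_zero, hn]; exact_mod_cast Nat.succ_ne_zero n)
    obtain ⟨q, rfl⟩ := Polynomial.dvd_iff_isRoot.mpr ha
    have hq : q.Monic := Polynomial.Monic.of_mul_monic_left (Polynomial.monic_X_sub_C a) hp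
    have hd := (Polynomial.monic_X_sub_C a).natDegree_mul hq
    rw [hn, Polynomial.natDegree_X_sub_C] at hd
    obtain ⟨y, hy⟩ := ih q hq (by omega)
    refine ⟨Fin.cons a y, ?_⟩
    rw [Fin.prod_univ_succ]
    simp only [Fin.cons_zero, Fin.cons_succ, hy]

lemma exists_prod_X_sub_C_eq_sum (n : ℕ) (a : ℕ → ℂ) (ha : a 0 = 1) :
    ∃ y : Fin n → ℂ, ∏ j, (Polynomial.X - Polynomial.C (y j)) =
      ∑ i ∈ Finset.range (n + 1), Polynomial.C (a i) * Polynomial.X ^ (n - i) := by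
  set p := ∑ i ∈ Finset.range (n + 1), Polynomial.C (a i) * Polynomial.X ^ (n - i) with hp
  have h1 : p.natDegree ≤ n := Polynomial.natDegree_sum_le_of_forall_le _ _ fun i _ =>
    (Polynomial.natDegree_C_mul_X_pow_le _ _).trans (Nat.sub_le _ _)
  have h2 : p.coeff n = 1 := by
    rw [← ha, hp]; exact coeff_sum_C_mul_X_pow_sub n a (Nat.zero_le n)
  refine exists_prod_X_sub_C n p (Polynomial.monic_of_natDegree_le_of_coeff_eq_one n h1 h2) ?_
  exact le_antisymm h1 (Polynomial.le_natDegree_of_ne_zero (by rw [h2]; exact one_ne_zero))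

lemma sum_mul_bcoef {m : ℕ} (hm : 0 < m) (r : ℕ) :
    ((m : ℝ) + 1) * ∑ i ∈ Finset.range (r + 1), i * bcoef m i = m * r * (r + 1) * bcoef m (r + 1) := by
  have h0 : (m : ℝ) ≠ 0 := by positivity
  induction r with
  | zero => simp
  | succ r ih =>
    have h := bcoef_succ m (r + 1)
    rw [Finset.sum_range_succ, mul_add, ih]
    push_cast at h ⊢
    have h2 : (m : ℝ) * ((m : ℝ)⁻¹ + (r + 1)) = 1 + m * (r + 1) := by field_simp
    linear_combination (-(m : ℝ) * (r + 1)) * h - (r + 1 : ℝ) * bcoef m (r + 1) * h2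

lemma sum_mul_sub_bcoef {m : ℕ} (hm : 0 < m) (r : ℕ) :
    (2 * (m : ℝ) + 1) * ∑ i ∈ Finset.range (r + 1), i * bcoef m i * ((r : ℝ) - i) =
      m * ((r : ℝ) - 1) * ∑ i ∈ Finset.range (r + 1), i * bcoef m i := by
  induction r with
  | zero => simp
  | succ r ih =>
    have h := sum_mul_bcoef hm r
    have h1 : ∑ i ∈ Finset.range (r + 1 + 1), i * bcoef m i * (((r + 1 : ℕ) : ℝ) - i) =
        ∑ i ∈ Finset.range (r + 1), i * bcoef m i * ((r : ℝ) - i) +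
        ∑ i ∈ Finset.range (r + 1), i * bcoef m i := by
      rw [Finset.sum_range_succ, sub_self, mul_zero, add_zero, ← Finset.sum_add_distrib]
      exact Finset.sum_congr rfl fun i _ => by push_cast; ring
    rw [h1, Finset.sum_range_succ (n := r + 1)]
    push_cast
    linear_combination ih + h

/-- The power sums vanish once the elementary symmetric functions take the critical values. -/
lemma powerSums_of_esymm {r m : ℕ} (hm : 0 < m) (y : Fin r → ℂ)
    (he : ∀ k ≤ r, aeval y (esymm (Fin r) ℂ k) = (-1) ^ k * (bcoef m k : ℝ)) :
    ∀ i, 1 ≤ i → i ≤ r → (m : ℂ) * ∑ j, y j ^ i + 1 = 0 := by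
  intro k
  induction k using Nat.strong_induction_on with
  | _ k ih =>
    intro h1k hk
    have h1 := congrArg (aeval y) (mul_esymm_eq_sum (Fin r) ℂ k)
    have hp : ∀ i, aeval y (psum (Fin r) ℂ i) = ∑ j, y j ^ i := fun i => by simp [psum]
    rw [map_mul, map_natCast, he k hk, map_mul, map_sum, Finset.sum_filter,
      Finset.Nat.sum_antidiagonal_eq_sum_range_succ_mk,
      Finset.sum_range_succ, if_neg (lt_irrefl k), add_zero, map_pow, map_neg, map_one] at h1
    have h2 : ∀ i ∈ Finset.range k, (m : ℂ) * (if i < k then aeval y ((-1) ^ i * esymm (Fin r) ℂ i *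
        psum (Fin r) ℂ (k - i)) else 0) =
        (if i = 0 then (m : ℂ) * ∑ j, y j ^ k + 1 else 0) - (bcoef m i : ℝ) := by
      intro i hi
      have hik := Finset.mem_range.mp hi
      rw [if_pos hik, map_mul, map_mul, he i (by omega), hp, map_pow, map_neg, map_one,
        show ((-1 : ℂ) ^ i) * ((-1) ^ i * (bcoef m i : ℝ)) = (bcoef m i : ℝ) by
          rw [← mul_assoc, ← mul_pow, neg_one_mul, neg_neg, one_pow, one_mul]]
      rcases Nat.eq_zero_or_pos i with rfl | h0
      · rw [if_pos rfl, bcoef_zero, Nat.sub_zero, Complex.ofReal_one]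
        ring
      · rw [if_neg h0.ne']
        linear_combination (bcoef m i : ℂ) * ih (k - i) (by omega) (by omega) (by omega)
    have h3 := Finset.sum_congr rfl h2
    have h4 := congrArg (fun t : ℝ => (t : ℂ)) (sum_bcoef hm k)
    simp only [Complex.ofReal_sum, Complex.ofReal_mul, Complex.ofReal_natCast] at h4
    rw [← Finset.mul_sum, Finset.sum_sub_distrib, Finset.sum_ite_eq',
      if_pos (Finset.mem_range.mpr h1k), h4] at h3
    have h6 : ((-1 : ℂ) ^ k) * (-1) ^ k = 1 := by rw [← mul_pow]; norm_num
    rw [pow_succ] at h1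
    simp only [] at h1
    generalize (∑ x ∈ Finset.range k, if x < k then (aeval y) ((-1) ^ x * esymm (Fin r) ℂ x *
      psum (Fin r) ℂ (k - x)) else 0) = T at h1 h3
    linear_combination (-1 : ℂ) ^ k * m * h1 - h3 - (m * T + m * k * (bcoef m k : ℂ)) * h6

end SpecialPoints

section SymmetricSpan

variable {r : ℕ}

lemma esymm_hom (n k : ℕ) : (esymm (Fin n) ℂ k).IsHomogeneous k := by
  refine IsHomogeneous.sum _ _ _ fun t ht => ?_
  rw [← (Finset.mem_powersetCard.mp ht).2, Finset.card_eq_sum_ones]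
  exact IsHomogeneous.prod _ _ _ fun i _ => isHomogeneous_X _ _

/-- The elementary symmetric polynomials in the `y_j`, together with `z`. -/
def esub (r : ℕ) : Fin r ⊕ Unit → Rr1 r :=
  Sum.elim (fun i => rename Sum.inl (esymm (Fin r) ℂ (i + 1))) fun u => X (Sum.inr u)

/-- The degrees of the polynomials `esub`. -/
def ewt (r : ℕ) : Fin r ⊕ Unit → ℕ := Sum.elim (fun i => i + 1) fun _ => 1

lemma esub_hom (s : Fin r ⊕ Unit) : (esub r s).IsHomogeneous (ewt r s) := by
  rcases s with i | u
  · exact (esymm_hom r _).rename_isHomogeneous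
  · exact isHomogeneous_X _ _

lemma exists_aeval_esub {h : Rr1 r}
    (hs : ∀ τ : Equiv.Perm (Fin r), rename (Sum.map τ id) h = h) : ∃ F : Rr1 r, aeval (esub r) F = h := by
  let A := MvPolynomial Unit ℂ
  let φ := sumAlgEquiv ℂ (Fin r) Unit
  have h1 : ∀ (τ : Equiv.Perm (Fin r)) (g : Rr1 r), φ (rename (Sum.map τ id) g) = rename τ (φ g) := by
    intro τ g
    have : φ.toAlgHom.comp (rename (Sum.map τ id)) =
        ((rename (R := A) τ).restrictScalars ℂ).comp φ.toAlgHom := by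
      refine algHom_ext fun s => ?_
      rcases s with s | s <;> simp [φ]
    exact DFunLike.congr_fun this g
  have h2 : (φ h).IsSymmetric := fun τ => by rw [← h1, hs]
  obtain ⟨F, hF⟩ := esymmAlgHom_surjective (R := A) (σ := Fin r) (n := r) (by simp) ⟨φ h, h2⟩
  refine ⟨φ.symm F, φ.injective ?_⟩
  have h3 : φ.toAlgHom.comp (aeval (esub r)) =
      (((symmetricSubalgebra (Fin r) A).val.comp (esymmAlgHom (Fin r) A r)).restrictScalars ℂ).comp φ.toAlgHom := by
    refine algHom_ext fun s => ?_
    rcases s with s | s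
    · have h5 := DFunLike.congr_fun (sumAlgEquiv_comp_rename_inl ℂ (Fin r) Unit)
        (esymm (Fin r) ℂ (s + 1))
      have h6 : φ (rename Sum.inl (esymm (Fin r) ℂ (s + 1))) = esymm (Fin r) A (s + 1) := by
        refine h5.trans ?_
        exact map_esymm (σ := Fin r) (R := ℂ) (n := s + 1) (f := algebraMap ℂ A)
      simp [φ, esub, esymmAlgHom] at h6 ⊢
      exact h6
    · simp [φ, esub]
  have h4 := DFunLike.congr_fun h3 (φ.symm F)
  change φ (aeval (esub r) (φ.symm F)) = ((esymmAlgHom (Fin r) A r) (φ (φ.symm F)) : _) at h4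
  rw [h4, AlgEquiv.apply_symm_apply, hF]

lemma mem_span_esub {h : Rr1 r} {n : ℕ} (hn : h.IsHomogeneous n)
    (hs : ∀ τ : Equiv.Perm (Fin r), rename (Sum.map τ id) h = h) :
    h ∈ Submodule.span ℂ {f | ∃ d : Fin r ⊕ Unit → ℕ, ∑ s, ewt r s * d s = n ∧
      f = ∏ s, esub r s ^ d s} := by
  obtain ⟨F, rfl⟩ := exists_aeval_esub hs
  rw [← (homogeneousComponent_of_mem hn).trans (if_pos rfl), aeval_def, eval₂_eq', map_sum]
  refine Submodule.sum_mem _ fun d _ => ?_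
  rw [← Algebra.smul_def, map_smul]
  refine Submodule.smul_mem _ _ ?_
  have hd : (∏ s, esub r s ^ d s).IsHomogeneous (∑ s, ewt r s * d s) :=
    IsHomogeneous.prod _ _ _ fun s _ => (esub_hom s).pow _
  rw [homogeneousComponent_of_mem hd]
  split_ifs with hdn
  · exact Submodule.subset_span ⟨d, hdn.symm, rfl⟩
  · exact Submodule.zero_mem _

end SymmetricSpan

section DualNumbers

lemma dual_snd_mul (x y : DualNumber ℂ) :
    (x * y).snd = x.fst * y.snd + y.fst * x.snd := by
  rw [TrivSqZeroExt.snd_mul, smul_eq_mul, op_smul_eq_smul, smul_eq_mul]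

lemma dual_fst_C_mul (c : ℂ) (x : DualNumber ℂ) : (algebraMap ℂ _ c * x).fst = c * x.fst := by
  rw [TrivSqZeroExt.fst_mul]; rfl

lemma dual_snd_C_mul (c : ℂ) (x : DualNumber ℂ) : (algebraMap ℂ _ c * x).snd = c * x.snd := by
  rw [dual_snd_mul]
  have h1 : (algebraMap ℂ (DualNumber ℂ) c).snd = 0 := rfl
  have h2 : (algebraMap ℂ (DualNumber ℂ) c).fst = c := rfl
  rw [h1, h2, mul_zero, add_zero]

lemma dual_fst_one_add_pow (a : ℂ) (n : ℕ) :
    ((1 + TrivSqZeroExt.inr a : DualNumber ℂ) ^ n).fst = 1 := by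
  simp

lemma dual_snd_one_add_pow (a : ℂ) (n : ℕ) :
    ((1 + TrivSqZeroExt.inr a : DualNumber ℂ) ^ n).snd = n * a := by
  induction n with
  | zero => simp
  | succ n ih =>
    rw [pow_succ, dual_snd_mul, ih, dual_fst_one_add_pow]
    simp
    ring

/-- Evaluation at dual numbers computes a directional derivative. -/
lemma dual_aeval {σ : Type*} [Fintype σ] (V : σ → DualNumber ℂ) (f : MvPolynomial σ ℂ) :
    (aeval V f).fst = eval (fun s => (V s).fst) f ∧
      (aeval V f).snd = ∑ s, (V s).snd * eval (fun s => (V s).fst) (pderiv s f) := by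
  classical
  induction f using MvPolynomial.induction_on with
  | C a =>
    refine ⟨?_, ?_⟩
    · rw [aeval_C, eval_C]; rfl
    · rw [aeval_C]
      simp only [pderiv_C, map_zero, mul_zero, Finset.sum_const_zero]
      rfl
  | add p q hp hq =>
    refine ⟨?_, ?_⟩
    · rw [map_add, map_add, TrivSqZeroExt.fst_add, hp.1, hq.1]
    · rw [map_add, TrivSqZeroExt.snd_add, hp.2, hq.2, ← Finset.sum_add_distrib]
      exact Finset.sum_congr rfl fun s _ => by rw [map_add, map_add, mul_add]
  | mul_X p i hp =>
    refine ⟨?_, ?_⟩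
    · rw [map_mul, map_mul, aeval_X, eval_X, TrivSqZeroExt.fst_mul, hp.1]
    · rw [map_mul, aeval_X, dual_snd_mul, hp.2, hp.1, Finset.mul_sum]
      have : ∀ s, (V s).snd * eval (fun s => (V s).fst) (pderiv s (p * X i)) =
          (V i).fst * ((V s).snd * eval (fun s => (V s).fst) (pderiv s p)) +
          if s = i then eval (fun s => (V s).fst) p * (V s).snd else 0 := by
        intro s
        rw [Derivation.leibniz, smul_eq_mul, smul_eq_mul, map_add, map_mul, map_mul, eval_X]
        split_ifs with h
        · subst h
          rw [pderiv_X_self, map_one]; ring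
        · rw [pderiv_X_of_ne (Ne.symm h), map_zero]; ring
      rw [Finset.sum_congr rfl fun s _ => this s, Finset.sum_add_distrib, Finset.sum_ite_eq',
        if_pos (Finset.mem_univ i), add_comm]

lemma dual_symmetric_identity {s : ℕ} (c : ℕ → ℂ) (G : ℂ) (V : Fin (s + 1) ⊕ Unit → DualNumber ℂ)
    (v : Fin (s + 1) ⊕ Unit → ℂ)
    (hV : ∀ i : Fin s, aeval V (esub (s + 1) (Sum.inl i.castSucc)) =
      algebraMap ℂ _ (c (i + 1)) * (1 + TrivSqZeroExt.inr 1) ^ (i + 1 : ℕ))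
    (hVl : aeval V (esub (s + 1) (Sum.inl (Fin.last s))) =
      algebraMap ℂ _ (c (s + 1)) * (1 + TrivSqZeroExt.inr 1) ^ (s + 1) - algebraMap ℂ _ G)
    (hVz : V (Sum.inr ()) = 1 + TrivSqZeroExt.inr 1)
    (hv : ∀ i : Fin (s + 1), eval v (esub (s + 1) (Sum.inl i)) = c (i + 1))
    (hvz : v (Sum.inr ()) = 1) {h : Rr1 (s + 1)} (hh : h.IsHomogeneous (2 * s + 1))
    (hs : ∀ τ : Equiv.Perm (Fin (s + 1)), rename (Sum.map τ id) h = h) :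
    (aeval V h).snd = s * (aeval V h).fst + (s + 1) * eval v h := by
  refine Submodule.span_induction ?_ ?_ ?_ ?_ (mem_span_esub hh hs)
  · rintro _ ⟨d, hd, rfl⟩
    have hVz' : aeval V (esub (s + 1) (Sum.inr ())) = 1 + TrivSqZeroExt.inr 1 := by
      rw [esub, Sum.elim_inr, aeval_X, hVz]
    have hvz' : eval v (esub (s + 1) (Sum.inr ())) = 1 := by
      rw [esub, Sum.elim_inr, eval_X, hvz]
    rw [Fintype.sum_sum_type, Fin.sum_univ_castSucc, Fintype.sum_unique (ι := Unit)] at hd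
    simp only [ewt, Sum.elim_inl, Sum.elim_inr, Fin.val_castSucc, Fin.val_last, one_mul] at hd
    have e0 : (default : Unit) = () := rfl
    rw [e0] at hd
    have e1 : aeval V (∏ t, esub (s + 1) t ^ d t) =
        algebraMap ℂ _ (∏ i : Fin s, c (i + 1) ^ d (Sum.inl i.castSucc)) *
          ((algebraMap ℂ _ (c (s + 1)) * (1 + TrivSqZeroExt.inr 1) ^ (s + 1) - algebraMap ℂ _ G) ^
            d (Sum.inl (Fin.last s)) * (1 + TrivSqZeroExt.inr 1) ^
          (∑ i : Fin s, (i + 1 : ℕ) * d (Sum.inl i.castSucc) + d (Sum.inr ()))) := by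
      rw [map_prod, Fintype.prod_sum_type, Fin.prod_univ_castSucc, Fintype.prod_unique (ι := Unit),
        map_pow, hVl, map_pow, e0, hVz', map_prod, pow_add _ (∑ i : Fin s, _),
        ← Finset.prod_pow_eq_pow_sum]
      have : ∀ i : Fin s, aeval V (esub (s + 1) (Sum.inl i.castSucc) ^ d (Sum.inl i.castSucc)) =
          algebraMap ℂ _ (c (i + 1) ^ d (Sum.inl i.castSucc)) *
            (1 + TrivSqZeroExt.inr 1) ^ ((i + 1 : ℕ) * d (Sum.inl i.castSucc)) := fun i => by
        rw [map_pow, hV, mul_pow, ← pow_mul, map_pow]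
      rw [Finset.prod_congr rfl fun i _ => this i, Finset.prod_mul_distrib]
      ring
    have e2 : eval v (∏ t, esub (s + 1) t ^ d t) =
        (∏ i : Fin s, c (i + 1) ^ d (Sum.inl i.castSucc)) * c (s + 1) ^ d (Sum.inl (Fin.last s)) := by
      rw [map_prod, Fintype.prod_sum_type, Fin.prod_univ_castSucc, Fintype.prod_unique (ι := Unit),
        map_pow, hv, map_pow, e0, hvz', one_pow, mul_one]
      congr 1
      exact Finset.prod_congr rfl fun i _ => by rw [map_pow, hv]; rfl
    rw [e1, e2, dual_snd_C_mul, dual_fst_C_mul]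
    have hb : d (Sum.inl (Fin.last s)) < 2 := by
      by_contra! hb
      have := Nat.mul_le_mul_left (s + 1) hb
      omega
    generalize (∏ i : Fin s, c (i + 1) ^ d (Sum.inl i.castSucc)) = K
    generalize (∑ i : Fin s, (i + 1 : ℕ) * d (Sum.inl i.castSucc)) = W at hd ⊢
    generalize d (Sum.inl (Fin.last s)) = b at hd hb ⊢
    have h3 : b = 0 ∨ b = 1 := by omega
    rcases h3 with rfl | rfl
    · have hW : W + d (Sum.inr ()) = 2 * s + 1 := by omega
      rw [hW, pow_zero, pow_zero, one_mul, dual_snd_one_add_pow, dual_fst_one_add_pow]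
      push_cast
      ring
    · have hW : W + d (Sum.inr ()) = s := by omega
      rw [hW, pow_one, pow_one, dual_snd_mul, TrivSqZeroExt.fst_mul, dual_snd_one_add_pow,
        dual_fst_one_add_pow, TrivSqZeroExt.fst_sub, TrivSqZeroExt.snd_sub, dual_fst_C_mul,
        dual_snd_C_mul, dual_snd_one_add_pow, dual_fst_one_add_pow]
      have h1 : (algebraMap ℂ (DualNumber ℂ) G).snd = 0 := rfl
      have h2 : (algebraMap ℂ (DualNumber ℂ) G).fst = G := rfl
      rw [h1, h2]
      push_cast
      ring
  · simp
  · intro x y _ _ hx hy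
    rw [map_add, map_add, TrivSqZeroExt.snd_add, TrivSqZeroExt.fst_add, hx, hy]; ring
  · intro a x _ hx
    rw [map_smul, TrivSqZeroExt.snd_smul, TrivSqZeroExt.fst_smul, hx, smul_eval, smul_eq_mul, smul_eq_mul]
    ring

end DualNumbers

section CriticalPoint

/-- The Vandermonde product of the variables `y_j`. -/
def vdm (r : ℕ) : Rr1 r := ∏ i : Fin r, ∏ j ∈ Finset.Ioi i, yy j i

/-- The product of the `y_k - y_0`. -/
def vdmHead (s : ℕ) : Rr1 (s + 1) := ∏ k : Fin s, yy k.succ 0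

/-- The factors of the Vandermonde product not involving `y_0`. -/
def vdmTail (s : ℕ) : Rr1 (s + 1) := ∏ i : Fin s, ∏ j ∈ Finset.Ioi i, yy j.succ i.succ

lemma vdm_succ (s : ℕ) : vdm (s + 1) = vdmHead s * vdmTail s := by
  rw [vdm, Fin.prod_univ_succ, Fin.prod_Ioi_zero, vdmHead, vdmTail]
  congr 1
  exact Finset.prod_congr rfl fun i _ => Fin.prod_Ioi_succ (fun j => yy j i.succ) i

lemma derivation_prod_eq_zero {ι A : Type*} [CommRing A] [Algebra ℂ A] (D : Derivation ℂ A A)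
    (t : Finset ι) (f : ι → A) (h : ∀ i ∈ t, D (f i) = 0) : D (∏ i ∈ t, f i) = 0 := by
  classical
  induction t using Finset.induction_on with
  | empty => simp
  | insert a t ha ih =>
    rw [Finset.prod_insert ha, Derivation.leibniz, h a (Finset.mem_insert_self a t),
      ih fun i hi => h i (Finset.mem_insert_of_mem hi), smul_zero, smul_zero, add_zero]

lemma grad_vdmTail (s m : ℕ) : grad (gw (s + 1) m) (yz 0) (vdmTail s) = 0 := by
  refine derivation_prod_eq_zero _ _ _ fun i _ => derivation_prod_eq_zero _ _ _ fun j _ => ?_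
  rw [grad_yz, yy]
  simp [pderiv_X, Fin.succ_ne_zero]

lemma not_yz_dvd_vdmTail (s : ℕ) : ¬ yz 0 ∣ vdmTail s :=
  not_dvd_prod_of_prime (prime_yz 0) fun i _ => not_dvd_prod_of_prime (prime_yz 0) fun j hj =>
    not_X_sub_X_dvd (by simpa using (Finset.mem_Ioi.mp hj).ne') (Or.inl (by simp [Fin.succ_ne_zero]))

lemma not_yz_dvd_vdmHead (s : ℕ) : ¬ yz 0 ∣ vdmHead s :=
  not_dvd_prod_of_prime (prime_yz 0) fun i _ =>
    not_X_sub_X_dvd (by simp [Fin.succ_ne_zero]) (Or.inl (by simp [Fin.succ_ne_zero]))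

lemma yz_dvd_of_vdm {s m N : ℕ} {h : Rr1 (s + 1)}
    (hq : yz 0 ∣ grad (gw (s + 1) m) (yz 0) (vdm (s + 1) ^ (N + 1) * h)) :
    yz 0 ∣ vdmHead s * grad (gw (s + 1) m) (yz 0) h +
      ((N + 1 : ℕ) : Rr1 (s + 1)) * h * grad (gw (s + 1) m) (yz 0) (vdmHead s) := by
  rw [Derivation.leibniz, Derivation.leibniz_pow, vdm_succ, Derivation.leibniz, grad_vdmTail,
    smul_zero, zero_add] at hq
  simp only [smul_eq_mul, nsmul_eq_mul, Nat.add_sub_cancel] at hq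
  have e : (vdmHead s * vdmTail s) ^ (N + 1) * grad (gw (s + 1) m) (yz 0) h +
      h * (((N + 1 : ℕ) : Rr1 (s + 1)) * ((vdmHead s * vdmTail s) ^ N *
        (vdmTail s * grad (gw (s + 1) m) (yz 0) (vdmHead s)))) =
      (vdmHead s ^ N * vdmTail s ^ (N + 1)) * (vdmHead s * grad (gw (s + 1) m) (yz 0) h +
        ((N + 1 : ℕ) : Rr1 (s + 1)) * h * grad (gw (s + 1) m) (yz 0) (vdmHead s)) := by
    ring
  rw [e] at hq
  rcases (prime_yz 0).dvd_or_dvd hq with h1 | h1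
  · rcases (prime_yz 0).dvd_or_dvd h1 with h2 | h2
    · exact absurd ((prime_yz 0).dvd_of_dvd_pow h2) (not_yz_dvd_vdmHead s)
    · exact absurd ((prime_yz 0).dvd_of_dvd_pow h2) (not_yz_dvd_vdmTail s)
  · exact h1

/-- The tangent vector `ε (∂_z - m⁻¹ ∂_{y_0})` at the point `(1, y, 1)`. -/
def tvec (m : ℕ) {s : ℕ} (y : Fin s → ℂ) : Fin (s + 1) ⊕ Unit → DualNumber ℂ :=
  Sum.elim (Fin.cons (1 + TrivSqZeroExt.inr (-(m : ℂ)⁻¹)) fun k => algebraMap ℂ _ (y k))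
    fun _ => 1 + TrivSqZeroExt.inr 1

lemma eval_grad_yz_tvec {m : ℕ} (hm : 0 < m) {s : ℕ} (y : Fin s → ℂ) (f : Rr1 (s + 1)) :
    eval (fun t => (tvec m y t).fst) (grad (gw (s + 1) m) (yz 0) f) = -(m * (aeval (tvec m y) f).snd) := by
  have h0 : (m : ℂ) ≠ 0 := Nat.cast_ne_zero.mpr hm.ne'
  rw [grad_yz, (dual_aeval (tvec m y) f).2, Fintype.sum_sum_type, Fin.sum_univ_succ,
    Fintype.sum_unique (ι := Unit)]
  have h1 : (tvec m y (Sum.inl 0)).snd = -(m : ℂ)⁻¹ := by simp [tvec]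
  have h2 : ∀ k : Fin s, (tvec m y (Sum.inl k.succ)).snd = 0 := fun k => rfl
  have h3 : (tvec m y (Sum.inr default)).snd = 1 := by simp [tvec]
  simp only [h1, h2, h3, zero_mul, Finset.sum_const_zero, map_neg, map_sub, map_mul, eval_C]
  have e0 : (default : Unit) = () := rfl
  rw [e0]
  field_simp
  ring

lemma tvec_first_order {m : ℕ} (hm : 0 < m) {s N : ℕ} (y : Fin s → ℂ) {h : Rr1 (s + 1)}
    (hq : yz 0 ∣ grad (gw (s + 1) m) (yz 0) (vdm (s + 1) ^ (N + 1) * h)) :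
    (aeval (tvec m y) (vdmHead s)).fst * (aeval (tvec m y) h).snd +
      ((N + 1 : ℕ) : ℂ) * (aeval (tvec m y) h).fst * (aeval (tvec m y) (vdmHead s)).snd = 0 := by
  have h0 : (m : ℂ) ≠ 0 := Nat.cast_ne_zero.mpr hm.ne'
  obtain ⟨g, hg⟩ := yz_dvd_of_vdm hq
  have h1 := congrArg (eval (fun t => (tvec m y t).fst)) hg
  have h2 : eval (fun t => (tvec m y t).fst) (yz 0 : Rr1 (s + 1)) = 0 := by
    rw [yz, map_sub, eval_X, eval_X]
    simp [tvec]
  rw [map_mul, h2, zero_mul, map_add, map_mul, map_mul, map_mul, map_natCast, eval_grad_yz_tvec hm,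
    eval_grad_yz_tvec hm, ← (dual_aeval (tvec m y) _).1, ← (dual_aeval (tvec m y) _).1] at h1
  refine mul_left_cancel₀ h0 ?_
  linear_combination -h1

end CriticalPoint

section CriticalValues

variable {s m : ℕ}

lemma aeval_esub_inl {A : Type*} [CommRing A] [Algebra ℂ A] {r : ℕ} (V : Fin r ⊕ Unit → A) (i : Fin r) :
    aeval V (esub r (Sum.inl i)) =
      (-1) ^ (i + 1 : ℕ) * (∏ j, (Polynomial.X - Polynomial.C (V (Sum.inl j)))).coeff (r - (i + 1)) := by
  rw [esub, Sum.elim_inl, aeval_rename, aeval_esymm_eq_coeff _ i.2]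
  rfl

/-- The coefficients of the polynomial whose roots are `y_1, ..., y_s`. -/
def qcoef (m i : ℕ) : ℂ := m * ((i + 1 : ℕ) * bcoef m (i + 1) : ℝ)

lemma qcoef_succ_sub (hm : 0 < m) (i : ℕ) :
    qcoef m (i + 1) - qcoef m i = (bcoef m (i + 1) : ℝ) := by
  have h0 : (m : ℂ) ≠ 0 := Nat.cast_ne_zero.mpr hm.ne'
  have h := congrArg (fun t : ℝ => (t : ℂ)) (bcoef_succ m (i + 1))
  simp only [qcoef]
  push_cast at h ⊢
  rw [h]
  field_simp
  ring

variable {y : Fin s → ℂ} (hy : ∏ j, (Polynomial.X - Polynomial.C (y j)) =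
  ∑ i ∈ Finset.range (s + 1), Polynomial.C (qcoef m i) * Polynomial.X ^ (s - i))

include hy

lemma prod_tvec :
    (∏ j, (Polynomial.X - Polynomial.C (tvec m y (Sum.inl j)))) =
      (∑ i ∈ Finset.range (s + 1), Polynomial.C (algebraMap ℂ (DualNumber ℂ) (qcoef m i)) *
        Polynomial.X ^ (s - i)) * (Polynomial.X - Polynomial.C (1 + TrivSqZeroExt.inr (-(m : ℂ)⁻¹))) := by
  have h := congrArg (Polynomial.map (algebraMap ℂ (DualNumber ℂ))) hy
  simp only [Polynomial.map_prod, Polynomial.map_sum, Polynomial.map_sub, Polynomial.map_mul,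
    Polynomial.map_pow, Polynomial.map_C, Polynomial.map_X] at h
  rw [Fin.prod_univ_succ, ← h]
  exact (mul_comm (G := Polynomial (DualNumber ℂ)) _ _).trans rfl

lemma aeval_tvec_castSucc (hm : 0 < m) (i : Fin s) :
    aeval (tvec m y) (esub (s + 1) (Sum.inl i.castSucc)) =
      algebraMap ℂ _ ((-1) ^ (i + 1 : ℕ) * (bcoef m (i + 1) : ℝ)) *
        (1 + TrivSqZeroExt.inr 1) ^ (i + 1 : ℕ) := by
  have h0 : (m : ℂ) ≠ 0 := Nat.cast_ne_zero.mpr hm.ne'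
  have e1 : s + 1 - (i + 1) = (s - (i + 1)) + 1 := by omega
  have e2 : s - (i + 1) + 1 = s - i := by omega
  rw [aeval_esub_inl, prod_tvec hy, Fin.val_castSucc, e1, Polynomial.coeff_mul_X_sub_C,
    coeff_sum_C_mul_X_pow_sub s _ i.2, e2, coeff_sum_C_mul_X_pow_sub s _ i.2.le, map_mul, map_pow,
    map_neg, map_one, mul_assoc]
  refine congrArg (fun t : DualNumber ℂ => (-1) ^ (i + 1 : ℕ) * t) ?_
  have h := qcoef_succ_sub hm i
  refine TrivSqZeroExt.ext ?_ ?_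
  · rw [dual_fst_C_mul, dual_fst_one_add_pow, ← h, TrivSqZeroExt.fst_sub, dual_fst_C_mul]
    simp [TrivSqZeroExt.algebraMap_eq_inl]
  · rw [dual_snd_C_mul, dual_snd_one_add_pow, TrivSqZeroExt.snd_sub, dual_snd_C_mul]
    simp [TrivSqZeroExt.algebraMap_eq_inl, qcoef]
    field_simp

lemma aeval_tvec_last (hm : 0 < m) :
    aeval (tvec m y) (esub (s + 1) (Sum.inl (Fin.last s))) =
      algebraMap ℂ _ ((-1) ^ (s + 1) * (bcoef m (s + 1) : ℝ)) * (1 + TrivSqZeroExt.inr 1) ^ (s + 1) -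
        algebraMap ℂ _ ((-1) ^ (s + 1) * (((bcoef m (s + 1) : ℝ) : ℂ) + qcoef m s)) := by
  have h0 : (m : ℂ) ≠ 0 := Nat.cast_ne_zero.mpr hm.ne'
  rw [aeval_esub_inl, prod_tvec hy, Fin.val_last, Nat.sub_self, Polynomial.mul_coeff_zero,
    ← Nat.sub_self s, coeff_sum_C_mul_X_pow_sub s _ le_rfl, map_mul, map_mul, map_pow,
    map_neg, map_one, mul_assoc, ← mul_sub]
  refine congrArg (fun t : DualNumber ℂ => (-1) ^ (s + 1 : ℕ) * t) ?_
  refine TrivSqZeroExt.ext ?_ ?_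
  · rw [TrivSqZeroExt.fst_sub, dual_fst_C_mul, dual_fst_C_mul, dual_fst_one_add_pow]
    simp [TrivSqZeroExt.algebraMap_eq_inl]
  · rw [TrivSqZeroExt.snd_sub, dual_snd_C_mul, dual_snd_C_mul, dual_snd_one_add_pow]
    simp [TrivSqZeroExt.algebraMap_eq_inl, qcoef]
    field_simp

lemma aeval_tvec_vdmHead :
    aeval (tvec m y) (vdmHead s) = algebraMap ℂ _ ((-1) ^ s) * ∑ i ∈ Finset.range (s + 1),
      algebraMap ℂ _ (qcoef m i) * (1 + TrivSqZeroExt.inr (-(m : ℂ)⁻¹)) ^ (s - i) := by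
  have h := congrArg (Polynomial.aeval (1 + TrivSqZeroExt.inr (-(m : ℂ)⁻¹) : DualNumber ℂ)) hy
  simp only [map_prod, map_sum, map_sub, map_mul, map_pow, Polynomial.aeval_C, Polynomial.aeval_X] at h
  rw [← h, vdmHead, map_prod, map_pow, map_neg, map_one]
  have e : ∀ k : Fin s, aeval (tvec m y) (yy k.succ 0) =
      -1 * ((1 + TrivSqZeroExt.inr (-(m : ℂ)⁻¹) : DualNumber ℂ) - algebraMap ℂ _ (y k)) := fun k => by
    rw [yy, map_sub, aeval_X, aeval_X, neg_one_mul, neg_sub]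
    rfl
  rw [Finset.prod_congr rfl fun k _ => e k, Finset.prod_mul_distrib, Finset.prod_const,
    Finset.card_univ, Fintype.card_fin]

lemma eval_eq_zero_of_first_order_aux (hm : 0 < m) (v : Fin (s + 1) ⊕ Unit → ℂ)
    (hv : ∀ i : Fin (s + 1), eval v (esub (s + 1) (Sum.inl i)) = (-1) ^ (i + 1 : ℕ) * (bcoef m (i + 1) : ℝ))
    (hvz : v (Sum.inr ()) = 1) {h : Rr1 (s + 1)} (hh : h.IsHomogeneous (2 * s + 1))
    (hs : ∀ τ : Equiv.Perm (Fin (s + 1)), rename (Sum.map τ id) h = h)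
    (hq : yz 0 ∣ grad (gw (s + 1) m) (yz 0) (vdm (s + 1) ^ (2 * m + 1) * h)) : eval v h = 0 := by
  have h0 : (m : ℂ) ≠ 0 := Nat.cast_ne_zero.mpr hm.ne'
  have h1 := dual_symmetric_identity (fun k => (-1) ^ k * (bcoef m k : ℝ)) _ (tvec m y) v
    (aeval_tvec_castSucc hy hm) (aeval_tvec_last hy hm) rfl hv hvz hh hs
  have h2 := tvec_first_order hm y hq
  rw [aeval_tvec_vdmHead hy, dual_fst_C_mul, dual_snd_C_mul, TrivSqZeroExt.fst_sum,
    TrivSqZeroExt.snd_sum] at h2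
  simp only [dual_fst_C_mul, dual_snd_C_mul, dual_fst_one_add_pow, dual_snd_one_add_pow, mul_one] at h2
  have e1 : ∑ i ∈ Finset.range (s + 1), qcoef m i =
      ((m * ∑ i ∈ Finset.range (s + 1 + 1), i * bcoef m i : ℝ) : ℂ) := by
    rw [Finset.sum_range_succ' _ (s + 1), Nat.cast_zero, zero_mul, add_zero, Finset.mul_sum,
      Complex.ofReal_sum]
    refine Finset.sum_congr rfl fun i _ => ?_
    rw [qcoef]
    push_cast
    ring
  have e2 : ∑ i ∈ Finset.range (s + 1), qcoef m i * (((s - i : ℕ) : ℂ) * -(m : ℂ)⁻¹) =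
      ((-∑ i ∈ Finset.range (s + 1 + 1), i * bcoef m i * (((s + 1 : ℕ) : ℝ) - i) : ℝ) : ℂ) := by
    rw [Finset.sum_range_succ' _ (s + 1), Nat.cast_zero, zero_mul, zero_mul, add_zero,
      ← Finset.sum_neg_distrib, Complex.ofReal_sum]
    refine Finset.sum_congr rfl fun i hi => ?_
    rw [qcoef, Nat.cast_sub (Nat.lt_succ_iff.mp (Finset.mem_range.mp hi))]
    push_cast
    field_simp
    ring
  have e3 := sum_mul_sub_bcoef hm (s + 1)
  have e4 := sum_mul_bcoef hm (s + 1)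
  rw [e1, e2] at h2
  generalize ∑ i ∈ Finset.range (s + 1 + 1), i * bcoef m i * (((s + 1 : ℕ) : ℝ) - i) = A at e3 h2
  have e5 : ∑ i ∈ Finset.range (s + 1 + 1), i * bcoef m i ≠ 0 := by
    intro h
    rw [h, mul_zero] at e4
    have := bcoef_pos hm (s + 1 + 1)
    have : 0 < (m : ℝ) * ((s + 1 : ℕ) : ℝ) * (((s + 1 : ℕ) : ℝ) + 1) * bcoef m (s + 1 + 1) := by
      positivity
    exact this.ne e4
  generalize ∑ i ∈ Finset.range (s + 1 + 1), i * bcoef m i = B at e3 e5 h2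
  have e6 := congrArg (fun t : ℝ => (t : ℂ)) e3
  have h6 : ((-1 : ℂ) ^ s) * (-1) ^ s = 1 := by rw [← mul_pow]; norm_num
  generalize (aeval (tvec m y) h).snd = a at h1 h2
  generalize (aeval (tvec m y) h).fst = b at h1 h2
  generalize (-1 : ℂ) ^ s = ε at h2 h6
  generalize eval v h = e at h1 ⊢
  have e7 : (m : ℂ) * B * (s + 1) ≠ 0 :=
    mul_ne_zero (mul_ne_zero h0 (Complex.ofReal_ne_zero.mpr e5)) (Nat.cast_add_one_ne_zero s)
  refine mul_left_cancel₀ e7 ?_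
  push_cast at h2 e6 ⊢
  linear_combination ε * h2 - (m : ℂ) * B * h1 + b * e6 - (m * B * a - b * (2 * m + 1) * A) * h6

omit hy in
lemma eval_eq_zero_of_first_order (hm : 0 < m) (v : Fin (s + 1) ⊕ Unit → ℂ)
    (hv : ∀ i : Fin (s + 1), eval v (esub (s + 1) (Sum.inl i)) = (-1) ^ (i + 1 : ℕ) * (bcoef m (i + 1) : ℝ))
    (hvz : v (Sum.inr ()) = 1) {h : Rr1 (s + 1)} (hh : h.IsHomogeneous (2 * s + 1))
    (hs : ∀ τ : Equiv.Perm (Fin (s + 1)), rename (Sum.map τ id) h = h)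
    (hq : yz 0 ∣ grad (gw (s + 1) m) (yz 0) (vdm (s + 1) ^ (2 * m + 1) * h)) : eval v h = 0 := by
  have h0 : (m : ℂ) ≠ 0 := Nat.cast_ne_zero.mpr hm.ne'
  obtain ⟨y, hy⟩ := exists_prod_X_sub_C_eq_sum s (qcoef m) (by simp [qcoef, bcoef, h0])
  exact eval_eq_zero_of_first_order_aux hy hm v hv hvz hh hs hq

end CriticalValues

section Alternation

variable {r m : ℕ}

lemma rename_perm_yy (τ : Equiv.Perm (Fin r)) (j k : Fin r) :
    rename (Sum.map τ id) (yy j k) = yy (τ j) (τ k) := by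
  rw [yy, map_sub, rename_X, rename_X]
  rfl

lemma rename_perm_yz (τ : Equiv.Perm (Fin r)) (j : Fin r) :
    rename (Sum.map τ id) (yz j) = yz (τ j) := by
  rw [yz, map_sub, rename_X, rename_X]
  rfl

lemma vdm_hom (r : ℕ) : (vdm r).IsHomogeneous (r * (r - 1) / 2) := by
  have h : (vdm r).IsHomogeneous (∑ i : Fin r, ∑ _j ∈ Finset.Ioi i, 1) :=
    IsHomogeneous.prod _ _ _ fun i _ => IsHomogeneous.prod _ _ _ fun j _ => yy_hom j i
  have e : ∑ i : Fin r, ∑ _j ∈ Finset.Ioi i, 1 = r * (r - 1) / 2 := by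
    simp only [Finset.sum_const, smul_eq_mul, mul_one, Fin.card_Ioi]
    rw [Fin.sum_univ_eq_sum_range (fun i => r - 1 - i) r, Finset.sum_range_reflect (fun i => i) r,
      Finset.sum_range_id]
  rwa [e] at h

lemma vdm_ne_zero (r : ℕ) : vdm r ≠ 0 :=
  Finset.prod_ne_zero_iff.mpr fun _ _ => Finset.prod_ne_zero_iff.mpr fun _ hj =>
    (prime_yy (Finset.mem_Ioi.mp hj).ne').ne_zero

lemma rename_perm_vdm (τ : Equiv.Perm (Fin r)) :
    rename (Sum.map τ id) (vdm r) = ((Equiv.Perm.sign τ : ℤ) : Rr1 r) * vdm r := by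
  have h : vdm r = (Matrix.vandermonde fun j : Fin r => (X (Sum.inl j) : Rr1 r)).det :=
    (Matrix.det_vandermonde _).symm
  rw [h, AlgHom.map_det, ← Matrix.det_permute]
  refine congrArg Matrix.det (Matrix.ext fun i j => ?_)
  simp [Matrix.vandermonde]

lemma perm_sign_mul_self (τ : Equiv.Perm (Fin r)) :
    ((Equiv.Perm.sign τ : ℤ) : Rr1 r) * ((Equiv.Perm.sign τ : ℤ) : Rr1 r) = 1 := by
  rw [← Int.cast_mul, ← Units.val_mul, Int.units_mul_self, Units.val_one, Int.cast_one]

lemma rename_perm_vdm_pow (τ : Equiv.Perm (Fin r)) (m : ℕ) :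
    rename (Sum.map τ id) (vdm r ^ (2 * m + 1)) =
      ((Equiv.Perm.sign τ : ℤ) : Rr1 r) * vdm r ^ (2 * m + 1) := by
  rw [map_pow, rename_perm_vdm, mul_pow, pow_succ _ (2 * m), pow_mul, pow_two, perm_sign_mul_self, one_pow,
    one_mul]

lemma prod_pow_dvd_of_prime {ι R : Type*} [CommRing R] [IsDomain R] (t : Finset ι) {p : ι → R} {z : R} (n : ℕ)
    (hp : ∀ i ∈ t, Prime (p i)) (hpp : ∀ i ∈ t, ∀ j ∈ t, i ≠ j → ¬ p i ∣ p j)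
    (h : ∀ i ∈ t, p i ^ n ∣ z) : (∏ i ∈ t, p i) ^ n ∣ z := by
  classical
  induction t using Finset.induction_on with
  | empty => simp
  | insert a t ha ih =>
    obtain ⟨w, rfl⟩ := ih (fun i hi => hp i (Finset.mem_insert_of_mem hi))
      (fun i hi j hj => hpp i (Finset.mem_insert_of_mem hi) j (Finset.mem_insert_of_mem hj))
      fun i hi => h i (Finset.mem_insert_of_mem hi)
    have h1 := hp a (Finset.mem_insert_self a t)
    rw [Finset.prod_insert ha, mul_pow, mul_comm]
    refine mul_dvd_mul_left _ (h1.pow_dvd_of_dvd_mul_left n ?_ (h a (Finset.mem_insert_self a t)))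
    refine not_dvd_pow_of_prime h1 (not_dvd_prod_of_prime h1 fun j hj => ?_) n
    exact hpp a (Finset.mem_insert_self a t) j (Finset.mem_insert_of_mem hj)
      fun e => ha (e ▸ hj)

lemma vdm_pow_dvd {z : Rr1 r} (n : ℕ) (h : ∀ j k : Fin r, j ≠ k → yy j k ^ n ∣ z) : vdm r ^ n ∣ z := by
  rw [vdm, Finset.prod_sigma']
  refine prod_pow_dvd_of_prime _ n (fun x hx => ?_) (fun x hx x' hx' hne => ?_) fun x hx => ?_
  · exact prime_yy (Finset.mem_Ioi.mp (Finset.mem_sigma.mp hx).2).ne'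
  · have h1 := Finset.mem_Ioi.mp (Finset.mem_sigma.mp hx).2
    have h2 := Finset.mem_Ioi.mp (Finset.mem_sigma.mp hx').2
    obtain ⟨i, j⟩ := x
    obtain ⟨i', j'⟩ := x'
    simp only at h1 h2
    refine not_X_sub_X_dvd (by simpa using h2.ne') ?_
    by_contra hcon
    have hn : ¬ (i = i' ∧ j = j') := by
      rintro ⟨rfl, rfl⟩
      exact hne rfl
    simp only [ne_eq, Sum.inl.injEq] at hcon
    omega
  · exact h _ _ (Finset.mem_Ioi.mp (Finset.mem_sigma.mp hx).2).ne'

/-- Antisymmetrization over the permutations of the `y_j`. -/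
def alt : Rr1 r →ₗ[ℂ] Rr1 r :=
  ∑ τ : Equiv.Perm (Fin r), LinearMap.mulLeft ℂ ((Equiv.Perm.sign τ : ℤ) : Rr1 r) ∘ₗ
    (rename (Sum.map τ id) : Rr1 r →ₐ[ℂ] Rr1 r).toLinearMap

lemma alt_apply (f : Rr1 r) :
    alt f = ∑ τ : Equiv.Perm (Fin r), ((Equiv.Perm.sign τ : ℤ) : Rr1 r) * rename (Sum.map τ id) f := by
  simp [alt, LinearMap.sum_apply]

lemma alt_mul_of_symm {p : Rr1 r} (hp : ∀ τ : Equiv.Perm (Fin r), rename (Sum.map τ id) p = p) (f : Rr1 r) :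
    alt (p * f) = p * alt f := by
  rw [alt_apply, alt_apply, Finset.mul_sum]
  refine Finset.sum_congr rfl fun τ _ => ?_
  rw [map_mul, hp]
  ring

lemma alt_of_antisymm {f : Rr1 r}
    (hf : ∀ τ : Equiv.Perm (Fin r), rename (Sum.map τ id) f = ((Equiv.Perm.sign τ : ℤ) : Rr1 r) * f) :
    alt f = ((r.factorial : ℕ) : Rr1 r) * f := by
  rw [alt_apply]
  have : ∀ τ ∈ (Finset.univ : Finset (Equiv.Perm (Fin r))),
      ((Equiv.Perm.sign τ : ℤ) : Rr1 r) * rename (Sum.map τ id) f = f := fun τ _ => by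
    rw [hf, ← mul_assoc, perm_sign_mul_self, one_mul]
  rw [Finset.sum_congr rfl this, Finset.sum_const, Finset.card_univ, Fintype.card_perm,
    Fintype.card_fin, nsmul_eq_mul]

lemma rename_perm_alt (τ : Equiv.Perm (Fin r)) (f : Rr1 r) :
    rename (Sum.map τ id) (alt f) = ((Equiv.Perm.sign τ : ℤ) : Rr1 r) * alt f := by
  rw [alt_apply, map_sum, Finset.mul_sum]
  refine Fintype.sum_equiv (Equiv.mulLeft τ) _ _ fun ρ => ?_
  rw [map_mul, map_intCast, rename_rename, Equiv.coe_mulLeft, Equiv.Perm.sign_mul, Units.val_mul,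
    Int.cast_mul, ← mul_assoc, ← mul_assoc, perm_sign_mul_self, one_mul, Sum.map_comp_map]
  rfl

lemma alt_hom {f : Rr1 r} {n : ℕ} (hf : f.IsHomogeneous n) : (alt f).IsHomogeneous n := by
  rw [alt_apply]
  refine IsHomogeneous.sum _ _ _ fun τ _ => ?_
  have h := (isHomogeneous_C (Fin r ⊕ Unit) ((Equiv.Perm.sign τ : ℤ) : ℂ)).mul
    (hf.rename_isHomogeneous (f := Sum.map τ id))
  rwa [zero_add, map_intCast] at h

lemma rename_perm_mem_QIalg (τ : Equiv.Perm (Fin r)) {f : Rr1 r} (hf : f ∈ QIalg r m) :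
    rename (Sum.map τ id) f ∈ QIalg r m := by
  rw [mem_QIalg] at hf ⊢
  refine ⟨fun j => ?_, fun j k h => ?_⟩
  · obtain ⟨j, rfl⟩ := τ.surjective j
    have h := grad_rename (γ := gw r m) (e := τ.sumCongr (Equiv.refl Unit))
      (fun s => by rcases s with s | s <;> rfl) (yz j) f
    have e : rename (τ.sumCongr (Equiv.refl Unit)) (yz j) = yz (τ j) := rename_perm_yz τ j
    rw [e] at h
    change yz (τ j) ∣ grad (gw r m) (yz (τ j)) (rename (τ.sumCongr (Equiv.refl Unit)) f)
    rw [h, ← e]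
    exact map_dvd _ (hf.1 j)
  · obtain ⟨j, rfl⟩ := τ.surjective j
    obtain ⟨k, rfl⟩ := τ.surjective k
    have hjk : j ≠ k := fun e => h (congrArg τ e)
    have e : rename (ysw (τ j) (τ k)) (rename (Sum.map τ id) f) =
        rename (Sum.map τ id) (rename (ysw j k) f) := by
      rw [rename_rename, rename_rename]
      refine congrArg (fun g : Fin r ⊕ Unit → Fin r ⊕ Unit => rename g f) (funext fun s => ?_)
      rcases s with s | s
      · exact congrArg Sum.inl (congrArg (fun ρ : Equiv.Perm (Fin r) => ρ s)
          (Equiv.mul_swap_eq_swap_mul τ j k).symm :)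
      · rfl
    rw [e, ← rename_perm_yy, ← map_pow, ← map_sub]
    exact map_dvd _ (hf.2 j k hjk)

lemma alt_mem_QIalg {f : Rr1 r} (hf : f ∈ QIalg r m) : alt f ∈ QIalg r m := by
  rw [alt_apply]
  exact sum_mem fun τ _ => mul_mem (intCast_mem _ _) (rename_perm_mem_QIalg τ hf)

lemma vdm_pow_dvd_alt {f : Rr1 r} (hf : f ∈ QIalg r m) : vdm r ^ (2 * m + 1) ∣ alt f := by
  refine vdm_pow_dvd _ fun j k h => two_dvd_cancel ?_
  have h1 := (mem_QIalg.mp (alt_mem_QIalg hf)).2 j k h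
  rw [← rename_ysw, rename_perm_alt, Equiv.Perm.sign_swap h] at h1
  have e : alt f - (((-1 : ℤˣ) : ℤ) : Rr1 r) * alt f = 2 * alt f := by
    push_cast
    ring
  rwa [e] at h1

lemma exists_alt_eq {f : Rr1 r} (hf : f ∈ QIalg r m) {n : ℕ}
    (hn : f.IsHomogeneous ((2 * m + 1) * (r * (r - 1) / 2) + n)) :
    ∃ h : Rr1 r, alt f = vdm r ^ (2 * m + 1) * h ∧ h.IsHomogeneous n ∧
      ∀ τ : Equiv.Perm (Fin r), rename (Sum.map τ id) h = h := by
  obtain ⟨h, hh⟩ := vdm_pow_dvd_alt hf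
  have hv : (vdm r ^ (2 * m + 1)).IsHomogeneous ((2 * m + 1) * (r * (r - 1) / 2)) := by
    rw [mul_comm (2 * m + 1) (r * (r - 1) / 2)]
    exact (vdm_hom r).pow _
  have h1 := homogeneousComponent_eq_of_sum (LinearMap.mulLeft ℂ (vdm r ^ (2 * m + 1)))
    (fun i => (2 * m + 1) * (r * (r - 1) / 2) + i) (fun i g hg => hv.mul hg) n
    (fun i g _ h2 h3 => absurd (Nat.add_left_cancel h2) h3) h
  simp only [LinearMap.mulLeft_apply] at h1
  rw [← hh, homogeneousComponent_of_mem (alt_hom hn), if_pos rfl] at h1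
  refine ⟨_, h1, homogeneousComponent_isHomogeneous n h, fun τ => ?_⟩
  have h2 := rename_perm_alt τ f
  rw [h1, map_mul, rename_perm_vdm_pow] at h2
  have h3 : ((Equiv.Perm.sign τ : ℤ) : Rr1 r) ≠ 0 := left_ne_zero_of_mul_eq_one (perm_sign_mul_self τ)
  rw [mul_assoc] at h2
  exact mul_left_cancel₀ (pow_ne_zero _ (vdm_ne_zero r)) (mul_left_cancel₀ h3 h2)

end Alternation

section TopDegree

/-- The deformed power sums `m (y_1^i + ... + y_r^i) + z^i`, for `1 ≤ i ≤ r + 1`. -/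
def dps (r m : ℕ) (i : Fin (r + 1)) : Rr1 r := ∑ s, cw r m s • X s ^ (i + 1 : ℕ)

/-- The degree of the alternating generator. -/
def topDeg (r m : ℕ) : ℕ := (2 * m + 1) * (r * (r - 1) / 2) + 3 * r

/-- The alternating generator. -/
def topGen (r m : ℕ) : Rr1 r := vdm r ^ (2 * m + 1) * ∏ j, yz j ^ 3

variable {r m : ℕ}

lemma dps_mem_Qk (hm : 0 < m) (i : Fin (r + 1)) : dps r m i ∈ (qsys r m hm).Qk (i + 1) := by
  refine QSys.mem_Qk.mpr ⟨powerSum_mem r m _, IsHomogeneous.sum _ _ _ fun s _ => ?_⟩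
  rw [smul_eq_C_mul]
  have h := (isHomogeneous_C (Fin r ⊕ Unit) (cw r m s)).mul ((isHomogeneous_X ℂ s).pow (i + 1 : ℕ))
  rwa [zero_add, one_mul] at h

lemma rename_perm_dps (τ : Equiv.Perm (Fin r)) (i : Fin (r + 1)) :
    rename (Sum.map τ id) (dps r m i) = dps r m i := by
  rw [dps, map_sum, Fintype.sum_sum_type, Fintype.sum_sum_type]
  simp only [map_smul, map_pow, rename_X, Sum.map_inl, Sum.map_inr, id]
  refine congrArg₂ (· + ·) ?_ rfl
  exact Equiv.sum_comp τ fun j => cw r m (Sum.inl j) • (X (Sum.inl j) : Rr1 r) ^ (i + 1 : ℕ)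

lemma rename_perm_topGen (τ : Equiv.Perm (Fin r)) :
    rename (Sum.map τ id) (topGen r m) = ((Equiv.Perm.sign τ : ℤ) : Rr1 r) * topGen r m := by
  rw [topGen, map_mul, rename_perm_vdm_pow, map_prod, mul_assoc]
  simp only [map_pow, rename_perm_yz]
  rw [Equiv.prod_comp τ fun j => (yz j : Rr1 r) ^ 3]

lemma yy_dvd_vdm {j k : Fin r} (h : j ≠ k) : yy j k ∣ vdm r := by
  rcases lt_or_gt_of_ne h with h | h
  · rw [yy_comm, neg_dvd]
    exact (Finset.dvd_prod_of_mem (fun l => yy l j) (Finset.mem_Ioi.mpr h)).trans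
      (Finset.dvd_prod_of_mem (fun i => ∏ l ∈ Finset.Ioi i, yy l i) (Finset.mem_univ j))
  · exact (Finset.dvd_prod_of_mem (fun l => yy l k) (Finset.mem_Ioi.mpr h)).trans
      (Finset.dvd_prod_of_mem (fun i => ∏ l ∈ Finset.Ioi i, yy l i) (Finset.mem_univ k))

lemma topGen_mem_Qk (hm : 0 < m) : topGen r m ∈ (qsys r m hm).Qk (topDeg r m) := by
  refine QSys.mem_Qk.mpr ⟨?_, ?_⟩
  · change topGen r m ∈ QIalg r m
    refine mem_QIalg.mpr ⟨fun j => ?_, fun j k h => ?_⟩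
    · have h1 : yz j ^ 2 ∣ topGen r m := by
        refine Dvd.dvd.mul_left ?_ _
        exact (pow_dvd_pow _ (by omega)).trans (Finset.dvd_prod_of_mem (fun j => yz j ^ 3) (Finset.mem_univ j))
      obtain ⟨g, hg⟩ := h1
      rw [hg, pow_two, mul_assoc, Derivation.leibniz]
      refine dvd_add (dvd_mul_right _ _) ?_
      rw [smul_eq_mul, mul_assoc]
      exact dvd_mul_right _ _
    · rw [← rename_ysw, rename_perm_topGen]
      have h1 : yy j k ^ (2 * m + 1) ∣ topGen r m := (pow_dvd_pow_of_dvd (yy_dvd_vdm h) _).mul_right _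
      exact dvd_sub h1 (h1.mul_left _)
  · refine IsHomogeneous.mul ?_ ?_
    · rw [mul_comm (2 * m + 1) (r * (r - 1) / 2)]
      exact (vdm_hom r).pow _
    · have h : (∏ j : Fin r, yz j ^ 3).IsHomogeneous (∑ _j : Fin r, 1 * 3) :=
        IsHomogeneous.prod _ _ _ fun j _ => (yz_hom j).pow 3
      have e : ∑ _j : Fin r, 1 * 3 = 3 * r := by
        rw [Finset.sum_const, Finset.card_univ, Fintype.card_fin, smul_eq_mul, one_mul, mul_comm]
      rwa [e] at h

/-- The critical point: `m p_i + z^i` vanishes there for `1 ≤ i ≤ r`. -/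
lemma exists_critical_point (hm : 0 < m) (r : ℕ) :
    ∃ v : Fin r ⊕ Unit → ℂ, v (Sum.inr ()) = 1 ∧
      (∀ i : Fin r, eval v (esub r (Sum.inl i)) = (-1) ^ (i + 1 : ℕ) * (bcoef m (i + 1) : ℝ)) ∧
      (∀ i : Fin (r + 1), (i : ℕ) < r → eval v (dps r m i) = 0) ∧
      ∀ j, eval v (yz j) ≠ 0 := by
  obtain ⟨y, hy⟩ := exists_prod_X_sub_C_eq_sum r (fun i => ((bcoef m i : ℝ) : ℂ)) (by simp [bcoef_zero])
  refine ⟨Sum.elim y fun _ => 1, rfl, fun i => ?_, fun i hi => ?_, fun j hj => ?_⟩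
  · rw [← coe_aeval_eq_eval]
    change aeval _ _ = _
    rw [aeval_esub_inl]
    simp only [Sum.elim_inl]
    rw [hy, coeff_sum_C_mul_X_pow_sub r _ i.2]
  · have h := powerSums_of_esymm hm y (fun k hk => by
      rw [aeval_esymm_eq_coeff y hk, hy, coeff_sum_C_mul_X_pow_sub r _ hk]) (i + 1) (by omega) hi
    rw [dps, Fintype.sum_sum_type, ← h]
    simp [cw, smul_eval, Finset.mul_sum]
  · have h1 : y j = 1 := by simpa [yz, sub_eq_zero] using hj
    have h2 := congrArg (Polynomial.eval 1) hy
    rw [Polynomial.eval_prod, Finset.prod_eq_zero (Finset.mem_univ j) (by simp [h1]),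
      Polynomial.eval_finsetSum] at h2
    simp only [Polynomial.eval_mul, Polynomial.eval_C, Polynomial.eval_pow, Polynomial.eval_X, one_pow,
      mul_one] at h2
    rw [← Complex.ofReal_sum, sum_bcoef hm] at h2
    have h3 := bcoef_pos hm (r + 1)
    have h4 : 0 < (m : ℝ) * ((r + 1 : ℕ) : ℝ) * bcoef m (r + 1) := by positivity
    exact h4.ne (Complex.ofReal_eq_zero.mp h2.symm).symm

lemma topGen_notMem_Uk (hr : 0 < r) (hm : 0 < m) :
    topGen r m ∉ (qsys r m hm).Uk (dps r m) (topDeg r m) := by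
  obtain ⟨s, rfl⟩ : ∃ s, r = s + 1 := ⟨r - 1, by omega⟩
  obtain ⟨v, hv1, hv2, hv3, hv4⟩ := exists_critical_point hm (s + 1)
  intro hmem
  have key : ∀ f ∈ (qsys (s + 1) m hm).Uk (dps (s + 1) m) (topDeg (s + 1) m),
      ∃ h, alt f = vdm (s + 1) ^ (2 * m + 1) * h ∧ eval v h = 0 := by
    intro f hf
    induction hf using Submodule.span_induction with
    | mem f hf =>
      obtain ⟨i, a, g, ha, hg, rfl⟩ := hf
      obtain ⟨hgQ, hgh⟩ := QSys.mem_Qk.mp hg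
      have hi := i.2
      have hgQ' : g ∈ QIalg (s + 1) m := hgQ
      have ha' : a = (2 * m + 1) * ((s + 1) * (s + 1 - 1) / 2) + (3 * (s + 1) - (i + 1)) := by
        rw [topDeg] at ha
        omega
      obtain ⟨h, h1, h2, h3⟩ := exists_alt_eq hgQ' (ha' ▸ hgh)
      refine ⟨dps (s + 1) m i * h, ?_, ?_⟩
      · rw [alt_mul_of_symm fun τ => rename_perm_dps τ i, h1]
        ring
      · rw [map_mul]
        rcases Nat.lt_or_ge i (s + 1) with h4 | h4
        · rw [hv3 i h4, zero_mul]
        · have h5 : 3 * (s + 1) - ((i : ℕ) + 1) = 2 * s + 1 := by omega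
          rw [h5] at h2
          have h6 := (mem_QIalg.mp (alt_mem_QIalg hgQ')).1 0
          rw [h1] at h6
          rw [eval_eq_zero_of_first_order hm v hv2 hv1 h2 h3 h6, mul_zero]
    | zero => exact ⟨0, by rw [map_zero, mul_zero], map_zero _⟩
    | add f g _ _ hf hg =>
      obtain ⟨h, h1, h2⟩ := hf
      obtain ⟨h', h1', h2'⟩ := hg
      exact ⟨h + h', by rw [map_add, h1, h1', mul_add], by rw [map_add, h2, h2', add_zero]⟩
    | smul c f _ hf =>
      obtain ⟨h, h1, h2⟩ := hf
      exact ⟨c • h, by rw [map_smul, h1, mul_smul_comm], by rw [smul_eval, h2, mul_zero]⟩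
  obtain ⟨h, h1, h2⟩ := key _ hmem
  rw [alt_of_antisymm rename_perm_topGen, topGen, mul_left_comm] at h1
  rw [← mul_left_cancel₀ (pow_ne_zero _ (vdm_ne_zero _)) h1, map_mul, map_natCast, map_prod] at h2
  refine mul_ne_zero (Nat.cast_ne_zero.mpr (Nat.factorial_ne_zero _)) ?_ h2
  refine Finset.prod_ne_zero_iff.mpr fun j _ => ?_
  rw [map_pow]
  exact pow_ne_zero 3 (hv4 j)

lemma exists_degree_eq_topDeg (hr : 0 < r) (hm : 0 < m) {ι : Type} [Fintype ι] {d : ι → ℕ}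
    {g : ι → Rr1 r} (H : (qsys r m hm).IsGen (dps r m) d g) : ∃ i, d i = topDeg r m := by
  by_contra hcon
  push Not at hcon
  have h := H.le_sup (topDeg r m) (topGen_mem_Qk hm)
  have e : {f : Rr1 r | ∃ i, d i = topDeg r m ∧ f = g i} = ∅ :=
    Set.eq_empty_of_forall_notMem fun f ⟨i, hi, _⟩ => hcon i hi
  rw [e, Submodule.span_empty, sup_bot_eq] at h
  exact topGen_notMem_Uk hr hm h

end TopDegree

section HilbertSeries

variable {r m : ℕ}

lemma two_mul_topDeg (hr : 0 < r) : 2 * topDeg r m = 4 * Fintype.card (CondIdx r m) + (r + 1) * (r + 1 - 1) := by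
  have h := two_mul_card_CondIdx r m
  have h2 : r * (r - 1) / 2 * 2 = r * (r - 1) := Nat.div_mul_cancel (Nat.even_mul_pred_self r).two_dvd
  obtain ⟨s, rfl⟩ : ∃ s, r = s + 1 := ⟨r - 1, by omega⟩
  rw [topDeg]
  generalize (s + 1) * (s + 1 - 1) / 2 = a at h2
  simp only [Nat.add_sub_cancel] at h h2 ⊢
  linear_combination (2 * m + 1) * h2 - 2 * h

lemma topDeg_eq (hr : 0 < r) : topDeg r m = ∑ i, wts (r + 1) i + (m * r + 1) * (r - 1) := by
  have h2 : r * (r - 1) / 2 * 2 = r * (r - 1) := Nat.div_mul_cancel (Nat.even_mul_pred_self r).two_dvd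
  have h3 : (∑ i, wts (r + 1) i) * 2 = (r + 1) * (r + 2) := by
    have h := Finset.sum_range_id_mul_two (r + 2)
    rw [Finset.sum_range_succ' _ (r + 1), add_zero] at h
    rw [← Fin.sum_univ_eq_sum_range (fun i => i + 1) (r + 1)] at h
    change (∑ i : Fin (r + 1), ((i : ℕ) + 1)) * 2 = _
    rw [h, mul_comm]
    rfl
  refine Nat.eq_of_mul_eq_mul_right zero_lt_two ?_
  rw [add_mul, h3, topDeg]
  obtain ⟨s, rfl⟩ : ∃ s, r = s + 1 := ⟨r - 1, by omega⟩
  generalize (s + 1) * (s + 1 - 1) / 2 = a at h2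
  simp only [Nat.add_sub_cancel] at h2 ⊢
  linear_combination (2 * m + 1) * h2

lemma hd_eq_finrank_Qk (hm : 0 < m) (k : ℕ) : hd r m k = Module.finrank ℂ ((qsys r m hm).Qk k) := by
  have e : Submodule.span ℂ {f : Rr1 r | f ∈ QI1 r m ∧ f.IsHomogeneous k} = (qsys r m hm).Qk k := by
    refine le_antisymm (Submodule.span_le.mpr fun f hf => QSys.mem_Qk.mpr hf) fun f hf =>
      Submodule.subset_span ?_
    exact QSys.mem_Qk.mp hf
  rw [hd, e]

lemma exists_isGen_dps (r : ℕ) (hm : 0 < m) :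
    ∃ (ι : Type) (_ : Fintype ι) (d : ι → ℕ) (g : ι → Rr1 r),
      Fintype.card ι ≤ (r + 1).factorial ∧ (qsys r m hm).IsGen (dps r m) d g := by
  obtain ⟨G⟩ := (qsys r m hm).nonempty_gauss
  refine (qsys r m hm).exists_isGen (dps_mem_Qk hm) fun M => ?_
  let e : Fin (r + 1).factorial ≃ StIdx r := (Fintype.equivFinOfCardEq (card_StIdx r)).symm
  refine le_trans (Finset.sum_le_sum fun k _ => ?_) ((qsys r m hm).sum_finrank_Sol_le (n := r + 1) (cw r m)
    (fun i => powerSum_mem r m _) (fun a => stMon r (e a)) (fun k h hh => ?_) M)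
  · exact tsub_le_iff_left.mpr (QSys.Gauss.finrank_le G (dps_mem_Qk hm) k)
  · have h1 := mem_span_stMon_sup hm k h hh
    have h2 : (Set.range fun a => stMon r (e a)) = Set.range (stMon r) := e.surjective.range_comp (stMon r)
    rw [h2]
    exact h1

/-- The degrees of a minimal generating family are symmetric. -/
lemma exists_degrees (hr : 0 < r) (hm : 0 < m) :
    ∃ (ι : Type) (_ : Fintype ι) (d : ι → ℕ) (τ : Equiv.Perm ι),
      (∀ k, hd r m k = ∑ i, if d i ≤ k then wcount (wts (r + 1)) (k - d i) else 0) ∧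
      ∀ i, d (τ i) + d i = topDeg r m := by
  obtain ⟨ι, _, d, g, hN, H⟩ := exists_isGen_dps r hm
  have hσ : Fintype.card (Fin r ⊕ Unit) = r + 1 := by simp
  obtain ⟨i₀, hi₀⟩ := exists_degree_eq_topDeg hr hm H
  obtain ⟨τ, hτ⟩ := H.exists_perm (H.ker_eq_bot hσ hN) i₀
  refine ⟨ι, inferInstance, d, τ, fun k => ?_, fun i => ?_⟩
  · rw [hd_eq_finrank_Qk hm, H.finrank_eq hσ hN]
  · have h1 := H.four_mul_sum_le hσ hN _ (rho_le r m hm)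
    rw [← two_mul_topDeg hr, ← H.card_eq hσ hN] at h1
    rw [hi₀] at hτ
    have h2 : ∑ i, (d (τ i) + d i) = 2 * ∑ i, d i := by
      rw [Finset.sum_add_distrib, Equiv.sum_comp τ d, two_mul]
    have h3 : ∑ _i : ι, topDeg r m = Fintype.card ι * topDeg r m := by
      rw [Finset.sum_const, Finset.card_univ, smul_eq_mul]
    have h4 := Finset.sum_le_sum fun i (_ : i ∈ Finset.univ) => hτ i
    have h5 : ∑ _i : ι, topDeg r m = ∑ i, (d (τ i) + d i) := by
      refine le_antisymm h4 ?_
      rw [h2, h3]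
      linarith
    exact ((Finset.sum_eq_sum_iff_of_le fun i _ => hτ i).mp h5 i (Finset.mem_univ i)).symm

lemma mk_shift_eq {R : Type*} [CommRing R] (c : ℕ → ℕ) (d : ℕ) :
    (PowerSeries.mk fun k => ((if d ≤ k then c (k - d) else 0 : ℕ) : R)) =
      PowerSeries.X ^ d * PowerSeries.mk fun k => (c k : R) := by
  ext k
  rw [PowerSeries.coeff_mk, PowerSeries.coeff_X_pow_mul']
  split_ifs <;> simp

lemma mk_hd_mul {R ι : Type*} [CommRing R] [Fintype ι] {n : ℕ} {c : ℕ → ℕ} {d : ι → ℕ}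
    (hc : ∀ k, c k = ∑ i, if d i ≤ k then wcount (wts n) (k - d i) else 0) :
    (PowerSeries.mk fun k => (c k : R)) * ∏ i, (1 - PowerSeries.X ^ wts n i) =
      ∑ i, PowerSeries.X ^ d i := by
  have h : (PowerSeries.mk fun k => (c k : R)) =
      ∑ i, PowerSeries.X ^ d i * PowerSeries.mk fun k => (wcount (wts n) k : R) := by
    simp only [← mk_shift_eq]
    ext k
    rw [map_sum]
    simp only [PowerSeries.coeff_mk]
    rw [hc, Nat.cast_sum]
  rw [h, ← Finset.sum_mul, mul_assoc, mul_comm (PowerSeries.mk _), prod_mul_mk_wcount R (wts_pos n),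
    mul_one]

lemma pow_mul_prod_one_sub_inv {K : Type*} [Field K] {n : ℕ} (w : Fin n → ℕ) {x : K} (hx : x ≠ 0) :
    x ^ (∑ i, w i) * ∏ i, (1 - x⁻¹ ^ w i) = (-1) ^ n * ∏ i, (1 - x ^ w i) := by
  have h : ((-1 : K)) ^ n = ∏ _i : Fin n, (-1) := by simp
  rw [h, ← Finset.prod_pow_eq_pow_sum, ← Finset.prod_mul_distrib, ← Finset.prod_mul_distrib]
  refine Finset.prod_congr rfl fun i _ => ?_
  rw [mul_sub, inv_pow, mul_inv_cancel₀ (pow_ne_zero _ hx)]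
  ring

lemma pow_mul_sum_inv {K ι : Type*} [Field K] [Fintype ι] {d : ι → ℕ} {D : ℕ} (τ : Equiv.Perm ι)
    (h : ∀ i, d (τ i) + d i = D) {x : K} (hx : x ≠ 0) :
    x ^ D * ∑ i, x⁻¹ ^ d i = ∑ i, x ^ d i := by
  rw [← Equiv.sum_comp τ fun i => x ^ d i, Finset.mul_sum]
  refine Finset.sum_congr rfl fun i _ => ?_
  rw [← h i, pow_add, mul_assoc, ← mul_pow, mul_inv_cancel₀ hx, one_pow, mul_one]

end HilbertSeries

/-- (M. Feigin) For `m > 1`, `r ≥ 2` and `n = mr + 1`, the Hilbert series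
`P_{r;m}(t) = Σ_k dim Λ_r(m)^{(k)} t^k` is a rational function `p/q` satisfying the
functional equation `P_{r;m}(t⁻¹) = (−1)^{r+1} t^{n(1−r)} P_{r;m}(t)`; consequently, by
Stanley's criterion, the Cohen–Macaulay graded domain `Λ_r(m)` is Gorenstein. -/
theorem hilbert_series_functional_equation (r m : ℕ) (hr : 2 ≤ r) (hm : 1 < m) :
    ∃ p q : Polynomial ℚ, q ≠ 0 ∧
      (PowerSeries.mk fun k => (hd r m k : ℚ)) * (q : PowerSeries ℚ) =
        (p : PowerSeries ℚ) ∧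
      ∀ x : ℚ, x ≠ 0 → Polynomial.eval x q ≠ 0 → Polynomial.eval x⁻¹ q ≠ 0 →
        Polynomial.eval x⁻¹ p / Polynomial.eval x⁻¹ q =
          (-1 : ℚ) ^ (r + 1) * x ^ (((m * r + 1 : ℕ) : ℤ) * (1 - (r : ℤ))) *
            (Polynomial.eval x p / Polynomial.eval x q) := by
  obtain ⟨ι, _, d, τ, hd, hτ⟩ := exists_degrees (m := m) (r := r) (by omega) (by omega)
  have hp : ∀ x : ℚ, Polynomial.eval x (∑ i, Polynomial.X ^ d i) = ∑ i, x ^ d i := fun x => by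
    simp [Polynomial.eval_finsetSum]
  have hq : ∀ x : ℚ, Polynomial.eval x (∏ i, (1 - Polynomial.X ^ wts (r + 1) i)) =
      ∏ i, (1 - x ^ wts (r + 1) i) := fun x => by
    simp [Polynomial.eval_prod]
  refine ⟨∑ i, Polynomial.X ^ d i, ∏ i, (1 - Polynomial.X ^ wts (r + 1) i), fun h => ?_, ?_, ?_⟩
  · have h1 := hq 0
    rw [h, Polynomial.eval_zero] at h1
    refine one_ne_zero (α := ℚ) (h1.trans (Finset.prod_eq_one fun i _ => ?_)).symm
    rw [zero_pow (wts_pos _ i).ne', sub_zero]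
  · have h1 : ((∏ i, (1 - Polynomial.X ^ wts (r + 1) i) : Polynomial ℚ) : PowerSeries ℚ) =
        ∏ i, (1 - PowerSeries.X ^ wts (r + 1) i) := by
      rw [← Polynomial.coeToPowerSeries.ringHom_apply, map_prod]
      simp
    have h2 : ((∑ i, Polynomial.X ^ d i : Polynomial ℚ) : PowerSeries ℚ) = ∑ i, PowerSeries.X ^ d i := by
      rw [← Polynomial.coeToPowerSeries.ringHom_apply, map_sum]
      simp
    rw [h1, h2, mk_hd_mul hd]
  · intro x hx h1 h2
    rw [hq] at h1 h2
    rw [hp, hp, hq, hq]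
    have e1 := pow_mul_prod_one_sub_inv (wts (r + 1)) hx
    have e2 := pow_mul_sum_inv τ hτ hx
    rw [topDeg_eq (by omega), pow_add] at e2
    have e3 : x ^ (((m * r + 1 : ℕ) : ℤ) * (1 - (r : ℤ))) = (x ^ ((m * r + 1) * (r - 1)))⁻¹ := by
      rw [← zpow_natCast, ← zpow_neg]
      refine congrArg (fun t : ℤ => x ^ t) ?_
      rw [Nat.cast_mul, Nat.cast_sub (by omega), Nat.cast_one]
      ring
    have e4 : ((-1 : ℚ) ^ (r + 1)) * (-1) ^ (r + 1) = 1 := by rw [← mul_pow]; norm_num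
    have h3 : x ^ ((m * r + 1) * (r - 1)) ≠ 0 := pow_ne_zero _ hx
    have h4 : x ^ (∑ i, wts (r + 1) i) ≠ 0 := pow_ne_zero _ hx
    rw [e3, ← e2]
    have e5 : ∏ i, (1 - x ^ wts (r + 1) i) =
        (-1) ^ (r + 1) * (x ^ (∑ i, wts (r + 1) i) * ∏ i, (1 - x⁻¹ ^ wts (r + 1) i)) := by
      rw [e1, ← mul_assoc, e4, one_mul]
    rw [e5]
    generalize (-1 : ℚ) ^ (r + 1) = ε at e4
    have h5 : ε ≠ 0 := left_ne_zero_of_mul_eq_one e4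
    field_simp
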